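/- arXiv:1205.5314 — 2 statements merged into one kernel-verified Lean document; each statement's English description precedes it below -/
import Mathlib

section
/- Let Ω be an open bounded subset of ℝ^d, V a Hilbert space continuously embedded in C_0^3(Ω,ℝ^d), and v, h ∈ V^{[0,1]}. Then for every x ∈ Ω the map ε ↦ log det Dφ^{v+εh}_1(x) is differentiable at ε = 0 and ∂_ε log det Dφ^{v+εh}_1(x)|_{ε=0} = ∫₀¹ [ h_u · ∇ log det Dφ^v_{u1} + div h_u ] ∘ φ^v_u(x) du, where φ^v_u = φ^v_{0u} and φ^v_{u1} is the flow from time u to time 1. -/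
open MeasureTheory Set Filter
open scoped RealInnerProductSpace BigOperators Topology

noncomputable section

abbrev Euc (d : ℕ) := EuclideanSpace ℝ (Fin d)

/-- The `C^k` sup-norm `‖f‖_{k,∞} = Σ_{j≤k} sup_{|β|=j} sup_Ω |D^β f|` over `Ω`,
expressed via iterated Fréchet derivatives. -/
def CknormOn {d : ℕ} (k : ℕ) (Ω : Set (Euc d)) (f : Euc d → Euc d) : ℝ :=
  ∑ j ∈ Finset.range (k + 1), ⨆ x ∈ Ω, ‖iteratedFDeriv ℝ j f x‖

/-- Membership in `C_0^k(Ω, ℝ^d)`: `C^k` on `Ω`, with all derivatives of order `≤ k`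
extending continuously by `0` to the boundary of `Ω`. -/
def MemC0k {d : ℕ} (k : ℕ) (Ω : Set (Euc d)) (f : Euc d → Euc d) : Prop :=
  ContDiffOn ℝ k f Ω ∧
    ∀ j ≤ k, ∀ x ∈ frontier Ω,
      Tendsto (iteratedFDeriv ℝ j f) (𝓝[Ω] x) (𝓝 0)

/-- `v ∈ V^{[0,1]}`: a measurable map `[0,1] → V` with `∫₀¹ ‖v_t‖² dt < ∞`. -/
def InV01 {V : Type*} [NormedAddCommGroup V] [MeasurableSpace V] (v : ℝ → V) : Prop :=
  Measurable v ∧ IntegrableOn (fun t => ‖v t‖ ^ 2) (Icc (0:ℝ) 1)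

/-- The norm `‖v‖_{V^{[0,1]}} = (∫₀¹ ‖v_t‖² dt)^{1/2}`. -/
def normV01 {V : Type*} [NormedAddCommGroup V] (v : ℝ → V) : ℝ :=
  Real.sqrt (∫ t in (0:ℝ)..1, ‖v t‖ ^ 2)

/-- Divergence of a vector field: the trace of its Jacobian. -/
def divg {d : ℕ} (f : Euc d → Euc d) (x : Euc d) : ℝ :=
  LinearMap.trace ℝ (Euc d) (fderiv ℝ f x : Euc d →ₗ[ℝ] Euc d)

lemma ac_of_dist_le {X Y : Type*} [PseudoMetricSpace X] [PseudoMetricSpace Y] {f : ℝ → X} {g : ℝ → Y} {a b : ℝ}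
    (hg : AbsolutelyContinuousOnInterval g a b)
    (h : ∀ x ∈ uIcc a b, ∀ y ∈ uIcc a b, dist (f x) (f y) ≤ dist (g x) (g y)) :
    AbsolutelyContinuousOnInterval f a b := by
  rw [absolutelyContinuousOnInterval_iff] at hg ⊢
  intro ε hε
  obtain ⟨δ, hδ, H⟩ := hg ε hε
  refine ⟨δ, hδ, fun E hE hs => lt_of_le_of_lt ?_ (H E hE hs)⟩
  refine Finset.sum_le_sum fun i hi => ?_
  exact h _ (hE.1 i hi).1 _ (hE.1 i hi).2

lemma ac_chain {X : Type*} [NormedAddCommGroup X] [NormedSpace ℝ X] [CompleteSpace X]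
    {a b : ℝ} (hab : a ≤ b) {w : ℝ → X} (hw : IntervalIntegrable w volume a b)
    {y : ℝ → X} {y0 : X} (hy : ∀ t ∈ Icc a b, y t = y0 + ∫ u in a..t, w u)
    {g : X → ℝ} (hg : ContDiff ℝ 1 g) :
    ∫ u in a..b, fderiv ℝ g (y u) (w u) = g (y b) - g (y a) := by
  have hii : ∀ s ∈ Icc a b, ∀ t ∈ Icc a b, IntervalIntegrable w volume s t := fun s hs t ht =>
    hw.mono_set (by rw [uIcc_of_le hab]; exact uIcc_subset_Icc hs ht)
  set Y : ℝ → X := fun t => y0 + ∫ u in a..t, w u with hY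
  have hYc : ContinuousOn Y (uIcc a b) :=
    continuousOn_const.add (intervalIntegral.continuousOn_primitive_interval
      (by rw [uIcc_of_le hab, integrableOn_Icc_iff_integrableOn_Ioc]; exact hw.1))
  obtain ⟨L, hL⟩ : ∃ L, LipschitzOnWith L g (Y '' uIcc a b) :=
    (hg.locallyLipschitz.locallyLipschitzOn (s := _)).exists_lipschitzOnWith_of_compact
      (isCompact_uIcc.image_of_continuousOn hYc)
  have hac : AbsolutelyContinuousOnInterval (fun t => g (Y t)) a b := by
    have h1 := (hw.norm.absolutelyContinuousOnInterval_intervalIntegral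
      (left_mem_uIcc)).const_mul (L : ℝ)
    refine ac_of_dist_le h1 ?_
    intro s hs t ht
    have h2 := hL.dist_le_mul (Y s) (mem_image_of_mem _ hs) (Y t) (mem_image_of_mem _ ht)
    refine h2.trans ?_
    rw [uIcc_of_le hab] at hs ht
    have ha : a ∈ Icc a b := left_mem_Icc.2 hab
    rw [Real.dist_eq, ← mul_sub, abs_mul, NNReal.abs_eq,
      intervalIntegral.integral_interval_sub_left (hii a ha s hs).norm (hii a ha t ht).norm]
    gcongr
    rw [dist_eq_norm, hY]
    simp only [add_sub_add_left_eq_sub]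
    rw [intervalIntegral.integral_interval_sub_left (hii a ha s hs) (hii a ha t ht)]
    exact intervalIntegral.norm_integral_le_abs_integral_norm
  have hfin := hac.integral_deriv_eq_sub
  have e1 : Y b = y b := (hy b (right_mem_Icc.2 hab)).symm
  have e2 : Y a = y a := (hy a (left_mem_Icc.2 hab)).symm
  simp only [e1, e2] at hfin
  rw [← hfin]
  refine intervalIntegral.integral_congr_ae ?_
  filter_upwards [hw.ae_hasDerivAt_integral] with t ht htm
  have htm' : t ∈ uIcc a b := uIoc_subset_uIcc htm
  have h3 : HasDerivAt Y (w t) t := (ht htm' a left_mem_uIcc).const_add y0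
  have h4 := ((hg.differentiable one_ne_zero (Y t)).hasFDerivAt.comp_hasDerivAt t h3).deriv
  have e3 : y t = Y t := hy t (by rwa [uIcc_of_le hab] at htm')
  rw [e3]
  exact h4.symm

/-- integrals of nonneg coefficient are antitone etc.  Gronwall with integrable coefficient. -/
lemma gronwall_int {a b A : ℝ} {k g : ℝ → ℝ} (hk : IntervalIntegrable k volume a b)
    (hk0 : ∀ u ∈ Icc a b, 0 ≤ k u) (hgc : ContinuousOn g (Icc a b))
    (h : ∀ t ∈ Icc a b, g t ≤ A + ∫ u in a..t, k u * g u) :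
    ∀ t ∈ Icc a b, g t ≤ A * Real.exp (∫ u in a..t, k u) := by
  intro t ht
  have hab : a ≤ b := ht.1.trans ht.2
  have hkt : IntervalIntegrable k volume a t := hk.mono_set (by
    rw [uIcc_of_le hab, uIcc_of_le ht.1]; exact Icc_subset_Icc_right ht.2)
  have hgt : ContinuousOn g (Icc a t) := hgc.mono (Icc_subset_Icc_right ht.2)
  have hkg : IntervalIntegrable (fun u => k u * g u) volume a t :=
    hkt.mul_continuousOn (by rwa [uIcc_of_le ht.1])
  have hg2 : ContDiff ℝ 1 (fun p : ℝ × ℝ => Real.exp (-p.1) * p.2) := by fun_prop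
  have hpair : IntervalIntegrable (fun u => (k u, k u * g u)) volume a t :=
    ⟨hkt.1.prodMk hkg.1, hkt.2.prodMk hkg.2⟩
  have hch := ac_chain (y := fun s => (∫ u in a..s, k u, A + ∫ u in a..s, k u * g u))
    (y0 := ((0 : ℝ), A)) ht.1 hpair (by
      intro s hs
      have hs1 : IntervalIntegrable k volume a s := hkt.mono_set (by
        rw [uIcc_of_le ht.1, uIcc_of_le hs.1]; exact Icc_subset_Icc_right hs.2)
      have hs2 : IntervalIntegrable (fun u => k u * g u) volume a s := hkg.mono_set (by
        rw [uIcc_of_le ht.1, uIcc_of_le hs.1]; exact Icc_subset_Icc_right hs.2)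
      have hs3 : IntervalIntegrable (fun u => (k u, k u * g u)) volume a s :=
        ⟨hs1.1.prodMk hs2.1, hs1.2.prodMk hs2.2⟩
      have i1 := (ContinuousLinearMap.fst ℝ ℝ ℝ).intervalIntegral_comp_comm hs3
      have i2 := (ContinuousLinearMap.snd ℝ ℝ ℝ).intervalIntegral_comp_comm hs3
      simp only [ContinuousLinearMap.coe_fst', ContinuousLinearMap.coe_snd'] at i1 i2
      ext
      · simp [← i1]
      · simp [← i2]) hg2
  have hle : ∫ u in a..t, fderiv ℝ (fun p : ℝ × ℝ => Real.exp (-p.1) * p.2)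
      (∫ r in a..u, k r, A + ∫ r in a..u, k r * g r) (k u, k u * g u) ≤ 0 := by
    have : 0 ≤ ∫ u in a..t, - fderiv ℝ (fun p : ℝ × ℝ => Real.exp (-p.1) * p.2)
      (∫ r in a..u, k r, A + ∫ r in a..u, k r * g r) (k u, k u * g u) := by
      refine intervalIntegral.integral_nonneg ht.1 fun u hu => ?_
      have hd : ∀ p q : ℝ × ℝ, fderiv ℝ (fun p : ℝ × ℝ => Real.exp (-p.1) * p.2) p q
          = Real.exp (-p.1) * (q.2 - q.1 * p.2) := by
        intro p q
        have h1 : HasFDerivAt (fun p : ℝ × ℝ => Real.exp (-p.1) * p.2) _ p :=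
          ((hasFDerivAt_fst (𝕜 := ℝ) (p := p)).neg.exp).mul (hasFDerivAt_snd (𝕜 := ℝ) (p := p))
        rw [h1.fderiv]
        simp
        ring
      rw [hd, ← mul_neg]
      have hu' : u ∈ Icc a b := ⟨hu.1, hu.2.trans ht.2⟩
      have := mul_le_mul_of_nonneg_left (h u hu') (hk0 u hu')
      refine mul_nonneg (Real.exp_pos _).le ?_
      simp only
      linarith
    rw [intervalIntegral.integral_neg] at this
    linarith
  rw [hch] at hle
  simp at hle
  have h5 := h t ht
  rw [Real.exp_neg] at hle
  have hpos := Real.exp_pos (∫ u in a..t, k u)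
  rw [inv_mul_le_iff₀ hpos] at hle
  linarith

lemma int_exp {a t : ℝ} {k : ℝ → ℝ} (hat : a ≤ t) (hk : IntervalIntegrable k volume a t) :
    ∫ u in a..t, k u * Real.exp (2 * ∫ r in a..u, k r) = (Real.exp (2 * ∫ u in a..t, k u) - 1) / 2 := by
  have hg : ContDiff ℝ 1 (fun p : ℝ => Real.exp (2 * p)/2) := by fun_prop
  have hch := ac_chain (y := fun s => ∫ u in a..s, k u) (y0 := (0 : ℝ)) hat hk
    (by intro s hs; simp) hg
  have hd : ∀ p q : ℝ, fderiv ℝ (fun p : ℝ => Real.exp (2 * p) / 2) p q = q * Real.exp (2 * p) := by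
    intro p q
    have h1 : HasDerivAt (fun p : ℝ => Real.exp (2 * p) / 2) _ p :=
      ((((hasDerivAt_id p).const_mul 2)).exp).div_const 2
    rw [h1.hasFDerivAt.fderiv]
    simp
  simp only [hd] at hch
  rw [hch]
  simp
  ring

lemma ii_apply {X Y : Type*} [NormedAddCommGroup X] [NormedSpace ℝ X]
    [NormedAddCommGroup Y] [NormedSpace ℝ Y] {a c : ℝ} (hac : a ≤ c)
    {A : ℝ → X →L[ℝ] Y} (hA : IntervalIntegrable A volume a c) {f : ℝ → X}
    (hf : ContinuousOn f (Icc a c)) : IntervalIntegrable (fun u => A u (f u)) volume a c := by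
  obtain ⟨C, hC⟩ := isCompact_Icc.exists_bound_of_continuousOn hf
  rw [intervalIntegrable_iff_integrableOn_Icc_of_le hac] at hA ⊢
  refine Integrable.mono' (hA.norm.mul_const C) ?_ ?_
  · exact (ContinuousLinearMap.id ℝ (X →L[ℝ] Y)).aestronglyMeasurable_comp₂ hA.aestronglyMeasurable
      (hf.aestronglyMeasurable measurableSet_Icc)
  · filter_upwards [ae_restrict_mem measurableSet_Icc] with u hu
    exact (A u).le_opNorm_of_le (hC u hu)

lemma cont_prim {X : Type*} [NormedAddCommGroup X] [NormedSpace ℝ X] {a c : ℝ} (hac : a ≤ c)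
    {w : ℝ → X} (hw : IntervalIntegrable w volume a c) :
    ContinuousOn (fun t => ∫ u in a..t, w u) (Icc a c) := by
  rw [← uIcc_of_le hac]
  exact intervalIntegral.continuousOn_primitive_interval
      (by rw [uIcc_of_le hac, integrableOn_Icc_iff_integrableOn_Ioc]; exact hw.1)

lemma ii_sub {X : Type*} [NormedAddCommGroup X] {a c s t : ℝ} {w : ℝ → X}
    (hw : IntervalIntegrable w volume a c) (hs : s ∈ Icc a c) (ht : t ∈ Icc a c) :
    IntervalIntegrable w volume s t :=
  hw.mono_set (by rw [uIcc_of_le (hs.1.trans hs.2)]; exact uIcc_subset_Icc hs ht)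

lemma lin_exists {X : Type*} [NormedAddCommGroup X] [NormedSpace ℝ X] [CompleteSpace X]
    {a c : ℝ} (hac : a ≤ c) {A : ℝ → X → X} {k : ℝ → ℝ} (hk : IntervalIntegrable k volume a c)
    (hA : ∀ f : ℝ → X, ContinuousOn f (Icc a c) → IntervalIntegrable (fun u => A u (f u)) volume a c)
    (hAk : ∀ u ∈ Icc a c, ∀ x x', ‖A u x - A u x'‖ ≤ k u * ‖x - x'‖) (hk0 : ∀ u, 0 ≤ k u)
    {b : ℝ → X} (hb : ContinuousOn b (Icc a c)) :
    ∃ f : ℝ → X, ContinuousOn f (Icc a c) ∧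
      ∀ t ∈ Icc a c, f t = b t + ∫ u in a..t, A u (f u) := by
  have haI : a ∈ Icc a c := left_mem_Icc.2 hac
  have hK := cont_prim hac hk
  set K : ℝ → ℝ := fun t => ∫ u in a..t, k u with hKdef
  have hE : ContinuousOn (fun t => Real.exp (2 * K t)) (Icc a c) := by fun_prop
  have hE' : ContinuousOn (fun t => Real.exp (-(2 * K t))) (Icc a c) := by fun_prop
  have hint : ∀ g : C(Icc a c, X), IntervalIntegrable
      (fun u => A u (Real.exp (2 * K u) • g (projIcc a c hac u))) volume a c := fun g =>
    hA _ (hE.smul (by fun_prop))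
  let T : C(Icc a c, X) → C(Icc a c, X) := fun g =>
    ⟨fun t => Real.exp (-(2 * K t)) • (b t + ∫ u in a..t,
      A u (Real.exp (2 * K u) • g (projIcc a c hac u))), by
      have : ContinuousOn (fun t => Real.exp (-(2 * K t)) • (b t + ∫ u in a..t,
        A u (Real.exp (2 * K u) • g (projIcc a c hac u)))) (Icc a c) :=
        hE'.smul (hb.add (cont_prim hac (hint g)))
      exact this.comp_continuous continuous_subtype_val (fun t => t.2)⟩
  have hTa : ∀ g t, T g t = Real.exp (-(2 * K t)) • (b t + ∫ u in a..t,
      A u (Real.exp (2 * K u) • g (projIcc a c hac u))) := fun _ _ => rfl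
  have hT : ContractingWith (1/2) T := by
    refine ⟨by rw [← NNReal.coe_lt_coe]; norm_num, ?_⟩
    refine LipschitzWith.of_dist_le_mul fun g1 g2 => ?_
    rw [ContinuousMap.dist_le (by positivity)]
    intro t
    rw [dist_eq_norm]
    have hta : (t : ℝ) ∈ Icc a c := t.2
    rw [hTa, hTa, ← smul_sub, add_sub_add_left_eq_sub, ← intervalIntegral.integral_sub
      (ii_sub (hint g1) haI hta) (ii_sub (hint g2) haI hta), norm_smul, Real.norm_eq_abs, Real.abs_exp]
    have hb1 : ‖∫ u in a..(t:ℝ), (A u (Real.exp (2 * K u) • g1 (projIcc a c hac u))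
        - A u (Real.exp (2 * K u) • g2 (projIcc a c hac u)))‖
        ≤ ∫ u in a..(t:ℝ), (k u * Real.exp (2 * K u)) * dist g1 g2 := by
      refine intervalIntegral.norm_integral_le_of_norm_le hta.1 ?_ ?_
      · refine Filter.Eventually.of_forall fun u hu => ?_
        refine (hAk u ⟨hu.1.le, hu.2.trans hta.2⟩ _ _).trans ?_
        rw [← smul_sub, norm_smul, Real.norm_eq_abs, Real.abs_exp, mul_assoc]
        have := hk0 u
        gcongr
        rw [← dist_eq_norm]
        exact ContinuousMap.dist_apply_le_dist _
      · refine IntervalIntegrable.mul_const ?_ _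
        refine (ii_sub hk haI hta).mul_continuousOn ?_
        rw [uIcc_of_le hta.1]
        exact hE.mono (Icc_subset_Icc_right hta.2)
    rw [intervalIntegral.integral_mul_const, int_exp hta.1 (ii_sub hk haI hta)] at hb1
    calc _ ≤ Real.exp (-(2 * K t)) * ((Real.exp (2 * K t) - 1) / 2 * dist g1 g2) := by gcongr
      _ ≤ Real.exp (-(2 * K t)) * ((Real.exp (2 * K t)) / 2 * dist g1 g2) := by
        gcongr; linarith
      _ = (Real.exp (-(2 * K t)) * (Real.exp (2 * K t))) * (1 / 2 * dist g1 g2) := by ring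
      _ = _ := by rw [← Real.exp_add]; simp
  obtain ⟨g, hg⟩ : ∃ g, T g = g := ⟨_, hT.fixedPoint_isFixedPt⟩
  refine ⟨fun u => Real.exp (2 * K u) • g (projIcc a c hac u), hE.smul (by fun_prop), ?_⟩
  intro t ht
  have h1 : T g ⟨t, ht⟩ = g ⟨t, ht⟩ := by rw [hg]
  rw [hTa] at h1
  simp only
  rw [projIcc_of_mem hac ht, ← h1, smul_smul, ← Real.exp_add]
  simp

/-- differentiability in a parameter -/
lemma param_deriv {P W : Type*} [NormedAddCommGroup P] [NormedSpace ℝ P]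
    [NormedAddCommGroup W] [NormedSpace ℝ W] [CompleteSpace W]
    {a c : ℝ} (hac : a ≤ c) {p0 : P} {N : Set P} (hN : N ∈ 𝓝 p0)
    {F : P → ℝ → W → W} {y : P → ℝ → W} (α : P →L[ℝ] W) (a0 : W)
    (hyc : ∀ p ∈ N, ContinuousOn (y p) (Icc a c))
    (hyi : ∀ p ∈ N, IntervalIntegrable (fun u => F p u (y p u)) volume a c)
    (hy : ∀ p ∈ N, ∀ t ∈ Icc a c, y p t = (a0 + α p) + ∫ u in a..t, F p u (y p u))
    {k : ℝ → ℝ} (hk : IntervalIntegrable k volume a c) (hk0 : ∀ u, 0 ≤ k u)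
    (hlip : ∀ p ∈ N, ∀ u ∈ Icc a c, ∀ w w', ‖F p u w - F p0 u w'‖ ≤ k u * (‖w - w'‖ + ‖p - p0‖))
    {A : ℝ → W →L[ℝ] W} {B : ℝ → P →L[ℝ] W}
    (hA : IntervalIntegrable A volume a c) (hB : IntervalIntegrable B volume a c)
    (hAk : ∀ u ∈ Icc a c, ‖A u‖ ≤ k u) (hBk : ∀ u ∈ Icc a c, ‖B u‖ ≤ k u)
    (hF : ∀ u ∈ Icc a c, HasFDerivAt (fun q : P × W => F q.1 u q.2) ((B u).coprod (A u)) (p0, y p0 u)) :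
    ∃ η : ℝ → P →L[ℝ] W, ContinuousOn η (Icc a c) ∧
      (∀ t ∈ Icc a c, η t = α + ∫ u in a..t, ((A u).comp (η u) + B u)) ∧
      (IntervalIntegrable (fun u => (A u).comp (η u) + B u) volume a c) ∧
      ∀ t ∈ Icc a c, HasFDerivAt (fun p => y p t) (η t) p0 := by
  have haI : a ∈ Icc a c := left_mem_Icc.2 hac
  have hp0 : p0 ∈ N := mem_of_mem_nhds hN
  -- solve the linear equation
  have hA' : ∀ f : ℝ → P →L[ℝ] W, ContinuousOn f (Icc a c) →
      IntervalIntegrable (fun u => (A u).comp (f u)) volume a c := by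
    intro f hf
    obtain ⟨C, hC⟩ := isCompact_Icc.exists_bound_of_continuousOn hf
    rw [intervalIntegrable_iff_integrableOn_Icc_of_le hac] at hA ⊢
    refine Integrable.mono' (hA.norm.mul_const C) ?_ ?_
    · exact (ContinuousLinearMap.compL ℝ P W W).aestronglyMeasurable_comp₂ hA.aestronglyMeasurable
        (hf.aestronglyMeasurable measurableSet_Icc)
    · filter_upwards [ae_restrict_mem measurableSet_Icc] with u hu
      refine ((A u).opNorm_comp_le _).trans ?_
      exact mul_le_mul_of_nonneg_left (hC u hu) (norm_nonneg _)
  obtain ⟨η, hηc, hη⟩ := lin_exists hac (A := fun u x => (A u).comp x) hk hA' (by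
      intro u hu x x'
      rw [← ContinuousLinearMap.comp_sub]
      refine ((A u).opNorm_comp_le _).trans ?_
      exact mul_le_mul_of_nonneg_right (hAk u hu) (norm_nonneg _)) hk0
    (b := fun t => α + ∫ u in a..t, B u)
    (continuousOn_const.add (cont_prim hac hB))
  have hi1 : IntervalIntegrable (fun u => (A u).comp (η u)) volume a c := hA' _ hηc
  have hη' : ∀ t ∈ Icc a c, η t = α + ∫ u in a..t, ((A u).comp (η u) + B u) := by
    intro t ht
    rw [hη t ht, intervalIntegral.integral_add (ii_sub hi1 haI ht) (ii_sub hB haI ht)]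
    abel
  refine ⟨η, hηc, hη', hi1.add hB, ?_⟩
  set E : ℝ := Real.exp (∫ u in a..c, k u) with hEdef
  have hKle : ∀ t ∈ Icc a c, Real.exp (∫ u in a..t, k u) ≤ E := by
    intro t ht
    refine Real.exp_le_exp.2 ?_
    refine intervalIntegral.integral_mono_interval le_rfl ht.1 ht.2 ?_ hk
    exact Filter.Eventually.of_forall fun u => hk0 u
  have hE0 : 0 < E := Real.exp_pos _
  set C : ℝ := (‖α‖ + ∫ u in a..c, k u) * E with hC
  -- Lipschitz dependence
  have hLip : ∀ p ∈ N, ∀ t ∈ Icc a c, ‖y p t - y p0 t‖ ≤ C * ‖p - p0‖ := by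
    intro p hp
    have h1 := gronwall_int (A := (‖α‖ + ∫ u in a..c, k u) * ‖p - p0‖)
      (g := fun t => ‖y p t - y p0 t‖) hk (fun u _ => hk0 u) ((hyc p hp).sub (hyc p0 hp0)).norm ?_
    · intro t ht
      refine (h1 t ht).trans ?_
      have h2 := hKle t ht
      have h3 : 0 ≤ ∫ u in a..c, k u := intervalIntegral.integral_nonneg hac fun u _ => hk0 u
      calc _ ≤ (‖α‖ + ∫ u in a..c, k u) * ‖p - p0‖ * E := by gcongr
        _ = _ := by rw [hC]; ring
    · intro t ht
      rw [hy p hp t ht, hy p0 hp0 t ht, add_sub_add_comm, add_sub_add_left_eq_sub, ← map_sub,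
        ← intervalIntegral.integral_sub (ii_sub (hyi p hp) haI ht) (ii_sub (hyi p0 hp0) haI ht)]
      have hkt := ii_sub hk haI ht
      have hi2 : IntervalIntegrable (fun u => k u * ‖y p u - y p0 u‖) volume a t :=
        hkt.mul_continuousOn (by
          rw [uIcc_of_le ht.1]
          exact (((hyc p hp).sub (hyc p0 hp0)).norm).mono (Icc_subset_Icc_right ht.2))
      have hb : ‖∫ u in a..t, (F p u (y p u) - F p0 u (y p0 u))‖ ≤
          ∫ u in a..t, (k u * ‖y p u - y p0 u‖ + k u * ‖p - p0‖) := by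
        refine intervalIntegral.norm_integral_le_of_norm_le ht.1 ?_ (hi2.add (hkt.mul_const _))
        refine Filter.Eventually.of_forall fun u hu => ?_
        rw [← mul_add]
        exact hlip p hp u ⟨hu.1.le, hu.2.trans ht.2⟩ _ _
      rw [intervalIntegral.integral_add hi2 (hkt.mul_const _),
        intervalIntegral.integral_mul_const] at hb
      have hmono : ∫ u in a..t, k u ≤ ∫ u in a..c, k u :=
        intervalIntegral.integral_mono_interval le_rfl ht.1 ht.2
          (Filter.Eventually.of_forall fun u => hk0 u) hk
      have hm2 := mul_le_mul_of_nonneg_right hmono (norm_nonneg (p - p0))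
      have := norm_add_le (α (p - p0)) (∫ u in a..t, (F p u (y p u) - F p0 u (y p0 u)))
      have := α.le_opNorm (p - p0)
      linarith
  have hC0 : 0 ≤ C := by
    have h3 : 0 ≤ ∫ u in a..c, k u := intervalIntegral.integral_nonneg hac fun u _ => hk0 u
    positivity
  -- remainder
  set ρ : P → ℝ → W := fun p u => F p u (y p u) - F p0 u (y p0 u) - A u (y p u - y p0 u) - B u (p - p0)
    with hρ
  have hρi : ∀ p ∈ N, IntervalIntegrable (ρ p) volume a c := by
    intro p hp
    refine (((hyi p hp).sub (hyi p0 hp0)).sub (ii_apply hac hA ((hyc p hp).sub (hyc p0 hp0)))).sub ?_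
    exact ii_apply hac hB continuousOn_const
  have hρb : ∀ p ∈ N, ∀ u ∈ Icc a c, ‖ρ p u‖ ≤ (2 * k u * (C + 1)) * ‖p - p0‖ := by
    intro p hp u hu
    have h1 := hlip p hp u hu (y p u) (y p0 u)
    have h2 := (A u).le_of_opNorm_le (hAk u hu) (y p u - y p0 u)
    have h3 := (B u).le_of_opNorm_le (hBk u hu) (p - p0)
    have h4 := hLip p hp u hu
    have h5 := mul_le_mul_of_nonneg_left h4 (hk0 u)
    have h6 : ‖ρ p u‖ ≤ _ := (norm_sub_le _ _).trans (add_le_add_left (norm_sub_le _ _) _)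
    nlinarith [hk0 u]
  have hρo : ∀ u ∈ Icc a c, Tendsto (fun p => ‖ρ p u‖ / ‖p - p0‖) (𝓝 p0) (𝓝 0) := by
    intro u hu
    have h1 := (hF u hu).isLittleO
    have htend : Tendsto (fun p => (p, y p u)) (𝓝 p0) (𝓝 (p0, y p0 u)) := by
      refine tendsto_id.prodMk_nhds ?_
      rw [tendsto_iff_norm_sub_tendsto_zero]
      refine squeeze_zero' (g := fun p => C * ‖p - p0‖) (Filter.Eventually.of_forall fun _ => norm_nonneg _) ?_ ?_
      · filter_upwards [hN] with p hp using hLip p hp u hu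
      · have : Tendsto (fun p => C * ‖p - p0‖) (𝓝 p0) (𝓝 (C * ‖p0 - p0‖)) :=
          Continuous.tendsto (by fun_prop) _
        simpa using this
    have h2 := h1.comp_tendsto htend
    have h3 : (fun p => ((p, y p u) : P × W) - (p0, y p0 u)) =O[𝓝 p0] fun p => p - p0 := by
      refine Asymptotics.IsBigO.of_bound (C + 1) ?_
      filter_upwards [hN] with p hp
      have := hLip p hp u hu
      have h0 := norm_nonneg (p - p0)
      rw [Prod.mk_sub_mk, Prod.norm_mk, max_le_iff]
      constructor <;> nlinarith
    have h4 : (fun p => ρ p u) =o[𝓝 p0] fun p => p - p0 := by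
      refine (h2.trans_isBigO h3).congr_left ?_
      intro p
      simp [hρ]
      abel
    exact h4.norm_norm.tendsto_div_nhds_zero
  have hI : Tendsto (fun p => ∫ u in a..c, ‖ρ p u‖ / ‖p - p0‖) (𝓝 p0) (𝓝 0) := by
    have h0 : (0:ℝ) = ∫ u in a..c, (0:ℝ) := by simp
    rw [h0]
    refine tendsto_of_seq_tendsto fun x hx => ?_
    refine intervalIntegral.tendsto_integral_filter_of_dominated_convergence
      (fun u => 2 * k u * (C + 1)) ?_ ?_ ?_ ?_
    · filter_upwards [hx hN] with n hn
      have := ((hρi _ hn).norm.div_const ‖x n - p0‖)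
      exact this.aestronglyMeasurable_restrict_uIoc
    · filter_upwards [hx hN] with n hn
      refine Filter.Eventually.of_forall fun u hu => ?_
      rw [uIoc_of_le hac] at hu
      have hu' := Ioc_subset_Icc_self hu
      have := hρb _ hn u hu'
      rw [Real.norm_of_nonneg (by positivity)]
      have h2 : 0 ≤ 2 * k u * (C + 1) := by have := hk0 u; positivity
      rcases eq_or_lt_of_le (norm_nonneg (x n - p0)) with h | h
      · rw [← h]; simpa using h2
      · rwa [div_le_iff₀ h]
    · exact (hk.const_mul 2).mul_const _
    · refine Filter.Eventually.of_forall fun u hu => ?_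
      rw [uIoc_of_le hac] at hu
      exact (hρo u (Ioc_subset_Icc_self hu)).comp hx
  intro t ht
  rw [hasFDerivAt_iff_isLittleO]
  have hmain : ∀ p ∈ N, ‖y p t - y p0 t - η t (p - p0)‖ ≤ (∫ u in a..c, ‖ρ p u‖) * E := by
    intro p hp
    have hηp : ContinuousOn (fun u => η u (p - p0)) (Icc a c) := hηc.clm_apply continuousOn_const
    have hΔc : ContinuousOn (fun u => y p u - y p0 u - η u (p - p0)) (Icc a c) :=
      ((hyc p hp).sub (hyc p0 hp0)).sub hηp
    have h1 := gronwall_int (A := ∫ u in a..c, ‖ρ p u‖)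
      (g := fun t => ‖y p t - y p0 t - η t (p - p0)‖) hk (fun u _ => hk0 u) hΔc.norm ?_ t ht
    · refine h1.trans ?_
      have : 0 ≤ ∫ u in a..c, ‖ρ p u‖ := intervalIntegral.integral_nonneg hac fun u _ => norm_nonneg _
      have := hKle t ht
      gcongr
    · intro s hs
      have hkt := ii_sub hk haI hs
      have e1 : y p s - y p0 s - η s (p - p0)
          = ∫ u in a..s, (ρ p u + A u (y p u - y p0 u - η u (p - p0))) := by
        have i1 := ii_sub (hyi p hp) haI hs
        have i2 := ii_sub (hyi p0 hp0) haI hs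
        have i3 := ii_sub (hi1.add hB) haI hs
        have i4 : IntervalIntegrable (fun u => ((A u).comp (η u) + B u) (p - p0)) volume a s :=
          ii_apply hs.1 i3 continuousOn_const
        have e2 : η s (p - p0) = α (p - p0) + ∫ u in a..s, ((A u).comp (η u) + B u) (p - p0) := by
          rw [hη' s hs, _root_.add_apply,
            ContinuousLinearMap.intervalIntegral_apply i3]
        rw [e2, hy p hp s hs, hy p0 hp0 s hs, add_sub_add_comm, add_sub_add_left_eq_sub, ← map_sub,
          ← intervalIntegral.integral_sub i1 i2, add_sub_add_left_eq_sub,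
          ← intervalIntegral.integral_sub (i1.sub i2) i4]
        congr 1
        ext u
        simp [hρ]
        abel
      have hiρ := ii_sub (hρi p hp) haI hs
      have hi2 : IntervalIntegrable (fun u => k u * ‖y p u - y p0 u - η u (p - p0)‖) volume a s :=
        hkt.mul_continuousOn (by
          rw [uIcc_of_le hs.1]
          exact hΔc.norm.mono (Icc_subset_Icc_right hs.2))
      rw [e1]
      have hb : ‖∫ u in a..s, (ρ p u + A u (y p u - y p0 u - η u (p - p0)))‖ ≤
          ∫ u in a..s, (‖ρ p u‖ + k u * ‖y p u - y p0 u - η u (p - p0)‖) := by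
        refine intervalIntegral.norm_integral_le_of_norm_le hs.1 ?_ (hiρ.norm.add hi2)
        refine Filter.Eventually.of_forall fun u hu => ?_
        refine (norm_add_le _ _).trans (add_le_add_right ?_ _)
        exact (A u).le_of_opNorm_le (hAk u ⟨hu.1.le, hu.2.trans hs.2⟩) _
      rw [intervalIntegral.integral_add hiρ.norm hi2] at hb
      refine hb.trans (add_le_add_left ?_ _)
      exact intervalIntegral.integral_mono_interval le_rfl hs.1 hs.2
          (Filter.Eventually.of_forall fun u => norm_nonneg _) (hρi p hp).norm
  rw [← Asymptotics.isLittleO_norm_norm]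
  have hO : (fun p => (∫ u in a..c, ‖ρ p u‖) * E) =o[𝓝 p0] fun p => ‖p - p0‖ := by
    refine Asymptotics.isLittleO_of_tendsto ?_ ?_
    · intro p hp
      rw [norm_eq_zero, sub_eq_zero] at hp
      subst hp
      simp [hρ]
    · have := hI.mul_const E
      simp only [zero_mul, intervalIntegral.integral_div] at this
      refine this.congr fun p => ?_
      ring
  refine Asymptotics.IsBigO.trans_isLittleO ?_ hO
  refine Asymptotics.IsBigO.of_bound 1 ?_
  filter_upwards [hN] with p hp
  rw [norm_norm, one_mul]
  exact (hmain p hp).trans (le_abs_self _)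

lemma not_all_measurable_real : ¬ ∀ s : Set ℝ, MeasurableSet s := by
  intro h
  have h1 : Cardinal.mk {t : Set ℝ | MeasurableSet t} ≤ Cardinal.continuum := by
    have hg : (inferInstance : MeasurableSpace ℝ) = MeasurableSpace.generateFrom (range Iio) := by
      rw [← borel_eq_generateFrom_Iio]; exact BorelSpace.measurable_eq
    have := MeasurableSpace.cardinal_measurableSet_le_continuum (s := range (Iio : ℝ → Set ℝ))
      (Cardinal.mk_range_le.trans (by rw [Cardinal.mk_real]))
    rwa [← hg] at this
  have h2 : {t : Set ℝ | MeasurableSet t} = univ := by ext t; simp [h t]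
  rw [h2, Cardinal.mk_univ, Cardinal.mk_set, Cardinal.mk_real] at h1
  exact absurd h1 (not_le.2 (Cardinal.cantor _))

lemma exists_sep {X : Type*} [MetricSpace X] (s : Set X)
    (hs : ¬ TopologicalSpace.IsSeparable s) :
    ∃ δ : ℝ, 0 < δ ∧ ∃ D ⊆ s, ¬ D.Countable ∧ D.Pairwise (fun x y => δ ≤ dist x y) := by
  by_contra hcon
  push Not at hcon
  apply hs
  obtain ⟨t, -, ht, hst⟩ := EMetric.subset_countable_closure_of_almost_dense_set s (by
    intro ε hε
    obtain ⟨δ, hδ0, hδ⟩ := ENNReal.lt_iff_exists_nnreal_btwn.1 hε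
    have hδ0' : (0:ℝ) < δ := by exact_mod_cast hδ0
    obtain ⟨D, hD⟩ := zorn_subset {D : Set X | D ⊆ s ∧ D.Pairwise (fun x y => (δ:ℝ) ≤ dist x y)} (by
      intro c hc hch
      refine ⟨⋃₀ c, ⟨sUnion_subset fun a ha => (hc ha).1, ?_⟩, fun a ha => subset_sUnion_of_mem ha⟩
      rw [pairwise_sUnion hch.directedOn]
      exact fun a ha => (hc ha).2)
    refine ⟨D, ?_, ?_⟩
    · by_contra hDc
      exact hcon δ hδ0' D hD.prop.1 hDc hD.prop.2
    · intro x hx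
      by_contra hxD
      simp only [mem_iUnion, not_exists, Metric.mem_closedEBall, not_le] at hxD
      have hfar : ∀ y ∈ D, (δ:ℝ) ≤ dist x y := by
        intro y hy
        have h1 := hδ.trans (hxD y hy)
        rw [edist_nndist, ENNReal.coe_lt_coe] at h1
        exact_mod_cast h1.le
      have hxnD : x ∉ D := fun hxD' => by have := hfar x hxD'; simp at this; linarith
      have hins : insert x D ∈ {D : Set X | D ⊆ s ∧ D.Pairwise (fun x y => (δ:ℝ) ≤ dist x y)} := by
        refine ⟨insert_subset hx hD.prop.1, ?_⟩
        refine hD.prop.2.insert fun y hy _ => ⟨hfar y hy, ?_⟩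
        rw [dist_comm]; exact hfar y hy
      exact hxnD (hD.le_of_ge hins (subset_insert x D) (mem_insert x D)))
  exact ⟨t, ht, hst⟩

lemma separable_range {X : Type*} [MetricSpace X] [MeasurableSpace X] [BorelSpace X]
    {f : ℝ → X} (hf : Measurable f) : TopologicalSpace.IsSeparable (range f) := by
  by_contra hs
  obtain ⟨δ, hδ, D, hDs, hDc, hDp⟩ := exists_sep _ hs
  have hcl : ∀ S ⊆ D, MeasurableSet (f ⁻¹' S) := by
    intro S hS
    have : IsClosed S := Metric.isClosed_of_pairwise_le_dist hδ (hDp.mono hS)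
    exact hf this.measurableSet
  -- section
  choose! j hj using fun x (hx : x ∈ D) => hDs hx
  have hjD : ∀ x ∈ D, f (j x) = x := hj
  let T : Set ℝ := j '' D
  let r : ℝ → ℝ := fun a => j (f a)
  have hTeq : T = f ⁻¹' D ∩ {a | r a = a} := by
    ext a
    constructor
    · rintro ⟨x, hx, rfl⟩
      refine ⟨by simpa [hjD x hx] using hx, ?_⟩
      simp [r, hjD x hx]
    · rintro ⟨h1, h2⟩
      exact ⟨f a, h1, h2⟩
  have hTsub : ∀ S ⊆ T, S = T ∩ f ⁻¹' (f '' S) := by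
    intro S hS
    apply Subset.antisymm
    · exact fun a ha => ⟨hS ha, mem_image_of_mem f ha⟩
    · rintro a ⟨haT, b, hb, hba⟩
      obtain ⟨x, hx, rfl⟩ := haT
      obtain ⟨y, hy, rfl⟩ := hS hb
      rw [hjD x hx, hjD y hy] at hba
      rwa [← hba]
  have hfT : ∀ S ⊆ T, f '' S ⊆ D := by
    rintro S hS _ ⟨a, ha, rfl⟩
    obtain ⟨x, hx, rfl⟩ := hS ha
    rwa [hjD x hx]
  have hTm : MeasurableSet T := by
    have hA := hcl D Subset.rfl
    -- measurable version of r
    classical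
    let r' : ℝ → ℝ := fun a => if a ∈ f ⁻¹' D then r a else a + 1
    have hr' : Measurable r' := by
      intro B hB
      have : r' ⁻¹' B = (f ⁻¹' (D ∩ j ⁻¹' B)) ∪ ((f ⁻¹' D)ᶜ ∩ (fun a => a + 1) ⁻¹' B) := by
        ext a
        by_cases ha : f a ∈ D <;> simp [r', r, ha]
      rw [this]
      exact (hcl _ inter_subset_left).union (hA.compl.inter ((measurable_id.add_const 1) hB))
    have : T = {a | r' a = a} := by
      rw [hTeq]
      ext a
      by_cases ha : f a ∈ D <;> simp [r', ha]
    rw [this]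
    exact measurableSet_eq_fun hr' measurable_id
  have hall : ∀ S ⊆ T, MeasurableSet S := by
    intro S hS
    rw [hTsub S hS]
    exact hTm.inter (hcl _ (hfT S hS))
  have hTunc : ¬ Countable T := by
    intro h
    apply hDc
    have h2 : (f '' T).Countable := (Set.to_countable T).image f
    exact h2.mono (show D ⊆ f '' T from fun x hx => ⟨j x, mem_image_of_mem j hx, hjD x hx⟩)
  have : StandardBorelSpace T := hTm.standardBorel
  have e : T ≃ᵐ ℝ := PolishSpace.measurableEquivOfNotCountable hTunc
    (by rw [← Cardinal.mk_le_aleph0_iff, Cardinal.mk_real]; exact not_le.2 Cardinal.aleph0_lt_continuum)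
  apply not_all_measurable_real
  intro s
  have h3 : MeasurableSet ((Subtype.val : T → ℝ) '' (e ⁻¹' s)) := hall _ (by
    rintro _ ⟨a, _, rfl⟩; exact a.2)
  have h4 : MeasurableSet (e ⁻¹' s) := by
    have := (measurable_subtype_coe : Measurable (Subtype.val : T → ℝ)) h3
    rwa [preimage_image_eq _ Subtype.val_injective] at this
  exact (e.measurableSet_preimage).1 h4

lemma InV01.sm {V : Type*} [NormedAddCommGroup V] [MeasurableSpace V] [BorelSpace V]
    {v : ℝ → V} (hv : InV01 v) : StronglyMeasurable v :=
  stronglyMeasurable_iff_measurable_separable.2 ⟨hv.1, separable_range hv.1⟩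

lemma InV01.add_smul {V : Type*} [NormedAddCommGroup V] [NormedSpace ℝ V] [MeasurableSpace V]
    [BorelSpace V] {v h : ℝ → V} (hv : InV01 v) (hh : InV01 h) (e : ℝ) :
    InV01 (fun u => v u + e • h u) := by
  have hsm : StronglyMeasurable (fun u => v u + e • h u) := hv.sm.add (hh.sm.const_smul e)
  refine ⟨hsm.measurable, ?_⟩
  refine Integrable.mono' ((hv.2.const_mul 2).add (hh.2.const_mul (2 * e ^ 2))) ?_ ?_
  · exact (hsm.norm.pow 2).aestronglyMeasurable
  · refine Filter.Eventually.of_forall fun u => ?_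
    rw [Real.norm_of_nonneg (by positivity)]
    have h1 := norm_add_le (v u) (e • h u)
    rw [norm_smul, Real.norm_eq_abs] at h1
    have h2 : ‖v u + e • h u‖ ^ 2 ≤ (‖v u‖ + |e| * ‖h u‖) ^ 2 := by gcongr
    simp only [Pi.add_apply]
    have h3 : e ^ 2 = |e| ^ 2 := (sq_abs e).symm
    rw [h3]
    nlinarith [sq_nonneg (‖v u‖ - |e| * ‖h u‖)]

lemma InV01.norm_int {V : Type*} [NormedAddCommGroup V] [MeasurableSpace V]
    [BorelSpace V] {v : ℝ → V} (hv : InV01 v) : IntegrableOn (fun u => ‖v u‖) (Icc (0:ℝ) 1) := by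
  have h1 : IntegrableOn (fun _ : ℝ => (1:ℝ)) (Icc (0:ℝ) 1) := by simp
  refine Integrable.mono' (h1.add hv.2) hv.sm.norm.aestronglyMeasurable ?_
  refine Filter.Eventually.of_forall fun u => ?_
  simp only [norm_norm, Pi.add_apply]
  nlinarith [sq_nonneg (‖v u‖ - 1)]

lemma ind_continuous {E G : Type*} [TopologicalSpace E] [NormedAddCommGroup G]
    {Ω : Set E} (hΩ : IsOpen Ω) {g : E → G} (hg : ContinuousOn g Ω)
    (h0 : ∀ b ∈ frontier Ω, Tendsto g (𝓝[Ω] b) (𝓝 0)) : Continuous (Ω.indicator g) := by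
  rw [continuous_iff_continuousAt]
  intro x
  by_cases hx : x ∈ Ω
  · refine (hg.continuousAt (hΩ.mem_nhds hx)).congr ?_
    filter_upwards [hΩ.mem_nhds hx] with y hy
    rw [indicator_of_mem hy]
  · rw [ContinuousAt, indicator_of_notMem hx]
    have h1 : Tendsto (Ω.indicator g) (𝓝[Ω] x) (𝓝 0) := by
      by_cases hc : x ∈ closure Ω
      · refine (h0 x ⟨hc, by rwa [hΩ.interior_eq]⟩).congr' ?_
        filter_upwards [self_mem_nhdsWithin] with y hy
        rw [indicator_of_mem hy]
      · have : 𝓝[Ω] x = ⊥ := by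
          rw [← not_neBot]; rwa [mem_closure_iff_nhdsWithin_neBot] at hc
        rw [this]; exact tendsto_bot
    have h2 : Tendsto (Ω.indicator g) (𝓝[Ωᶜ] x) (𝓝 0) := by
      refine tendsto_const_nhds.congr' ?_
      filter_upwards [self_mem_nhdsWithin] with y hy
      rw [indicator_of_notMem hy]
    have h3 := h1.sup h2
    rwa [← nhdsWithin_union, union_compl_self, nhdsWithin_univ] at h3

lemma ind_hasFDerivAt {E G : Type*} [NormedAddCommGroup E] [NormedSpace ℝ E]
    [NormedAddCommGroup G] [NormedSpace ℝ G]
    {Ω : Set E} (hΩ : IsOpen Ω) {g : E → G} {g' : E → E →L[ℝ] G}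
    (hg : ∀ x ∈ Ω, HasFDerivAt g (g' x) x)
    (h0 : ∀ b ∈ frontier Ω, Tendsto g (𝓝[Ω] b) (𝓝 0))
    (h0' : ∀ b ∈ frontier Ω, Tendsto g' (𝓝[Ω] b) (𝓝 0)) (x : E) :
    HasFDerivAt (Ω.indicator g) (Ω.indicator g' x) x := by
  have hcont : Continuous (Ω.indicator g) :=
    ind_continuous hΩ (fun x hx => (hg x hx).continuousAt.continuousWithinAt) h0
  have hin : ∀ x ∈ Ω, HasFDerivAt (Ω.indicator g) (g' x) x := by
    intro x hx
    refine (hg x hx).congr_of_eventuallyEq ?_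
    filter_upwards [hΩ.mem_nhds hx] with y hy
    rw [indicator_of_mem hy]
  by_cases hx : x ∈ Ω
  · rw [indicator_of_mem hx]; exact hin x hx
  rw [indicator_of_notMem hx]
  by_cases hc : x ∈ closure Ω
  swap
  · refine (hasFDerivAt_const (0:G) x).congr_of_eventuallyEq ?_
    filter_upwards [isClosed_closure.isOpen_compl.mem_nhds hc] with y hy
    rw [indicator_of_notMem fun h => hy (subset_closure h)]
  have hb := h0' x ⟨hc, by rwa [hΩ.interior_eq]⟩
  rw [hasFDerivAt_iff_isLittleO, Asymptotics.isLittleO_iff]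
  intro ε hε
  have h1 : ∀ᶠ y in 𝓝 x, y ∈ Ω → ‖g' y‖ < ε := by
    have := hb.norm
    rw [norm_zero] at this
    exact eventually_nhdsWithin_iff.1 (this.eventually (gt_mem_nhds hε))
  obtain ⟨δ, hδ, hball⟩ := Metric.eventually_nhds_iff_ball.1 h1
  filter_upwards [Metric.ball_mem_nhds x hδ] with y hy
  rw [indicator_of_notMem hx]
  simp only [sub_zero, _root_.zero_apply]
  by_cases hyΩ : y ∈ Ω
  swap
  · rw [indicator_of_notMem hyΩ, norm_zero]; positivity
  let γ : ℝ → E := fun t => y + t • (x - y)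
  have hγ : Continuous γ := by fun_prop
  have hK : IsCompact (Icc (0:ℝ) 1 ∩ γ ⁻¹' Ωᶜ) :=
    isCompact_Icc.inter_right (hΩ.isClosed_compl.preimage hγ)
  obtain ⟨T, hT, hTl⟩ := hK.exists_isLeast ⟨1, by simp, by simpa [γ] using hx⟩
  have hlt : ∀ t ∈ Ico (0:ℝ) T, γ t ∈ Ω := by
    intro t ht
    by_contra hcon
    exact absurd (hTl ⟨⟨ht.1, ht.2.le.trans hT.1.2⟩, hcon⟩) (not_le.2 ht.2)
  have hγb : ∀ t ∈ Icc (0:ℝ) 1, γ t ∈ Metric.ball x δ := by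
    intro t ht
    have := (convex_ball x δ).add_smul_sub_mem hy (Metric.mem_ball_self hδ) ht
    exact this
  have hγd : ∀ t, HasDerivAt γ (x - y) t := by
    intro t
    have := ((hasDerivAt_id t).smul_const (x - y)).const_add y
    rw [one_smul] at this
    exact this
  have h2 := norm_image_sub_le_of_norm_deriv_right_le_segment
    (f := fun t => Ω.indicator g (γ t)) (f' := fun t => g' (γ t) (x - y))
    (a := 0) (b := T) (C := ε * ‖x - y‖) (hcont.comp hγ).continuousOn
    (fun t ht => ((hin _ (hlt t ht)).comp_hasDerivAt t (hγd t)).hasDerivWithinAt)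
    (fun t ht => (ContinuousLinearMap.le_opNorm _ _).trans (by
      have := hball _ (hγb t ⟨ht.1, ht.2.le.trans hT.1.2⟩) (hlt t ht)
      gcongr)) T ⟨hT.1.1, le_rfl⟩
  have h3 : γ 0 = y := by simp [γ]
  simp only [h3] at h2
  rw [indicator_of_notMem hT.2, zero_sub, norm_neg, sub_zero] at h2
  refine h2.trans ?_
  rw [norm_sub_rev x y]
  exact mul_le_of_le_one_right (by positivity) hT.1.2

/-- vector fields indexed by `V`, with two bounded derivatives, globally defined -/
structure ExtFld (d : ℕ) (V : Type*) [NormedAddCommGroup V] [NormedSpace ℝ V] where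
  T0 : V → Euc d → Euc d
  T1 : V → Euc d → (Euc d →L[ℝ] Euc d)
  T2 : V → Euc d → (Euc d →L[ℝ] (Euc d →L[ℝ] Euc d))
  C : ℝ
  hC : 0 ≤ C
  add0 : ∀ f g y, T0 (f + g) y = T0 f y + T0 g y
  smul0 : ∀ (r : ℝ) f y, T0 (r • f) y = r • T0 f y
  hd0 : ∀ f y, HasFDerivAt (T0 f) (T1 f y) y
  hd1 : ∀ f y, HasFDerivAt (T1 f) (T2 f y) y
  hc2 : ∀ f, Continuous (T2 f)
  b0 : ∀ f y, ‖T0 f y‖ ≤ C * ‖f‖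
  b1 : ∀ f y, ‖T1 f y‖ ≤ C * ‖f‖
  b2 : ∀ f y, ‖T2 f y‖ ≤ C * ‖f‖

lemma c0k_iter_cont {d : ℕ} {Ω : Set (Euc d)} (hΩ : IsOpen Ω) {f : Euc d → Euc d}
    (hf : MemC0k 3 Ω f) {j : ℕ} (hj : j ≤ 3) : ContinuousOn (iteratedFDeriv ℝ j f) Ω := by
  intro x hx
  have h1 : ContDiffAt ℝ 3 f x := hf.1.contDiffAt (hΩ.mem_nhds hx)
  have h2 : ContDiffAt ℝ 0 (iteratedFDeriv ℝ j f) x :=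
    h1.iteratedFDeriv_right (by rw [zero_add]; exact_mod_cast hj)
  exact h2.continuousAt.continuousWithinAt

lemma c0k_bound {d : ℕ} {Ω : Set (Euc d)} (hΩ : IsOpen Ω) (hΩb : Bornology.IsBounded Ω)
    {f : Euc d → Euc d} (hf : MemC0k 3 Ω f) {j : ℕ} (hj : j ≤ 3) {x : Euc d} (hx : x ∈ Ω) :
    ‖iteratedFDeriv ℝ j f x‖ ≤ CknormOn 3 Ω f := by
  have hnn : ∀ i, 0 ≤ ⨆ x ∈ Ω, ‖iteratedFDeriv ℝ i f x‖ := fun i =>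
    Real.iSup_nonneg fun x => Real.iSup_nonneg fun _ => norm_nonneg _
  have hci := ind_continuous hΩ (c0k_iter_cont hΩ hf hj) (hf.2 j hj)
  obtain ⟨M, hM⟩ := (hΩb.isCompact_closure.image hci.norm).bddAbove
  have hM' : ∀ y ∈ Ω, ‖iteratedFDeriv ℝ j f y‖ ≤ M := by
    intro y hy
    have := hM (mem_image_of_mem _ (subset_closure hy))
    simpa only [indicator_of_mem hy] using this
  have hM0 : 0 ≤ M := (norm_nonneg _).trans (hM' x hx)
  have h1 : ‖iteratedFDeriv ℝ j f x‖ ≤ ⨆ x ∈ Ω, ‖iteratedFDeriv ℝ j f x‖ := by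
    have hb : BddAbove (range fun y => ⨆ (_ : y ∈ Ω), ‖iteratedFDeriv ℝ j f y‖) := by
      refine ⟨M, ?_⟩
      rintro _ ⟨y, rfl⟩
      exact Real.iSup_le (fun hy => hM' y hy) hM0
    have h2 := le_ciSup hb x
    simpa only [ciSup_pos hx] using h2
  refine h1.trans ?_
  unfold CknormOn
  exact Finset.single_le_sum (f := fun j => ⨆ x ∈ Ω, ‖iteratedFDeriv ℝ j f x‖)
    (fun i _ => hnn i) (Finset.mem_range.2 (by omega))

lemma norm_iter_two {d : ℕ} (f : Euc d → Euc d) (x : Euc d) :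
    ‖fderiv ℝ (fderiv ℝ f) x‖ = ‖iteratedFDeriv ℝ 2 f x‖ := by
  rw [← norm_iteratedFDeriv_fderiv, norm_iteratedFDeriv_one]

def mkExt {d : ℕ} (Ω : Set (Euc d)) (hΩo : IsOpen Ω) (hΩb : Bornology.IsBounded Ω)
    (V : Type*) [NormedAddCommGroup V] [InnerProductSpace ℝ V]
    (ι : V →ₗ[ℝ] (Euc d → Euc d))
    (c : ℝ) (hc : 0 < c)
    (hemb : ∀ f : V, MemC0k 3 Ω (ι f) ∧ CknormOn 3 Ω (ι f) ≤ c * ‖f‖) : ExtFld d V where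
  T0 f := Ω.indicator (ι f)
  T1 f := Ω.indicator (fderiv ℝ (ι f))
  T2 f := Ω.indicator (fderiv ℝ (fderiv ℝ (ι f)))
  C := c
  hC := hc.le
  add0 f g y := by
    by_cases hy : y ∈ Ω <;> simp [hy]
  smul0 r f y := by
    by_cases hy : y ∈ Ω <;> simp [hy]
  hd0 f y := by
    refine ind_hasFDerivAt hΩo (fun x hx => ?_) ?_ ?_ y
    · exact (((hemb f).1.1.contDiffAt (hΩo.mem_nhds hx)).differentiableAt (by norm_num)).hasFDerivAt
    · intro b hb
      have := ((hemb f).1.2 0 (by norm_num) b hb)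
      rw [tendsto_zero_iff_norm_tendsto_zero] at this ⊢
      simpa only [norm_iteratedFDeriv_zero] using this
    · intro b hb
      have := ((hemb f).1.2 1 (by norm_num) b hb)
      rw [tendsto_zero_iff_norm_tendsto_zero] at this ⊢
      simpa only [norm_iteratedFDeriv_one] using this
  hd1 f y := by
    refine ind_hasFDerivAt hΩo (fun x hx => ?_) ?_ ?_ y
    · have h1 : ContDiffAt ℝ 2 (fderiv ℝ (ι f)) x :=
        ((hemb f).1.1.contDiffAt (hΩo.mem_nhds hx)).fderiv_right (by norm_num)
      exact (h1.differentiableAt (by norm_num)).hasFDerivAt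
    · intro b hb
      have := ((hemb f).1.2 1 (by norm_num) b hb)
      rw [tendsto_zero_iff_norm_tendsto_zero] at this ⊢
      simpa only [norm_iteratedFDeriv_one] using this
    · intro b hb
      have := ((hemb f).1.2 2 (by norm_num) b hb)
      rw [tendsto_zero_iff_norm_tendsto_zero] at this ⊢
      simpa only [norm_iter_two] using this
  hc2 f := by
    refine ind_continuous (G := Euc d →L[ℝ] (Euc d →L[ℝ] Euc d)) hΩo (fun x hx => ?_) ?_
    · have h1 : ContDiffAt ℝ 2 (fderiv ℝ (ι f)) x :=
        ((hemb f).1.1.contDiffAt (hΩo.mem_nhds hx)).fderiv_right (by norm_num)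
      have h2 : ContDiffAt ℝ 1 (fderiv ℝ (fderiv ℝ (ι f))) x :=
        h1.fderiv_right (by norm_num)
      exact h2.continuousAt.continuousWithinAt
    · intro b hb
      have := ((hemb f).1.2 2 (by norm_num) b hb)
      rw [tendsto_zero_iff_norm_tendsto_zero] at this
      refine (tendsto_zero_iff_norm_tendsto_zero (E := Euc d →L[ℝ] (Euc d →L[ℝ] Euc d))).2 ?_
      simpa only [norm_iter_two] using this
  b0 f y := by
    by_cases hy : y ∈ Ω
    · rw [indicator_of_mem hy, ← norm_iteratedFDeriv_zero (𝕜 := ℝ)]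
      exact (c0k_bound hΩo hΩb (hemb f).1 (by norm_num) hy).trans (hemb f).2
    · rw [indicator_of_notMem hy, norm_zero]; positivity
  b1 f y := by
    by_cases hy : y ∈ Ω
    · rw [indicator_of_mem hy, ← norm_iteratedFDeriv_one (𝕜 := ℝ)]
      exact (c0k_bound hΩo hΩb (hemb f).1 (by norm_num) hy).trans (hemb f).2
    · rw [indicator_of_notMem hy, norm_zero]; positivity
  b2 f y := by
    by_cases hy : y ∈ Ω
    · rw [indicator_of_mem hy, norm_iter_two]
      exact (c0k_bound hΩo hΩb (hemb f).1 (by norm_num) hy).trans (hemb f).2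
    · rw [indicator_of_notMem hy]
      exact (norm_zero (E := Euc d →L[ℝ] (Euc d →L[ℝ] Euc d))).le.trans (by positivity)

lemma joint_cont {V E Z : Type*} [NormedAddCommGroup V] [TopologicalSpace E]
    [NormedAddCommGroup Z] {S : V → E → Z} (hadd : ∀ f g y, S (f + g) y = S f y + S g y)
    {C : ℝ} (hb : ∀ f y, ‖S f y‖ ≤ C * ‖f‖) (hc : ∀ f, Continuous (S f)) :
    Continuous (fun q : V × E => S q.1 q.2) := by
  rw [continuous_iff_continuousAt]
  rintro ⟨f, y⟩
  have h1 : Tendsto (fun q : V × E => S (q.1 - f) q.2) (𝓝 (f, y)) (𝓝 0) := by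
    refine squeeze_zero_norm (fun q => hb _ _) ?_
    have : Continuous (fun q : V × E => C * ‖q.1 - f‖) := by fun_prop
    simpa using this.tendsto (f, y)
  have h2 : Tendsto (fun q : V × E => S f q.2) (𝓝 (f, y)) (𝓝 (S f y)) :=
    ((hc f).comp continuous_snd).tendsto (f, y)
  have h3 := h1.add h2
  rw [zero_add] at h3
  refine h3.congr fun q => ?_
  rw [← hadd, sub_add_cancel]

lemma bd_int {V E Z : Type*} [NormedAddCommGroup V] [NormedAddCommGroup E]
    [NormedAddCommGroup Z] {S : V → E → Z} (hadd : ∀ f g y, S (f + g) y = S f y + S g y)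
    {C : ℝ} (hb : ∀ f y, ‖S f y‖ ≤ C * ‖f‖) (hc : ∀ f, Continuous (S f))
    {a c : ℝ} (hac : a ≤ c) {v : ℝ → V} (hv : StronglyMeasurable v)
    (hvi : IntegrableOn (fun u => ‖v u‖) (Icc a c)) {y : ℝ → E} (hy : ContinuousOn y (Icc a c)) :
    IntervalIntegrable (fun u => S (v u) (y u)) volume a c := by
  rw [intervalIntegrable_iff_integrableOn_Icc_of_le hac]
  refine Integrable.mono' (hvi.const_mul C) ?_ (Eventually.of_forall fun u => hb _ _)
  have h1 : AEStronglyMeasurable y (volume.restrict (Icc a c)) :=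
    hy.aestronglyMeasurable_of_isCompact isCompact_Icc measurableSet_Icc
  exact (joint_cont hadd hb hc).comp_aestronglyMeasurable
    (hv.aestronglyMeasurable.prodMk h1)

lemma ode_unique {X : Type*} [NormedAddCommGroup X] [NormedSpace ℝ X] {a c : ℝ}
    {A : ℝ → X → X} {k : ℝ → ℝ} (hk : IntervalIntegrable k volume a c)
    (hAk : ∀ u ∈ Icc a c, ∀ x x', ‖A u x - A u x'‖ ≤ k u * ‖x - x'‖) (hk0 : ∀ u, 0 ≤ k u)
    {f g b : ℝ → X} (hfc : ContinuousOn f (Icc a c)) (hgc : ContinuousOn g (Icc a c))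
    (hfi : IntervalIntegrable (fun u => A u (f u)) volume a c)
    (hgi : IntervalIntegrable (fun u => A u (g u)) volume a c)
    (hf : ∀ t ∈ Icc a c, f t = b t + ∫ u in a..t, A u (f u))
    (hg : ∀ t ∈ Icc a c, g t = b t + ∫ u in a..t, A u (g u)) :
    ∀ t ∈ Icc a c, f t = g t := by
  have hfg : ContinuousOn (fun t => ‖f t - g t‖) (Icc a c) := (hfc.sub hgc).norm
  have key := gronwall_int (A := 0) (g := fun t => ‖f t - g t‖) hk (fun u _ => hk0 u) hfg (by
    intro t ht
    have ha : a ∈ Icc a c := ⟨le_rfl, ht.1.trans ht.2⟩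
    rw [hf t ht, hg t ht, add_sub_add_left_eq_sub,
      ← intervalIntegral.integral_sub (ii_sub hfi ha ht) (ii_sub hgi ha ht), zero_add]
    refine intervalIntegral.norm_integral_le_of_norm_le ht.1 ?_ ?_
    · refine Eventually.of_forall fun u hu => hAk u ⟨hu.1.le, hu.2.trans ht.2⟩ _ _
    · exact (ii_sub hk ha ht).mul_continuousOn (by
        rw [uIcc_of_le ht.1]; exact hfg.mono (Icc_subset_Icc_right ht.2)))
  intro t ht
  have := key t ht
  rw [zero_mul] at this
  exact sub_eq_zero.1 (norm_le_zero_iff.1 this)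

lemma ode_stays {X : Type*} [NormedAddCommGroup X] [NormedSpace ℝ X] {a c : ℝ}
    {A : ℝ → X → X} {k : ℝ → ℝ} (hk : IntervalIntegrable k volume a c)
    (hAk : ∀ u ∈ Icc a c, ∀ x x', ‖A u x - A u x'‖ ≤ k u * ‖x - x'‖) (hk0 : ∀ u, 0 ≤ k u)
    {z : ℝ → X} {x : X} (hzc : ContinuousOn z (Icc a c))
    (hzi : IntervalIntegrable (fun u => A u (z u)) volume a c)
    (hz : ∀ t ∈ Icc a c, z t = x + ∫ u in a..t, A u (z u))
    {t : ℝ} (ht : t ∈ Icc a c) (h0 : ∀ u ∈ Icc a c, A u (z t) = 0) : z t = x := by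
  have ha : a ∈ Icc a c := ⟨le_rfl, ht.1.trans ht.2⟩
  have hmem : ∀ τ ∈ Icc 0 (t - a), t - τ ∈ Icc a c := fun τ hτ =>
    ⟨by linarith [hτ.2], by linarith [hτ.1, ht.2]⟩
  have hfg : ContinuousOn (fun τ => ‖z (t - τ) - z t‖) (Icc 0 (t - a)) := by
    refine ((hzc.comp (by fun_prop) hmem).sub continuousOn_const).norm
  have hk' : IntervalIntegrable (fun τ => k (t - τ)) volume 0 (t - a) := by
    have := (ii_sub hk ht ha).comp_sub_left t
    simpa using this
  have key := gronwall_int (A := 0) (g := fun τ => ‖z (t - τ) - z t‖) hk'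
    (fun u _ => hk0 _) hfg (by
    intro τ hτ
    have hm := hmem τ hτ
    have h1 : z (t - τ) - z t = - ∫ u in (t - τ)..t, A u (z u) := by
      rw [hz t ht, hz _ hm, add_sub_add_left_eq_sub,
        intervalIntegral.integral_interval_sub_left (ii_sub hzi ha hm) (ii_sub hzi ha ht),
        intervalIntegral.integral_symm]
    rw [h1, norm_neg, zero_add]
    have h2 := intervalIntegral.integral_comp_sub_left (a := 0) (b := τ)
      (fun u => k u * ‖z u - z t‖) t
    rw [sub_zero] at h2
    rw [h2]
    refine intervalIntegral.norm_integral_le_of_norm_le (by linarith [hτ.1]) ?_ ?_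
    · refine Eventually.of_forall fun u hu => ?_
      have hu' : u ∈ Icc a c := ⟨hm.1.trans hu.1.le, hu.2.trans ht.2⟩
      have := hAk u hu' (z u) (z t)
      rwa [h0 u hu', sub_zero] at this
    · exact (ii_sub hk hm ht).mul_continuousOn (by
        rw [uIcc_of_le (by linarith [hτ.1])]
        exact ((hzc.mono (Icc_subset_Icc hm.1 ht.2)).sub continuousOn_const).norm))
  have h3 := key (t - a) ⟨by linarith [ht.1], le_rfl⟩
  rw [zero_mul] at h3
  have h4 := sub_eq_zero.1 (norm_le_zero_iff.1 h3)
  rw [← h4, sub_sub_cancel, hz a ha, intervalIntegral.integral_same, add_zero]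

lemma flow_ident {X : Type*} [NormedAddCommGroup X] [NormedSpace ℝ X] [CompleteSpace X] {a c : ℝ}
    (hac : a ≤ c) {A B : ℝ → X → X} {k : ℝ → ℝ} (hk : IntervalIntegrable k volume a c)
    (hA : ∀ f, ContinuousOn f (Icc a c) → IntervalIntegrable (fun u => A u (f u)) volume a c)
    (hAk : ∀ u ∈ Icc a c, ∀ x x', ‖A u x - A u x'‖ ≤ k u * ‖x - x'‖) (hk0 : ∀ u, 0 ≤ k u)
    {Ω : Set X} (hΩ : IsOpen Ω) (hA0 : ∀ u, ∀ y, y ∉ Ω → A u y = 0)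
    (hAB : ∀ u, ∀ y ∈ Ω, B u y = A u y)
    {y : ℝ → X} {x : X} (hx : x ∈ Ω)
    (hy : ∀ t ∈ Icc a c, y t = x + ∫ u in a..t, B u (y u)) :
    ContinuousOn y (Icc a c) ∧ (∀ t ∈ Icc a c, y t ∈ Ω) ∧
      ∀ t ∈ Icc a c, y t = x + ∫ u in a..t, A u (y u) := by
  obtain ⟨z, hzc, hz⟩ := lin_exists hac hk hA hAk hk0 (b := fun _ => x) continuousOn_const
  have ha : a ∈ Icc a c := ⟨le_rfl, hac⟩
  have hzΩ : ∀ t ∈ Icc a c, z t ∈ Ω := by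
    intro t ht
    by_contra hcon
    have := ode_stays hk hAk hk0 hzc (hA z hzc) hz ht (fun u _ => hA0 u _ hcon)
    exact hcon (this ▸ hx)
  suffices hmain : Icc a c ⊆ {t | ∀ r ∈ Icc a t, y r = z r} by
    have heq : ∀ t ∈ Icc a c, y t = z t := fun t ht => hmain ht t ⟨ht.1, le_rfl⟩
    refine ⟨hzc.congr heq, fun t ht => heq t ht ▸ hzΩ t ht, fun t ht => ?_⟩
    rw [heq t ht, hz t ht]
    congr 1
    refine intervalIntegral.integral_congr fun u hu => ?_
    rw [uIcc_of_le ht.1] at hu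
    simp only [heq u ⟨hu.1, hu.2.trans ht.2⟩]
  have hya : y a = x := by rw [hy a ha]; simp
  have hza : z a = x := by rw [hz a ha]; simp
  -- agreement of integrals
  have hstep : ∀ t ∈ Icc a c, (∀ r ∈ Ico a t, y r = z r) → y t = z t := by
    intro t ht h
    rw [hy t ht, hz t ht]
    congr 1
    rw [intervalIntegral.integral_of_le ht.1, intervalIntegral.integral_of_le ht.1,
      ← integral_Ico_eq_integral_Ioc, ← integral_Ico_eq_integral_Ioc]
    refine setIntegral_congr_fun measurableSet_Ico fun u hu => ?_
    rw [h u hu, hAB u _ (hzΩ u ⟨hu.1, hu.2.le.trans ht.2⟩)]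
  refine IsClosed.Icc_subset_of_forall_exists_gt ?_ ?_ ?_
  · rw [← isSeqClosed_iff_isClosed]
    intro tn t htn hlim
    have ht : t ∈ Icc a c := isClosed_Icc.mem_of_tendsto hlim (Eventually.of_forall fun n => (htn n).2)
    refine ⟨?_, ht⟩
    have h1 : ∀ r ∈ Ico a t, y r = z r := by
      intro r hr
      obtain ⟨n, hn⟩ := (hlim.eventually (lt_mem_nhds hr.2)).exists
      exact (htn n).1 r ⟨hr.1, hn.le⟩
    intro r hr
    rcases hr.2.lt_or_eq with h | h
    · exact h1 r ⟨hr.1, h⟩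
    · rw [h]; exact hstep t ht h1
  · intro r hr
    have : r = a := le_antisymm hr.2 hr.1
    rw [this, hya, hza]
  · rintro t1 ⟨h1, ht1⟩ b hb
    have h1' : ∀ r ∈ Icc a t1, y r = z r := h1
    have ht1' : t1 ∈ Icc a c := ⟨ht1.1, ht1.2.le⟩
    -- integrability slightly beyond t1
    obtain ⟨t2, ht2, ht2c, hint⟩ : ∃ t2, t1 < t2 ∧ t2 ≤ c ∧
        IntervalIntegrable (fun u => B u (y u)) volume a t2 := by
      by_contra hcon
      push Not at hcon
      have hyx : ∀ t ∈ Ioc t1 c, y t = x := by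
        intro t ht
        rw [hy t ⟨ht1.1.trans ht.1.le, ht.2⟩, intervalIntegral.integral_undef (hcon t ht.1 ht.2),
          add_zero]
      apply hcon c ht1.2 le_rfl
      have i1 : IntervalIntegrable (fun u => B u (y u)) volume a t1 := by
        refine (ii_sub (hA z hzc) ha ht1').congr ?_
        intro u hu
        rw [uIoc_of_le ht1.1] at hu
        simp only
        rw [h1' u ⟨hu.1.le, hu.2⟩, hAB u _ (hzΩ u ⟨hu.1.le, hu.2.trans ht1.2.le⟩)]
      have i2 : IntervalIntegrable (fun u => B u (y u)) volume t1 c := by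
        refine (ii_sub (hA (fun _ => x) continuousOn_const) ht1' ⟨hac, le_rfl⟩).congr ?_
        intro u hu
        rw [uIoc_of_le ht1.2.le] at hu
        simp only
        rw [hyx u hu, hAB u _ hx]
      exact i1.trans i2
    have hyc2 : ContinuousOn y (Icc a t2) := by
      refine ((continuousOn_const (c := x)).add (cont_prim (ht1.1.trans ht2.le) hint)).congr ?_
      intro t ht
      exact hy t ⟨ht.1, ht.2.trans ht2c⟩
    have hyt1 : y t1 ∈ Ω := by rw [h1' t1 ⟨ht1.1, le_rfl⟩]; exact hzΩ t1 ht1'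
    have hev : ∀ᶠ t in 𝓝[Icc a t2] t1, y t ∈ Ω :=
      (hyc2 t1 ⟨ht1.1, ht2.le⟩).eventually (hΩ.mem_nhds hyt1)
    obtain ⟨δ, hδ, hball⟩ := Metric.eventually_nhds_iff_ball.1 (eventually_nhdsWithin_iff.1 hev)
    let t3 := min (min t2 b) (t1 + δ / 2)
    have ht13 : t1 < t3 := lt_min (lt_min ht2 hb) (by linarith)
    have ht32 : t3 ≤ t2 := (min_le_left _ _).trans (min_le_left _ _)
    have ht3b : t3 ≤ b := (min_le_left _ _).trans (min_le_right _ _)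
    have ht3δ : t3 ≤ t1 + δ / 2 := min_le_right _ _
    have hyΩ : ∀ t ∈ Icc a t3, y t ∈ Ω := by
      intro t ht
      rcases le_total t t1 with h | h
      · rw [h1' t ⟨ht.1, h⟩]; exact hzΩ t ⟨ht.1, h.trans ht1.2.le⟩
      · refine hball t ?_ ⟨ht.1, ht.2.trans ht32⟩
        rw [Metric.mem_ball, Real.dist_eq, abs_of_nonneg (by linarith)]
        linarith [ht.2]
    have ht3 : t3 ∈ Icc a c := ⟨ht1.1.trans ht13.le, ht32.trans ht2c⟩
    have hsub : Icc a t3 ⊆ Icc a c := Icc_subset_Icc_right ht3.2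
    refine ⟨t3, ?_, ht13, ht3b⟩
    have hBA : ∀ u ∈ Icc a t3, A u (y u) = B u (y u) := fun u hu => (hAB u _ (hyΩ u hu)).symm
    refine ode_unique (b := fun _ => x) (ii_sub hk ha ht3) (fun u hu => hAk u (hsub hu)) hk0
      (hyc2.mono (Icc_subset_Icc_right ht32)) (hzc.mono hsub) ?_ (ii_sub (hA z hzc) ha ht3) ?_
      (fun t ht => hz t (hsub ht))
    · refine (ii_sub hint ⟨le_rfl, ht1.1.trans ht2.le⟩ ⟨ht3.1, ht32⟩).congr fun u hu => ?_
      rw [uIoc_of_le ht3.1] at hu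
      exact (hBA u ⟨hu.1.le, hu.2⟩).symm
    · intro t ht
      rw [hy t (hsub ht)]
      congr 1
      refine intervalIntegral.integral_congr fun u hu => ?_
      rw [uIcc_of_le ht.1] at hu
      exact (hBA u ⟨hu.1, hu.2.trans ht.2⟩).symm

/-- trace as a continuous linear functional -/
def trL (d : ℕ) : (Euc d →L[ℝ] Euc d) →L[ℝ] ℝ :=
  LinearMap.toContinuousLinearMap
    ((LinearMap.trace ℝ (Euc d)).comp (ContinuousLinearMap.coeLM ℝ))

lemma trL_apply {d : ℕ} (A : Euc d →L[ℝ] Euc d) :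
    trL d A = LinearMap.trace ℝ (Euc d) (A : Euc d →ₗ[ℝ] Euc d) := rfl

section
variable {d : ℕ} {V : Type*} [NormedAddCommGroup V] [NormedSpace ℝ V] (X : ExtFld d V)

lemma ExtFld.add1 (f g : V) (y : Euc d) : X.T1 (f + g) y = X.T1 f y + X.T1 g y := by
  refine (X.hd0 (f + g) y).unique (((X.hd0 f y).add (X.hd0 g y)).congr_of_eventuallyEq ?_)
  exact Eventually.of_forall fun z => X.add0 f g z

lemma ExtFld.smul1 (r : ℝ) (f : V) (y : Euc d) : X.T1 (r • f) y = r • X.T1 f y := by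
  refine (X.hd0 (r • f) y).unique (((X.hd0 f y).const_smul r).congr_of_eventuallyEq ?_)
  exact Eventually.of_forall fun z => X.smul0 r f z

lemma ExtFld.add2 (f g : V) (y : Euc d) : X.T2 (f + g) y = X.T2 f y + X.T2 g y := by
  refine (X.hd1 (f + g) y).unique (((X.hd1 f y).add (X.hd1 g y)).congr_of_eventuallyEq ?_)
  exact Eventually.of_forall fun z => X.add1 f g z

/-- field together with its divergence -/
def ExtFld.G (f : V) (y : Euc d) : Euc d × ℝ := (X.T0 f y, trL d (X.T1 f y))

/-- derivative of `G` -/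
def ExtFld.G' (f : V) (y : Euc d) : Euc d →L[ℝ] (Euc d × ℝ) :=
  (X.T1 f y).prod ((trL d).comp (X.T2 f y))

/-- the bound -/
def ExtFld.K : ℝ := X.C * (1 + ‖trL d‖)

lemma ExtFld.K0 : 0 ≤ X.K := mul_nonneg X.hC (by positivity)

lemma ExtFld.addG (f g : V) (y : Euc d) : X.G (f + g) y = X.G f y + X.G g y := by
  simp [ExtFld.G, X.add0, X.add1]

lemma ExtFld.smulG (r : ℝ) (f : V) (y : Euc d) : X.G (r • f) y = r • X.G f y := by
  simp [ExtFld.G, X.smul0, X.smul1]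

lemma ExtFld.addG' (f g : V) (y : Euc d) : X.G' (f + g) y = X.G' f y + X.G' g y := by
  ext z
  · simp [ExtFld.G', X.add1]
  · simp [ExtFld.G', X.add2]

lemma ExtFld.hdG (f : V) (y : Euc d) : HasFDerivAt (X.G f) (X.G' f y) y :=
  (X.hd0 f y).prodMk ((trL d).hasFDerivAt.comp y (X.hd1 f y))

lemma ExtFld.bG (f : V) (y : Euc d) : ‖X.G f y‖ ≤ X.K * ‖f‖ := by
  have h0 := X.b0 f y
  have h1 := X.b1 f y
  have h2 := (trL d).le_opNorm (X.T1 f y)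
  have hC := X.hC
  have h3 : ‖trL d‖ * ‖X.T1 f y‖ ≤ ‖trL d‖ * (X.C * ‖f‖) := by gcongr
  have h4 : 0 ≤ X.C * ‖f‖ := by positivity
  have h5 : 0 ≤ ‖trL d‖ * (X.C * ‖f‖) := by positivity
  rw [ExtFld.G, Prod.norm_def, ExtFld.K]
  apply max_le <;> simp only <;> nlinarith

lemma ExtFld.bG' (f : V) (y : Euc d) : ‖X.G' f y‖ ≤ X.K * ‖f‖ := by
  have h1 := X.b1 f y
  have h2 := (trL d).opNorm_comp_le (X.T2 f y)
  have h2' := X.b2 f y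
  have hC := X.hC
  have h3 : ‖trL d‖ * ‖X.T2 f y‖ ≤ ‖trL d‖ * (X.C * ‖f‖) := by gcongr
  have h4 : 0 ≤ X.C * ‖f‖ := by positivity
  have h5 : 0 ≤ ‖trL d‖ * (X.C * ‖f‖) := by positivity
  rw [ExtFld.G', ContinuousLinearMap.opNorm_prod, Prod.norm_def, ExtFld.K]
  apply max_le <;> simp only <;> nlinarith

lemma ExtFld.cT0 (f : V) : Continuous (X.T0 f) :=
  continuous_iff_continuousAt.2 fun y => (X.hd0 f y).continuousAt

lemma ExtFld.cT1 (f : V) : Continuous (X.T1 f) :=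
  continuous_iff_continuousAt.2 fun y => (X.hd1 f y).continuousAt

lemma ExtFld.cG (f : V) : Continuous (X.G f) :=
  continuous_iff_continuousAt.2 fun y => (X.hdG f y).continuousAt

lemma ExtFld.cG' (f : V) : Continuous (X.G' f) := by
  have h1 := X.cT1 f
  have h2 := X.hc2 f
  have h3 : Continuous (fun y => (trL d).comp (X.T2 f y)) := continuous_const.clm_comp h2
  exact (ContinuousLinearMap.prodₗᵢ ℝ :
    ((Euc d →L[ℝ] Euc d) × (Euc d →L[ℝ] ℝ)) ≃ₗᵢ[ℝ] (Euc d →L[ℝ] Euc d × ℝ)).continuous.comp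
    (h1.prodMk h3)

lemma ExtFld.lipT0 (f : V) (y z : Euc d) : ‖X.T0 f y - X.T0 f z‖ ≤ X.C * ‖f‖ * ‖y - z‖ :=
  convex_univ.norm_image_sub_le_of_norm_hasFDerivWithin_le
    (fun w _ => (X.hd0 f w).hasFDerivWithinAt) (fun w _ => X.b1 f w) (mem_univ _) (mem_univ _)

lemma ExtFld.lipG (f : V) (y z : Euc d) : ‖X.G f y - X.G f z‖ ≤ X.K * ‖f‖ * ‖y - z‖ :=
  convex_univ.norm_image_sub_le_of_norm_hasFDerivWithin_le
    (fun w _ => (X.hdG f w).hasFDerivWithinAt) (fun w _ => X.bG' f w) (mem_univ _) (mem_univ _)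

end

lemma sens_aux {E : Type*} [NormedAddCommGroup E] [NormedSpace ℝ E]
    {f g : E → E × ℝ} {f' g' : E →L[ℝ] E × ℝ} {x0 y : E} {r : ℝ}
    (hf : HasFDerivAt f f' y) (hg : HasFDerivAt g g' y) :
    HasFDerivAt (fun q : (E × ℝ) × (E × ℝ) => f q.2.1 + q.1.2 • g q.2.1)
      (((ContinuousLinearMap.snd ℝ E ℝ).smulRight (g y)).coprod
        (f'.comp (ContinuousLinearMap.fst ℝ E ℝ))) ((x0, 0), (y, r)) := by
  have hf1 : HasFDerivAt (fun q : (E × ℝ) × (E × ℝ) => q.2.1)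
      ((ContinuousLinearMap.fst ℝ E ℝ).comp
        (ContinuousLinearMap.snd ℝ (E × ℝ) (E × ℝ))) ((x0, 0), (y, r)) :=
    ((ContinuousLinearMap.fst ℝ E ℝ).comp
      (ContinuousLinearMap.snd ℝ (E × ℝ) (E × ℝ))).hasFDerivAt
  have hf2 : HasFDerivAt (fun q : (E × ℝ) × (E × ℝ) => q.1.2)
      ((ContinuousLinearMap.snd ℝ E ℝ).comp
        (ContinuousLinearMap.fst ℝ (E × ℝ) (E × ℝ))) ((x0, 0), (y, r)) :=
    ((ContinuousLinearMap.snd ℝ E ℝ).comp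
      (ContinuousLinearMap.fst ℝ (E × ℝ) (E × ℝ))).hasFDerivAt
  have g1 := HasFDerivAt.comp (f := fun q : (E × ℝ) × (E × ℝ) => q.2.1) ((x0, (0:ℝ)), (y, r)) hf hf1
  have g2 := HasFDerivAt.comp (f := fun q : (E × ℝ) × (E × ℝ) => q.2.1) ((x0, (0:ℝ)), (y, r)) hg hf1
  refine (g1.add (hf2.smul g2)).congr_fderiv ?_
  refine ContinuousLinearMap.ext fun w => ?_
  change f' w.2.1 + ((0:ℝ) • g' w.2.1 + w.1.2 • g y) = w.1.2 • g y + f' w.2.1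
  rw [zero_smul, zero_add, add_comm]

lemma sens {d : ℕ} {V : Type*} [NormedAddCommGroup V] [NormedSpace ℝ V] (X : ExtFld d V)
    {s c : ℝ} (hs : s ≤ c) {v h : ℝ → V} (hv : StronglyMeasurable v) (hh : StronglyMeasurable h)
    (hvi : IntegrableOn (fun u => ‖v u‖) (Icc s c)) (hhi : IntegrableOn (fun u => ‖h u‖) (Icc s c))
    {Ω : Set (Euc d)} (hΩ : IsOpen Ω) {Ψ : ℝ → ℝ → Euc d → Euc d}
    (hΨc : ∀ e, ∀ x ∈ Ω, ContinuousOn (fun t => Ψ e t x) (Icc s c))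
    (hΨ : ∀ e, ∀ x ∈ Ω, ∀ t ∈ Icc s c,
      Ψ e t x = x + ∫ u in s..t, X.T0 (v u + e • h u) (Ψ e u x))
    {x0 : Euc d} (hx0 : x0 ∈ Ω) :
    ∃ η : ℝ → (Euc d × ℝ) →L[ℝ] (Euc d × ℝ), ContinuousOn η (Icc s c) ∧
      (∀ t ∈ Icc s c, ∀ q e, η t (q, e) =
        (q, 0) + ∫ u in s..t, (X.G' (v u) (Ψ 0 u x0) (η u (q, e)).1 + e • X.G (h u) (Ψ 0 u x0))) ∧
      (∀ t ∈ Icc s c, HasFDerivAt (fun p : Euc d × ℝ =>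
        (Ψ p.2 t p.1, ∫ u in s..t, trL d (X.T1 (v u + p.2 • h u) (Ψ p.2 u p.1)))) (η t) (x0, 0)) := by
  set y : ℝ → Euc d := fun u => Ψ 0 u x0 with hydef
  have hyc : ContinuousOn y (Icc s c) := hΨc 0 x0 hx0
  let N : Set (Euc d × ℝ) := Ω ×ˢ univ
  have hN : N ∈ 𝓝 (x0, (0:ℝ)) := prod_mem_nhds (hΩ.mem_nhds hx0) univ_mem
  let F : Euc d × ℝ → ℝ → Euc d × ℝ → Euc d × ℝ := fun p u w => X.G (v u + p.2 • h u) w.1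
  let Y : Euc d × ℝ → ℝ → Euc d × ℝ := fun p t =>
        (Ψ p.2 t p.1, ∫ u in s..t, trL d (X.T1 (v u + p.2 • h u) (Ψ p.2 u p.1)))
  let α : Euc d × ℝ →L[ℝ] Euc d × ℝ := (ContinuousLinearMap.fst ℝ (Euc d) ℝ).prod 0
  have hsm : ∀ e : ℝ, StronglyMeasurable (fun u => v u + e • h u) := fun e =>
    hv.add (hh.const_smul e)
  have hsi : ∀ e : ℝ, IntegrableOn (fun u => ‖v u + e • h u‖) (Icc s c) := by
    intro e
    refine Integrable.mono' (hvi.add (hhi.const_mul |e|)) (hsm e).norm.aestronglyMeasurable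
      (Eventually.of_forall fun u => ?_)
    rw [norm_norm]
    refine (norm_add_le _ _).trans ?_
    rw [norm_smul, Real.norm_eq_abs]; rfl
  have hGi : ∀ p ∈ N, IntervalIntegrable (fun u => X.G (v u + p.2 • h u) (Ψ p.2 u p.1)) volume s c :=
    fun p hp => bd_int X.addG X.bG X.cG hs (hsm p.2) (hsi p.2) (hΨc p.2 p.1 hp.1)
  have hs' : s ∈ Icc s c := ⟨le_rfl, hs⟩
  have hYeq : ∀ p ∈ N, ∀ t ∈ Icc s c, Y p t = (0 + α p) + ∫ u in s..t, F p u (Y p u) := by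
    intro p hp t ht
    have hi := ii_sub (hGi p hp) hs' ht
    have h1 := (ContinuousLinearMap.fst ℝ (Euc d) ℝ).intervalIntegral_comp_comm hi
    have h2 := (ContinuousLinearMap.snd ℝ (Euc d) ℝ).intervalIntegral_comp_comm hi
    refine Prod.ext ?_ ?_
    · simp only [Y, F, α, Prod.fst_add]
      rw [hΨ p.2 p.1 hp.1 t ht]
      simp only [ContinuousLinearMap.coe_fst'] at h1
      rw [← h1]
      simp [ExtFld.G]
    · simp only [Y, F, α, Prod.snd_add]
      simp only [ContinuousLinearMap.coe_snd'] at h2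
      rw [← h2]
      simp [ExtFld.G]
  have hYc : ∀ p ∈ N, ContinuousOn (Y p) (Icc s c) := by
    intro p hp
    refine (hΨc p.2 p.1 hp.1).prodMk ?_
    have := cont_prim hs ((ContinuousLinearMap.snd ℝ (Euc d) ℝ).integrable_comp
      (hGi p hp).1 |> fun h => (intervalIntegrable_iff_integrableOn_Ioc_of_le hs).2 h)
    exact this
  let k : ℝ → ℝ := fun u => X.K * (‖v u‖ + ‖h u‖)
  have hK0 := X.K0
  have hk0 : ∀ u, 0 ≤ k u := fun u => by positivity
  have hk : IntervalIntegrable k volume s c :=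
    (intervalIntegrable_iff_integrableOn_Icc_of_le hs).2 ((hvi.add hhi).const_mul X.K)
  have hlip : ∀ p ∈ N, ∀ u ∈ Icc s c, ∀ w w', ‖F p u w - F (x0, 0) u w'‖ ≤
      k u * (‖w - w'‖ + ‖p - (x0, 0)‖) := by
    intro p hp u hu w w'
    have e1 : F p u w - F (x0, 0) u w' = (X.G (v u) w.1 - X.G (v u) w'.1) + p.2 • X.G (h u) w.1 := by
      simp only [F, X.addG, X.smulG, zero_smul, add_zero]
      abel
    rw [e1]
    have n1 := X.lipG (v u) w.1 w'.1
    have n2 := X.bG (h u) w.1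
    have n3 : ‖w.1 - w'.1‖ ≤ ‖w - w'‖ := norm_fst_le (w - w')
    have n4 : ‖p.2‖ ≤ ‖p - (x0, 0)‖ := by
      have := norm_snd_le (p - (x0, (0:ℝ)))
      simpa using this
    calc _ ≤ X.K * ‖v u‖ * ‖w.1 - w'.1‖ + ‖p.2‖ * (X.K * ‖h u‖) := by
          refine (norm_add_le _ _).trans (add_le_add n1 ?_)
          rw [norm_smul]; gcongr
      _ ≤ X.K * ‖v u‖ * ‖w - w'‖ + ‖p - (x0, 0)‖ * (X.K * ‖h u‖) := by gcongr
      _ ≤ _ := by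
          have a1 : 0 ≤ X.K * ‖v u‖ := by positivity
          have a2 : 0 ≤ X.K * ‖h u‖ := by positivity
          have a3 := mul_nonneg a1 (norm_nonneg (p - (x0, 0)))
          have a4 := mul_nonneg a2 (norm_nonneg (w - w'))
          simp only [k]
          nlinarith
  let A : ℝ → (Euc d × ℝ) →L[ℝ] (Euc d × ℝ) := fun u =>
    (X.G' (v u) (y u)).comp (ContinuousLinearMap.fst ℝ (Euc d) ℝ)
  let B : ℝ → (Euc d × ℝ) →L[ℝ] (Euc d × ℝ) := fun u =>
    (ContinuousLinearMap.snd ℝ (Euc d) ℝ).smulRight (X.G (h u) (y u))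
  have bA : ∀ f z, ‖(X.G' f z).comp (ContinuousLinearMap.fst ℝ (Euc d) ℝ)‖ ≤ X.K * ‖f‖ := by
    intro f z
    refine (ContinuousLinearMap.opNorm_comp_le _ _).trans ?_
    have := X.bG' f z
    have h2 := ContinuousLinearMap.norm_fst_le ℝ (Euc d) ℝ
    calc _ ≤ ‖X.G' f z‖ * 1 := by gcongr
      _ ≤ _ := by linarith
  have bB : ∀ f z, ‖(ContinuousLinearMap.snd ℝ (Euc d) ℝ).smulRight (X.G f z)‖ ≤ X.K * ‖f‖ := by
    intro f z
    rw [ContinuousLinearMap.norm_smulRight_apply]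
    have := X.bG f z
    have h2 := ContinuousLinearMap.norm_snd_le ℝ (Euc d) ℝ
    calc _ ≤ 1 * ‖X.G f z‖ := by gcongr
      _ ≤ _ := by linarith
  have hA : IntervalIntegrable A volume s c := by
    refine bd_int (S := fun f z => (X.G' f z).comp (ContinuousLinearMap.fst ℝ (Euc d) ℝ))
      ?_ bA ?_ hs hv hvi hyc
    · intro f g z; simp only [X.addG', ContinuousLinearMap.add_comp]
    · intro f; exact (X.cG' f).clm_comp continuous_const
  have hB : IntervalIntegrable B volume s c := by
    refine bd_int (S := fun f z => (ContinuousLinearMap.snd ℝ (Euc d) ℝ).smulRight (X.G f z))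
      ?_ bB ?_ hs hh hhi hyc
    · intro f g z
      ext w <;> simp [X.addG, smul_add]
    · intro f
      exact (ContinuousLinearMap.smulRightL ℝ (Euc d × ℝ) (Euc d × ℝ)
        (ContinuousLinearMap.snd ℝ (Euc d) ℝ)).continuous.comp (X.cG f)
  have hF : ∀ u ∈ Icc s c, HasFDerivAt (fun q : (Euc d × ℝ) × (Euc d × ℝ) => F q.1 u q.2)
      ((B u).coprod (A u)) ((x0, 0), Y (x0, 0) u) := by
    intro u hu
    refine (sens_aux (r := (Y (x0, 0) u).2) (X.hdG (v u) (y u))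
      (X.hdG (h u) (y u))).congr_of_eventuallyEq (Eventually.of_forall fun q => ?_)
    simp only [F, X.addG, X.smulG]
  obtain ⟨η, hηc, hη, hηi, hηd⟩ := param_deriv hs hN (F := F) (y := Y) α 0 hYc
    (fun p hp => hGi p hp) hYeq hk hk0 hlip hA hB
    (fun u _ => (bA _ _).trans (by simp only [k]; nlinarith [norm_nonneg (h u)]))
    (fun u _ => (bB _ _).trans (by simp only [k]; nlinarith [norm_nonneg (v u)])) hF
  refine ⟨η, hηc, ?_, hηd⟩
  intro t ht q e
  rw [hη t ht, _root_.add_apply, ContinuousLinearMap.intervalIntegral_apply (ii_sub hηi hs' ht)]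
  rfl

lemma det_contDiff (d : ℕ) : ContDiff ℝ 1 (fun M : Euc d →L[ℝ] Euc d => M.det) := by
  let b := (EuclideanSpace.basisFun (Fin d) ℝ).toBasis
  have h1 : (fun M : Euc d →L[ℝ] Euc d => M.det) = fun M : Euc d →L[ℝ] Euc d =>
      ∑ σ : Equiv.Perm (Fin d), ((Equiv.Perm.sign σ : ℤ) : ℝ) *
        ∏ i, LinearMap.toMatrix b b (M : Euc d →ₗ[ℝ] Euc d) (σ i) i := by
    ext M
    rw [← Matrix.det_apply', LinearMap.det_toMatrix]
  rw [h1]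
  refine ContDiff.sum fun σ _ => contDiff_const.mul (contDiff_prod fun i _ => ?_)
  let L : (Euc d →L[ℝ] Euc d) →ₗ[ℝ] ℝ :=
    { toFun := fun M => LinearMap.toMatrix b b (M : Euc d →ₗ[ℝ] Euc d) (σ i) i
      map_add' := fun M N => by
        rw [ContinuousLinearMap.toLinearMap_add, map_add]; rfl
      map_smul' := fun r M => by
        rw [ContinuousLinearMap.toLinearMap_smul, map_smul]; rfl }
  exact (LinearMap.toContinuousLinearMap L).contDiff

lemma det_line (d : ℕ) (A : Euc d →L[ℝ] Euc d) :
    HasDerivAt (fun r : ℝ => (ContinuousLinearMap.id ℝ (Euc d) + r • A).det) (trL d A) 0 := by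
  let b := (EuclideanSpace.basisFun (Fin d) ℝ).toBasis
  let M := LinearMap.toMatrix b b (A : Euc d →ₗ[ℝ] Euc d)
  have h1 : ∀ r : ℝ, (ContinuousLinearMap.id ℝ (Euc d) + r • A).det = Matrix.det (1 + r • M) := by
    intro r
    change LinearMap.det (LinearMap.id + r • (A : Euc d →ₗ[ℝ] Euc d)) = _
    rw [← LinearMap.det_toMatrix b, map_add, map_smul, LinearMap.toMatrix_id]
  have h2 : trL d A = M.trace := by
    rw [trL_apply, LinearMap.trace_eq_matrix_trace ℝ b]
  set p := (Matrix.det (1 + (Polynomial.X : Polynomial ℝ) • M.map Polynomial.C)).divX.divX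
  have h3 : HasDerivAt (fun r : ℝ => 1 + M.trace * r + p.eval r * r ^ 2)
      (M.trace * 1 + (p.derivative.eval 0 * 0 ^ 2 + p.eval 0 * (2 * 0))) 0 := by
    have e1 := (((hasDerivAt_id (0:ℝ)).const_mul M.trace).const_add 1)
    have e2 := (p.hasDerivAt (0:ℝ)).mul (hasDerivAt_pow 2 (0:ℝ))
    convert! e1.add e2 using 1
    simp
  have h4 : (fun r : ℝ => (ContinuousLinearMap.id ℝ (Euc d) + r • A).det) =
      fun r : ℝ => 1 + M.trace * r + p.eval r * r ^ 2 := by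
    funext r
    rw [h1, Matrix.det_one_add_smul]
  rw [h4, h2]
  convert! h3 using 1
  simp

lemma det_fderiv (d : ℕ) (M A : Euc d →L[ℝ] Euc d) :
    fderiv ℝ (fun M : Euc d →L[ℝ] Euc d => M.det) M (A.comp M) = trL d A * M.det := by
  have hd : DifferentiableAt ℝ (fun M : Euc d →L[ℝ] Euc d => M.det) M :=
    (det_contDiff d).differentiable (by norm_num) M
  have h1 : HasDerivAt (fun r : ℝ => M + r • A.comp M) (A.comp M) 0 := by
    have := ((hasDerivAt_id (0:ℝ)).smul_const (A.comp M)).const_add M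
    rwa [one_smul] at this
  have hd' : HasFDerivAt (fun M : Euc d →L[ℝ] Euc d => M.det)
      (fderiv ℝ (fun M : Euc d →L[ℝ] Euc d => M.det) M) (M + (0:ℝ) • A.comp M) := by
    have e0 : M + (0:ℝ) • A.comp M = M := ContinuousLinearMap.ext fun x => by simp
    rw [e0]; exact hd.hasFDerivAt
  have h2 := hd'.comp_hasDerivAt (0:ℝ) h1
  have h3 := (det_line d A).mul_const M.det
  refine h2.unique (h3.congr_of_eventuallyEq (Eventually.of_forall fun r => ?_))
  change LinearMap.det _ = LinearMap.det _ * LinearMap.det _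
  rw [← LinearMap.det_comp]
  congr 1

lemma ii_comp_right {d : ℕ} {s c : ℝ} (hs : s ≤ c) {A m : ℝ → Euc d →L[ℝ] Euc d}
    (hA : IntervalIntegrable A volume s c) (hmc : ContinuousOn m (Icc s c)) :
    IntervalIntegrable (fun u => (A u).comp (m u)) volume s c := by
  rw [intervalIntegrable_iff_integrableOn_Icc_of_le hs] at hA ⊢
  obtain ⟨M, hM⟩ := isCompact_Icc.exists_bound_of_continuousOn hmc
  have hmm := hmc.aestronglyMeasurable_of_isCompact (μ := volume) isCompact_Icc measurableSet_Icc
  refine Integrable.mono' (hA.norm.mul_const M) ?_ ?_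
  · exact (ContinuousLinearMap.compL ℝ (Euc d) (Euc d) (Euc d)).aestronglyMeasurable_comp₂
      hA.aestronglyMeasurable hmm
  · refine (ae_restrict_iff' measurableSet_Icc).2 (Eventually.of_forall fun u hu => ?_)
    exact (ContinuousLinearMap.opNorm_comp_le _ _).trans (by
      have := hM u hu
      gcongr)

lemma liouville {d : ℕ} {s c : ℝ} (hs : s ≤ c) {A m : ℝ → Euc d →L[ℝ] Euc d}
    (hA : IntervalIntegrable A volume s c) (hmc : ContinuousOn m (Icc s c))
    (hm : ∀ t ∈ Icc s c, m t = ContinuousLinearMap.id ℝ (Euc d) + ∫ u in s..t, (A u).comp (m u)) :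
    (m c).det = Real.exp (∫ u in s..c, trL d (A u)) := by
  have hs' : s ∈ Icc s c := ⟨le_rfl, hs⟩
  have hAm := ii_comp_right hs hA hmc
  have htr : IntervalIntegrable (fun u => trL d (A u)) volume s c :=
    (intervalIntegrable_iff_integrableOn_Ioc_of_le hs).2 ((trL d).integrable_comp hA.1)
  let w : ℝ → (Euc d →L[ℝ] Euc d) × ℝ := fun u => ((A u).comp (m u), trL d (A u))
  have hw : IntervalIntegrable w volume s c :=
    (intervalIntegrable_iff_integrableOn_Ioc_of_le hs).2 (hAm.1.prodMk htr.1)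
  let y : ℝ → (Euc d →L[ℝ] Euc d) × ℝ := fun t => (m t, ∫ u in s..t, trL d (A u))
  have hy : ∀ t ∈ Icc s c, y t = (ContinuousLinearMap.id ℝ (Euc d), 0) + ∫ u in s..t, w u := by
    intro t ht
    have hi := ii_sub hw hs' ht
    have h1 := (ContinuousLinearMap.fst ℝ (Euc d →L[ℝ] Euc d) ℝ).intervalIntegral_comp_comm hi
    have h2 := (ContinuousLinearMap.snd ℝ (Euc d →L[ℝ] Euc d) ℝ).intervalIntegral_comp_comm hi
    simp only [ContinuousLinearMap.coe_fst'] at h1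
    simp only [ContinuousLinearMap.coe_snd'] at h2
    refine Prod.ext ?_ ?_
    · rw [Prod.fst_add, ← h1]; exact hm t ht
    · rw [Prod.snd_add, ← h2, zero_add]
  let g : (Euc d →L[ℝ] Euc d) × ℝ → ℝ := fun q => q.1.det * Real.exp (-q.2)
  have hg : ContDiff ℝ 1 g :=
    ((det_contDiff d).comp contDiff_fst).mul (Real.contDiff_exp.comp contDiff_snd.neg)
  have key := ac_chain hs hw hy hg
  have hz : ∀ u, fderiv ℝ g (y u) (w u) = 0 := by
    intro u
    have hd : HasFDerivAt (fun M : Euc d →L[ℝ] Euc d => M.det)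
        (fderiv ℝ (fun M : Euc d →L[ℝ] Euc d => M.det) (m u)) (m u) :=
      ((det_contDiff d).differentiable (by norm_num) (m u)).hasFDerivAt
    have h1 : HasFDerivAt (fun q : (Euc d →L[ℝ] Euc d) × ℝ => q.1.det) _ (y u) :=
      HasFDerivAt.comp (f := Prod.fst) (y u) hd hasFDerivAt_fst
    have h2 : HasFDerivAt (fun q : (Euc d →L[ℝ] Euc d) × ℝ => Real.exp (-q.2)) _ (y u) :=
      (hasFDerivAt_snd (p := y u)).neg.exp
    have h3 := (h1.mul h2).fderiv
    change fderiv ℝ g (y u) = _ at h3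
    rw [h3]
    change (m u).det * (Real.exp (-(y u).2) * (-(trL d (A u)))) + Real.exp (-(y u).2) *
      (fderiv ℝ (fun M : Euc d →L[ℝ] Euc d => M.det) (m u) ((A u).comp (m u))) = 0
    rw [det_fderiv]; ring
  simp only [hz, intervalIntegral.integral_zero] at key
  have hgs : g (y s) = 1 := by
    have : m s = ContinuousLinearMap.id ℝ (Euc d) := by rw [hm s hs']; simp
    simp only [g, y, this, intervalIntegral.integral_same, neg_zero, Real.exp_zero, mul_one]
    exact LinearMap.det_id
  rw [hgs] at key
  have h5 : (m c).det * Real.exp (-(∫ u in s..c, trL d (A u))) = 1 := by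
    simp only [g, y] at key; linarith
  rw [Real.exp_neg] at h5
  field_simp at h5
  exact h5

lemma ii_comp_left {d : ℕ} {a c : ℝ} (hac : a ≤ c) {L : ℝ → Euc d →L[ℝ] ℝ}
    {M : ℝ → Euc d →L[ℝ] Euc d} (hL : ContinuousOn L (Icc a c))
    (hM : IntervalIntegrable M volume a c) :
    IntervalIntegrable (fun u => (L u).comp (M u)) volume a c := by
  rw [intervalIntegrable_iff_integrableOn_Icc_of_le hac] at hM ⊢
  obtain ⟨K, hK⟩ := isCompact_Icc.exists_bound_of_continuousOn hL
  have hmm := hL.aestronglyMeasurable_of_isCompact (μ := volume) isCompact_Icc measurableSet_Icc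
  refine Integrable.mono' (hM.norm.const_mul K) ?_ ?_
  · exact (ContinuousLinearMap.compL ℝ (Euc d) (Euc d) ℝ).aestronglyMeasurable_comp₂
      hmm hM.aestronglyMeasurable
  · refine (ae_restrict_iff' measurableSet_Icc).2 (Eventually.of_forall fun u hu => ?_)
    exact (ContinuousLinearMap.opNorm_comp_le _ _).trans (by
      have := hK u hu
      gcongr)

lemma ii_left_apply {d : ℕ} {a c : ℝ} (hac : a ≤ c) {L : ℝ → Euc d →L[ℝ] ℝ}
    {r : ℝ → Euc d} (hL : ContinuousOn L (Icc a c))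
    (hr : IntervalIntegrable r volume a c) :
    IntervalIntegrable (fun u => L u (r u)) volume a c := by
  rw [intervalIntegrable_iff_integrableOn_Icc_of_le hac] at hr ⊢
  obtain ⟨K, hK⟩ := isCompact_Icc.exists_bound_of_continuousOn hL
  have hmm := hL.aestronglyMeasurable_of_isCompact (μ := volume) isCompact_Icc measurableSet_Icc
  refine Integrable.mono' (hr.norm.const_mul K) ?_ ?_
  · exact (ContinuousLinearMap.id ℝ (Euc d →L[ℝ] ℝ)).aestronglyMeasurable_comp₂
      hmm hr.aestronglyMeasurable
  · refine (ae_restrict_iff' measurableSet_Icc).2 (Eventually.of_forall fun u hu => ?_)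
    exact (ContinuousLinearMap.le_opNorm _ _).trans (by
      have := hK u hu
      gcongr)

lemma adj_exists {d : ℕ} {a : ℝ → Euc d →L[ℝ] Euc d} {β : ℝ → Euc d →L[ℝ] ℝ}
    (ha : IntervalIntegrable a volume 0 1) (hβ : IntervalIntegrable β volume 0 1) :
    ∃ p : ℝ → Euc d →L[ℝ] ℝ, ContinuousOn p (Icc 0 1) ∧
      ∀ t ∈ Icc (0:ℝ) 1, p t = ∫ u in t..1, (β u + (p u).comp (a u)) := by
  have ha' : IntervalIntegrable (fun u => a (1 - u)) volume 0 1 := by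
    have := (ha.comp_sub_left 1).symm; simpa using this
  have hβ' : IntervalIntegrable (fun u => β (1 - u)) volume 0 1 := by
    have := (hβ.comp_sub_left 1).symm; simpa using this
  obtain ⟨P, hPc, hP⟩ := lin_exists (X := Euc d →L[ℝ] ℝ) zero_le_one
    (A := fun u x => β (1 - u) + x.comp (a (1 - u))) (k := fun u => ‖a (1 - u)‖) ha'.norm
    (fun f hf => hβ'.add (ii_comp_left zero_le_one hf ha'))
    (by
      intro u _ x x'
      rw [add_sub_add_left_eq_sub, ← ContinuousLinearMap.sub_comp, mul_comm]
      exact ContinuousLinearMap.opNorm_comp_le _ _)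
    (fun u => norm_nonneg _) (b := fun _ => 0) continuousOn_const
  refine ⟨fun t => P (1 - t), hPc.comp (by fun_prop) fun t ht => ⟨by linarith [ht.2], by linarith [ht.1]⟩, ?_⟩
  intro t ht
  simp only
  rw [hP (1 - t) ⟨by linarith [ht.2], by linarith [ht.1]⟩, zero_add]
  have := intervalIntegral.integral_comp_sub_left (a := 0) (b := 1 - t)
    (fun u => β u + (P (1 - u)).comp (a u)) 1
  simp only [sub_sub_cancel, sub_zero] at this
  exact this

lemma duality {d : ℕ} {a : ℝ → Euc d →L[ℝ] Euc d} {β : ℝ → Euc d →L[ℝ] ℝ}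
    (ha : IntervalIntegrable a volume 0 1) (hβ : IntervalIntegrable β volume 0 1)
    {p : ℝ → Euc d →L[ℝ] ℝ} (hpc : ContinuousOn p (Icc 0 1))
    (hp : ∀ t ∈ Icc (0:ℝ) 1, p t = ∫ u in t..1, (β u + (p u).comp (a u)))
    {s : ℝ} (hs : s ∈ Icc (0:ℝ) 1) {ζ r : ℝ → Euc d} {q : Euc d}
    (hr : IntervalIntegrable r volume s 1) (hζc : ContinuousOn ζ (Icc s 1))
    (hζ : ∀ t ∈ Icc s 1, ζ t = q + ∫ u in s..t, (a u (ζ u) + r u)) :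
    ∫ u in s..1, β u (ζ u) = p s q + ∫ u in s..1, p u (r u) := by
  have h1m : (1:ℝ) ∈ Icc (0:ℝ) 1 := ⟨zero_le_one, le_rfl⟩
  have has := ii_sub ha hs h1m
  have hβs := ii_sub hβ hs h1m
  have hsub : Icc s 1 ⊆ Icc (0:ℝ) 1 := Icc_subset_Icc_left hs.1
  have hps := hpc.mono hsub
  have hs1 : s ∈ Icc s 1 := ⟨le_rfl, hs.2⟩
  have hw1 : IntervalIntegrable (fun u => β u + (p u).comp (a u)) volume s 1 :=
    hβs.add (ii_comp_left hs.2 hps has)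
  have haz := ii_apply hs.2 has hζc
  have hw2 : IntervalIntegrable (fun u => a u (ζ u) + r u) volume s 1 := haz.add hr
  let w : ℝ → (Euc d →L[ℝ] ℝ) × Euc d := fun u => (-(β u + (p u).comp (a u)), a u (ζ u) + r u)
  have hw : IntervalIntegrable w volume s 1 :=
    (intervalIntegrable_iff_integrableOn_Ioc_of_le hs.2).2 (hw1.neg.1.prodMk hw2.1)
  let y : ℝ → (Euc d →L[ℝ] ℝ) × Euc d := fun t => (p t, ζ t)
  have hy : ∀ t ∈ Icc s 1, y t = (p s, q) + ∫ u in s..t, w u := by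
    intro t ht
    have hi := ii_sub hw hs1 ht
    have h1 := (ContinuousLinearMap.fst ℝ (Euc d →L[ℝ] ℝ) (Euc d)).intervalIntegral_comp_comm hi
    have h2 := (ContinuousLinearMap.snd ℝ (Euc d →L[ℝ] ℝ) (Euc d)).intervalIntegral_comp_comm hi
    simp only [ContinuousLinearMap.coe_fst'] at h1
    simp only [ContinuousLinearMap.coe_snd'] at h2
    refine Prod.ext ?_ ?_
    · rw [Prod.fst_add, ← h1]
      simp only [w, y]
      rw [intervalIntegral.integral_neg, hp t (hsub ht), hp s hs,
        ← intervalIntegral.integral_add_adjacent_intervals (ii_sub hw1 hs1 ht)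
          (ii_sub hw1 ht ⟨hs.2, le_rfl⟩)]
      abel
    · rw [Prod.snd_add, ← h2]
      exact hζ t ht
  let g : (Euc d →L[ℝ] ℝ) × Euc d → ℝ := fun z => z.1 z.2
  have hg : ContDiff ℝ 1 g := contDiff_fst.clm_apply contDiff_snd
  have key := ac_chain hs.2 hw hy hg
  have hfd : ∀ u, fderiv ℝ g (y u) (w u) = p u (r u) - β u (ζ u) := by
    intro u
    have h3 := ((hasFDerivAt_fst (𝕜 := ℝ) (p := y u)).clm_apply (hasFDerivAt_snd (𝕜 := ℝ) (p := y u))).fderiv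
    change fderiv ℝ g (y u) = _ at h3
    rw [h3]
    change p u (a u (ζ u) + r u) + (-(β u + (p u).comp (a u))) (ζ u) = _
    simp
    ring
  simp only [hfd] at key
  have hp1 : p 1 = 0 := by rw [hp 1 h1m, intervalIntegral.integral_same]
  have hzs : ζ s = q := by rw [hζ s hs1, intervalIntegral.integral_same, add_zero]
  rw [intervalIntegral.integral_sub (ii_left_apply hs.2 hps hr) (ii_apply hs.2 hβs hζc)] at key
  simp only [g, y, hp1, hzs, _root_.zero_apply] at key
  linarith

section
variable {d : ℕ} {V : Type*} [NormedAddCommGroup V] [NormedSpace ℝ V] (X : ExtFld d V)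

/-- coefficient of the linearised divergence -/
def ExtFld.bet (f : V) (y : Euc d) : Euc d →L[ℝ] ℝ := (trL d).comp (X.T2 f y)

lemma T1_int {a c : ℝ} (hac : a ≤ c) {v : ℝ → V} (hv : StronglyMeasurable v)
    (hvi : IntegrableOn (fun u => ‖v u‖) (Icc a c)) {y : ℝ → Euc d}
    (hy : ContinuousOn y (Icc a c)) :
    IntervalIntegrable (fun u => X.T1 (v u) (y u)) volume a c :=
  bd_int X.add1 X.b1 X.cT1 hac hv hvi hy

lemma T0_int {a c : ℝ} (hac : a ≤ c) {v : ℝ → V} (hv : StronglyMeasurable v)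
    (hvi : IntegrableOn (fun u => ‖v u‖) (Icc a c)) {y : ℝ → Euc d}
    (hy : ContinuousOn y (Icc a c)) :
    IntervalIntegrable (fun u => X.T0 (v u) (y u)) volume a c :=
  bd_int X.add0 X.b0 X.cT0 hac hv hvi hy

lemma bet_int {a c : ℝ} (hac : a ≤ c) {v : ℝ → V} (hv : StronglyMeasurable v)
    (hvi : IntegrableOn (fun u => ‖v u‖) (Icc a c)) {y : ℝ → Euc d}
    (hy : ContinuousOn y (Icc a c)) :
    IntervalIntegrable (fun u => X.bet (v u) (y u)) volume a c := by
  refine bd_int (S := X.bet) (C := ‖trL d‖ * X.C) ?_ ?_ ?_ hac hv hvi hy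
  · intro f g z
    simp only [ExtFld.bet, X.add2, ContinuousLinearMap.comp_add]
  · intro f z
    refine (ContinuousLinearMap.opNorm_comp_le _ _).trans ?_
    rw [mul_assoc]
    have := X.b2 f z
    gcongr
  · intro f
    exact continuous_const.clm_comp (X.hc2 f)

/-- components of the sensitivity along a direction -/
lemma sens_comp {s c : ℝ} (hs : s ≤ c) {v h : ℝ → V} (hv : StronglyMeasurable v)
    (hh : StronglyMeasurable h)
    (hvi : IntegrableOn (fun u => ‖v u‖) (Icc s c)) (hhi : IntegrableOn (fun u => ‖h u‖) (Icc s c))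
    {y : ℝ → Euc d} (hy : ContinuousOn y (Icc s c))
    {η : ℝ → (Euc d × ℝ) →L[ℝ] (Euc d × ℝ)} (hηc : ContinuousOn η (Icc s c)) {q : Euc d} {e : ℝ}
    (hη : ∀ t ∈ Icc s c, η t (q, e) =
        (q, 0) + ∫ u in s..t, (X.G' (v u) (y u) (η u (q, e)).1 + e • X.G (h u) (y u))) :
    ContinuousOn (fun t => (η t (q, e)).1) (Icc s c) ∧
    (∀ t ∈ Icc s c, (η t (q, e)).1 = q + ∫ u in s..t, (X.T1 (v u) (y u) (η u (q, e)).1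
      + e • X.T0 (h u) (y u))) ∧
    (∀ t ∈ Icc s c, (η t (q, e)).2 = ∫ u in s..t, (X.bet (v u) (y u) (η u (q, e)).1
      + e * trL d (X.T1 (h u) (y u)))) := by
  have hs' : s ∈ Icc s c := ⟨le_rfl, hs⟩
  have hζc : ContinuousOn (fun t => (η t (q, e)).1) (Icc s c) :=
    continuous_fst.comp_continuousOn (hηc.clm_apply continuousOn_const)
  have hi : IntervalIntegrable
      (fun u => X.G' (v u) (y u) (η u (q, e)).1 + e • X.G (h u) (y u)) volume s c :=
    (ii_apply hs (bd_int X.addG' X.bG' X.cG' hs hv hvi hy) hζc).add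
      ((bd_int X.addG X.bG X.cG hs hh hhi hy).smul e)
  refine ⟨hζc, fun t ht => ?_, fun t ht => ?_⟩
  · have h1 := (ContinuousLinearMap.fst ℝ (Euc d) ℝ).intervalIntegral_comp_comm (ii_sub hi hs' ht)
    simp only [ContinuousLinearMap.coe_fst'] at h1
    rw [hη t ht, Prod.fst_add, ← h1]
    rfl
  · have h1 := (ContinuousLinearMap.snd ℝ (Euc d) ℝ).intervalIntegral_comp_comm (ii_sub hi hs' ht)
    simp only [ContinuousLinearMap.coe_snd'] at h1
    rw [hη t ht, Prod.snd_add, ← h1, zero_add]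
    rfl

lemma jac {s c : ℝ} (hs : s ≤ c) {v : ℝ → V} (hv : StronglyMeasurable v)
    (hvi : IntegrableOn (fun u => ‖v u‖) (Icc s c))
    {Ω : Set (Euc d)} (hΩ : IsOpen Ω) {Ψ : ℝ → Euc d → Euc d}
    (hΨc : ∀ x ∈ Ω, ContinuousOn (fun t => Ψ t x) (Icc s c))
    (hΨ : ∀ x ∈ Ω, ∀ t ∈ Icc s c, Ψ t x = x + ∫ u in s..t, X.T0 (v u) (Ψ u x))
    {x0 : Euc d} (hx0 : x0 ∈ Ω) :
    Real.log (fderiv ℝ (Ψ c) x0).det = ∫ u in s..c, trL d (X.T1 (v u) (Ψ u x0)) := by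
  have hhi : IntegrableOn (fun u : ℝ => ‖(0 : V)‖) (Icc s c) := by simp
  have hc' : c ∈ Icc s c := ⟨hs, le_rfl⟩
  obtain ⟨η, hηc, hη, hηd⟩ := sens X hs hv (h := fun _ => 0) stronglyMeasurable_const hvi hhi hΩ
    (Ψ := fun _ => Ψ) (fun _ => hΨc) (fun e x hx t ht => by simpa using hΨ x hx t ht) hx0
  have hyc := hΨc x0 hx0
  have hcomp := fun q => sens_comp X hs hv stronglyMeasurable_const hvi hhi hyc hηc
    (fun t ht => hη t ht q 0)
  let J : Euc d →L[ℝ] Euc d × ℝ := ContinuousLinearMap.inl ℝ (Euc d) ℝ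
  let m : ℝ → Euc d →L[ℝ] Euc d := fun t => (ContinuousLinearMap.fst ℝ (Euc d) ℝ).comp ((η t).comp J)
  have hmc : ContinuousOn m (Icc s c) :=
    continuousOn_const.clm_comp (hηc.clm_comp continuousOn_const)
  have hA := T1_int X hs hv hvi hyc
  have hAm : IntervalIntegrable (fun u => (X.T1 (v u) (Ψ u x0)).comp (m u)) volume s c :=
    ii_comp_right hs hA hmc
  have hm : ∀ t ∈ Icc s c, m t = ContinuousLinearMap.id ℝ (Euc d) +
      ∫ u in s..t, (X.T1 (v u) (Ψ u x0)).comp (m u) := by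
    intro t ht
    refine ContinuousLinearMap.ext fun q => ?_
    rw [_root_.add_apply, ContinuousLinearMap.intervalIntegral_apply (ii_sub hAm ⟨le_rfl, hs⟩ ht)]
    have := (hcomp q).2.1 t ht
    simp only [zero_smul, add_zero] at this
    exact this
  have hder : HasFDerivAt (Ψ c) (m c) x0 := by
    have h1 : HasFDerivAt (fun x : Euc d => (x, (0:ℝ))) J x0 := hasFDerivAt_prodMk_left x0 0
    have h2 := (hηd c hc').comp (f := fun x : Euc d => (x, (0:ℝ))) x0 h1
    exact (hasFDerivAt_fst (𝕜 := ℝ)).comp x0 h2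
  rw [hder.fderiv, liouville hs hA hmc hm, Real.log_exp]

lemma grad {v : ℝ → V} (hv : StronglyMeasurable v)
    (hvi : IntegrableOn (fun u => ‖v u‖) (Icc 0 1)) {s : ℝ} (hs : s ∈ Icc (0:ℝ) 1)
    {Ω : Set (Euc d)} (hΩ : IsOpen Ω) {Ψ : ℝ → Euc d → Euc d}
    (hΨc : ∀ x ∈ Ω, ContinuousOn (fun t => Ψ t x) (Icc s 1))
    (hΨ : ∀ x ∈ Ω, ∀ t ∈ Icc s 1, Ψ t x = x + ∫ u in s..t, X.T0 (v u) (Ψ u x))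
    {x0 : Euc d} (hx0 : x0 ∈ Ω) {y : ℝ → Euc d} (hyc : ContinuousOn y (Icc 0 1))
    (hyΨ : ∀ t ∈ Icc s 1, Ψ t x0 = y t)
    {p : ℝ → Euc d →L[ℝ] ℝ} (hpc : ContinuousOn p (Icc 0 1))
    (hp : ∀ t ∈ Icc (0:ℝ) 1, p t = ∫ u in t..1, (X.bet (v u) (y u)
      + (p u).comp (X.T1 (v u) (y u)))) :
    HasFDerivAt (fun x => ∫ u in s..1, trL d (X.T1 (v u) (Ψ u x))) (p s) x0 := by
  have hhi : IntegrableOn (fun u : ℝ => ‖(0 : V)‖) (Icc s 1) := by simp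
  have h1m : (1:ℝ) ∈ Icc s 1 := ⟨hs.2, le_rfl⟩
  have hvis := hvi.mono_set (Icc_subset_Icc_left hs.1)
  have hycs := hyc.mono (Icc_subset_Icc_left hs.1)
  obtain ⟨η, hηc, hη, hηd⟩ := sens X hs.2 hv (h := fun _ => 0) stronglyMeasurable_const hvis hhi hΩ
    (Ψ := fun _ => Ψ) (fun _ => hΨc) (fun e x hx t ht => by simpa using hΨ x hx t ht) hx0
  have hη' : ∀ q, ∀ t ∈ Icc s 1, η t (q, 0) =
        (q, 0) + ∫ u in s..t, (X.G' (v u) (y u) (η u (q, 0)).1 + (0:ℝ) • X.G 0 (y u)) := by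
    intro q t ht
    rw [hη t ht q 0]
    congr 1
    refine intervalIntegral.integral_congr fun u hu => ?_
    rw [uIcc_of_le ht.1] at hu
    simp only [hyΨ u ⟨hu.1, hu.2.trans ht.2⟩]
  have hcomp := fun q => sens_comp X hs.2 hv stronglyMeasurable_const hvis hhi hycs hηc (hη' q)
  let J : Euc d →L[ℝ] Euc d × ℝ := ContinuousLinearMap.inl ℝ (Euc d) ℝ
  have h1 : HasFDerivAt (fun x : Euc d => (x, (0:ℝ))) J x0 := hasFDerivAt_prodMk_left x0 0
  have h2 := (hηd 1 h1m).comp (f := fun x : Euc d => (x, (0:ℝ))) x0 h1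
  have h3 := (hasFDerivAt_snd (𝕜 := ℝ)).comp x0 h2
  refine (h3.congr_of_eventuallyEq (Eventually.of_forall fun x => ?_)).congr_fderiv ?_
  · simp
  · refine ContinuousLinearMap.ext fun q => ?_
    change (η 1 (q, 0)).2 = p s q
    obtain ⟨hc1, hc2, hc3⟩ := hcomp q
    rw [hc3 1 h1m]
    simp only [zero_mul, add_zero]
    rw [duality (T1_int X zero_le_one hv hvi hyc) (bet_int X zero_le_one hv hvi hyc) hpc hp hs
      (r := fun _ => 0) (by simp) hc1 (fun t ht => by simpa using hc2 t ht)]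
    simp

lemma deps {v h : ℝ → V} (hv : StronglyMeasurable v) (hh : StronglyMeasurable h)
    (hvi : IntegrableOn (fun u => ‖v u‖) (Icc 0 1)) (hhi : IntegrableOn (fun u => ‖h u‖) (Icc 0 1))
    {Ω : Set (Euc d)} (hΩ : IsOpen Ω) {Ψ : ℝ → ℝ → Euc d → Euc d}
    (hΨc : ∀ e, ∀ x ∈ Ω, ContinuousOn (fun t => Ψ e t x) (Icc 0 1))
    (hΨ : ∀ e, ∀ x ∈ Ω, ∀ t ∈ Icc (0:ℝ) 1,
      Ψ e t x = x + ∫ u in (0:ℝ)..t, X.T0 (v u + e • h u) (Ψ e u x))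
    {x0 : Euc d} (hx0 : x0 ∈ Ω)
    {p : ℝ → Euc d →L[ℝ] ℝ} (hpc : ContinuousOn p (Icc 0 1))
    (hp : ∀ t ∈ Icc (0:ℝ) 1, p t = ∫ u in t..1, (X.bet (v u) (Ψ 0 u x0)
      + (p u).comp (X.T1 (v u) (Ψ 0 u x0)))) :
    HasDerivAt (fun e => ∫ u in (0:ℝ)..1, trL d (X.T1 (v u + e • h u) (Ψ e u x0)))
      (∫ u in (0:ℝ)..1, (p u (X.T0 (h u) (Ψ 0 u x0)) + trL d (X.T1 (h u) (Ψ 0 u x0)))) 0 := by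
  have h1m : (1:ℝ) ∈ Icc (0:ℝ) 1 := ⟨zero_le_one, le_rfl⟩
  have h0m : (0:ℝ) ∈ Icc (0:ℝ) 1 := ⟨le_rfl, zero_le_one⟩
  obtain ⟨η, hηc, hη, hηd⟩ := sens X zero_le_one hv hh hvi hhi hΩ hΨc hΨ hx0
  have hyc := hΨc 0 x0 hx0
  obtain ⟨hc1, hc2, hc3⟩ := sens_comp X zero_le_one hv hh hvi hhi hyc hηc
    (fun t ht => hη t ht 0 1)
  have h1 : HasDerivAt (fun e : ℝ => (x0, e)) ((0 : Euc d), (1:ℝ)) 0 :=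
    (hasDerivAt_const (0:ℝ) x0).prodMk (hasDerivAt_id (0:ℝ))
  have h2 := HasFDerivAt.comp_hasDerivAt (f := fun e : ℝ => (x0, e)) (0:ℝ) (hηd 1 h1m) h1
  have h3 := (hasFDerivAt_snd (𝕜 := ℝ)).comp_hasDerivAt (0:ℝ) h2
  refine h3.congr_deriv ?_
  change (η 1 (0, 1)).2 = _
  have hT0 := T0_int X zero_le_one hh hhi hyc
  have hT1 := T1_int X zero_le_one hh hhi hyc
  have htr : IntervalIntegrable (fun u => trL d (X.T1 (h u) (Ψ 0 u x0))) volume 0 1 :=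
    (intervalIntegrable_iff_integrableOn_Ioc_of_le zero_le_one).2 ((trL d).integrable_comp hT1.1)
  have hβ := bet_int X zero_le_one hv hvi hyc
  rw [hc3 1 h1m]
  simp only [one_mul]
  rw [intervalIntegral.integral_add (ii_apply zero_le_one hβ hc1) htr,
    intervalIntegral.integral_add (ii_left_apply zero_le_one hpc hT0) htr,
    duality (q := 0) (T1_int X zero_le_one hv hvi hyc) hβ hpc hp h0m hT0 hc1
      (fun t ht => by have := hc2 t ht; simpa only [one_smul] using this)]
  simp

end

/-- derivative of the log-Jacobian-determinant in the vector field: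
`∂_ε log det Dφ^{v+εh}_1(x)|_{ε=0}
   = ∫₀¹ [h_u ⬝ ∇ log det Dφ^v_{u1} + div h_u] ∘ φ^v_u(x) du`. -/
theorem stmt_11 {d : ℕ} (Ω : Set (Euc d)) (hΩo : IsOpen Ω) (hΩb : Bornology.IsBounded Ω)
    (V : Type*) [NormedAddCommGroup V] [InnerProductSpace ℝ V] [CompleteSpace V]
    [MeasurableSpace V] [BorelSpace V]
    (ι : V →ₗ[ℝ] (Euc d → Euc d)) (hinj : Function.Injective ι)
    (c : ℝ) (hc : 0 < c)
    (hemb : ∀ f : V, MemC0k 3 Ω (ι f) ∧ CknormOn 3 Ω (ι f) ≤ c * ‖f‖)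
    (Φ : (ℝ → V) → ℝ → ℝ → Euc d → Euc d)
    (hflow : ∀ v : ℝ → V, InV01 v → ∀ s ∈ Icc (0:ℝ) 1, ∀ t ∈ Icc (0:ℝ) 1, ∀ x ∈ Ω,
      Φ v s t x = x + ∫ u in s..t, ι (v u) (Φ v s u x))
    (v h : ℝ → V) (hv : InV01 v) (hh : InV01 h) :
    ∀ x ∈ Ω,
      HasDerivAt
        (fun e : ℝ => Real.log ((fderiv ℝ (Φ (fun u => v u + e • h u) 0 1) x).det))
        (∫ u in (0:ℝ)..1,
          (⟪ι (h u) (Φ v 0 u x),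
              gradient (fun y => Real.log ((fderiv ℝ (Φ v u 1) y).det)) (Φ v 0 u x)⟫
            + divg (ι (h u)) (Φ v 0 u x)))
        0 := by
  intro x hx
  let X : ExtFld d V := mkExt Ω hΩo hΩb V ι c hc hemb
  have hT0 : ∀ f : V, ∀ y ∈ Ω, ι f y = X.T0 f y := fun f y hy =>
    (indicator_of_mem hy (ι f)).symm
  have hT1 : ∀ f : V, ∀ y ∈ Ω, fderiv ℝ (ι f) y = X.T1 f y := fun f y hy =>
    (indicator_of_mem hy (fderiv ℝ (ι f))).symm
  have hT0' : ∀ f : V, ∀ y, y ∉ Ω → X.T0 f y = 0 := fun f y hy =>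
    indicator_of_notMem hy (ι f)
  have hki : ∀ w : ℝ → V, InV01 w → ∀ s ∈ Icc (0:ℝ) 1,
      IntervalIntegrable (fun u => X.C * ‖w u‖) volume s 1 := by
    intro w hw s hs
    rw [intervalIntegrable_iff_integrableOn_Icc_of_le hs.2]
    exact (hw.norm_int.mono_set (Icc_subset_Icc_left hs.1)).const_mul X.C
  have hk0 : ∀ w : ℝ → V, ∀ u, 0 ≤ X.C * ‖w u‖ := fun w u => mul_nonneg X.hC (norm_nonneg _)
  have hni : ∀ w : ℝ → V, InV01 w → ∀ s ∈ Icc (0:ℝ) 1,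
      IntegrableOn (fun u => ‖w u‖) (Icc s 1) := fun w hw s hs =>
    hw.norm_int.mono_set (Icc_subset_Icc_left hs.1)
  have key : ∀ w : ℝ → V, InV01 w → ∀ s ∈ Icc (0:ℝ) 1, ∀ z ∈ Ω,
      ContinuousOn (fun t => Φ w s t z) (Icc s 1) ∧ (∀ t ∈ Icc s 1, Φ w s t z ∈ Ω) ∧
      ∀ t ∈ Icc s 1, Φ w s t z = z + ∫ u in s..t, X.T0 (w u) (Φ w s u z) := by
    intro w hw s hs z hz
    exact flow_ident (A := fun u y => X.T0 (w u) y) (B := fun u y => ι (w u) y) hs.2 (hki w hw s hs)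
      (fun f hf => T0_int X hs.2 hw.sm (hni w hw s hs) hf)
      (fun u _ y y' => X.lipT0 (w u) y y') (hk0 w) hΩo (fun u => hT0' (w u)) (fun u => hT0 (w u)) hz
      (fun t ht => hflow w hw s hs t ⟨hs.1.trans ht.1, ht.2⟩ z hz)
  have h0m : (0:ℝ) ∈ Icc (0:ℝ) 1 := ⟨le_rfl, zero_le_one⟩
  have h1m : (1:ℝ) ∈ Icc (0:ℝ) 1 := ⟨zero_le_one, le_rfl⟩
  obtain ⟨hyc, hyΩ, hy⟩ := key v hv 0 h0m x hx
  have hv0 : (fun u => v u + (0:ℝ) • h u) = v := by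
    funext u; simp
  have hwe := fun e : ℝ => hv.add_smul hh e
  obtain ⟨p, hpc, hp⟩ := adj_exists (T1_int X zero_le_one hv.sm hv.norm_int hyc)
    (bet_int X zero_le_one hv.sm hv.norm_int hyc)
  have hD := deps X hv.sm hh.sm hv.norm_int hh.norm_int hΩo
    (Ψ := fun e t z => Φ (fun u => v u + e • h u) 0 t z)
    (fun e z hz => (key _ (hwe e) 0 h0m z hz).1)
    (fun e z hz => (key _ (hwe e) 0 h0m z hz).2.2) hx hpc
    (by simp only [hv0]; exact hp)
  simp only [hv0] at hD
  have hfun : (fun e : ℝ => Real.log ((fderiv ℝ (Φ (fun u => v u + e • h u) 0 1) x).det)) =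
      fun e => ∫ u in (0:ℝ)..1, trL d (X.T1 (v u + e • h u) (Φ (fun u => v u + e • h u) 0 u x)) := by
    funext e
    exact jac X zero_le_one (hwe e).sm (hwe e).norm_int hΩo
      (Ψ := fun t z => Φ (fun u => v u + e • h u) 0 t z)
      (fun z hz => (key _ (hwe e) 0 h0m z hz).1)
      (fun z hz => (key _ (hwe e) 0 h0m z hz).2.2) hx
  rw [hfun]
  refine hD.congr_deriv ?_
  refine intervalIntegral.integral_congr fun s hs => ?_
  rw [uIcc_of_le zero_le_one] at hs
  have hyΩs := hyΩ s hs
  obtain ⟨hfc, hfΩ, hf⟩ := key v hv s hs _ hyΩs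
  have hsub : Icc s 1 ⊆ Icc (0:ℝ) 1 := Icc_subset_Icc_left hs.1
  have hyi := T0_int X zero_le_one hv.sm hv.norm_int hyc
  have hflowp : ∀ t ∈ Icc s 1, Φ v s t (Φ v 0 s x) = Φ v 0 t x := by
    refine ode_unique (A := fun u y => X.T0 (v u) y) (b := fun _ => Φ v 0 s x) (hki v hv s hs)
      (fun u _ y y' => X.lipT0 (v u) y y') (hk0 v) hfc (hyc.mono hsub)
      (T0_int X hs.2 hv.sm (hni v hv s hs) hfc)
      (T0_int X hs.2 hv.sm (hni v hv s hs) (hyc.mono hsub)) hf ?_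
    intro t ht
    have e1 := hy t (hsub ht)
    have e2 := hy s hs
    have e3 := intervalIntegral.integral_add_adjacent_intervals (ii_sub hyi h0m hs)
      (ii_sub hyi hs (hsub ht))
    rw [e1, ← e3, ← add_assoc, ← e2]
  have hG := grad X hv.sm hv.norm_int hs hΩo (Ψ := fun t z => Φ v s t z)
    (fun z hz => (key v hv s hs z hz).1) (fun z hz => (key v hv s hs z hz).2.2) hyΩs hyc hflowp
    hpc hp
  have hG' : HasFDerivAt (fun y => Real.log ((fderiv ℝ (Φ v s 1) y).det)) (p s) (Φ v 0 s x) := by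
    refine hG.congr_of_eventuallyEq ?_
    filter_upwards [hΩo.mem_nhds hyΩs] with z hz
    exact jac X hs.2 hv.sm (hni v hv s hs) hΩo (Ψ := fun t z => Φ v s t z)
      (fun z hz => (key v hv s hs z hz).1) (fun z hz => (key v hv s hs z hz).2.2) hz
  have hdiv : divg (ι (h s)) (Φ v 0 s x) = trL d (X.T1 (h s) (Φ v 0 s x)) := by
    rw [← hT1 _ _ hyΩs]; rfl
  rw [hdiv, hT0 _ _ hyΩs, gradient, hG'.fderiv, real_inner_comm,
    InnerProductSpace.toDual_symm_apply]
end
end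

section
/- Let Ω be a bounded open subset of ℝ^d and V a Hilbert space continuously embedded in C_0^2(Ω,ℝ^d). Let v^m ∈ V^{[0,1]} be a sequence with ‖v^m‖_{V^{[0,1]}} ≤ M for all m, converging weakly in V^{[0,1]} to v̂ ∈ V^{[0,1]}, and suppose that for each x ∈ Ω, φ^{v^m}_t(x) → φ^{v̂}_t(x) uniformly in t ∈ [0,1] as m → ∞. Then for every x ∈ Ω, log det Dφ^{v^m}_1(x) → log det Dφ^{v̂}_1(x) as m → ∞. -/
open MeasureTheory Set Filter
open scoped RealInnerProductSpace BigOperators Topology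

noncomputable section

lemma gron14 (k u : ℝ → ℝ) (a T : ℝ) (hT : 0 ≤ T) (hk : IntervalIntegrable k volume 0 T)
    (hk0 : ∀ t, 0 ≤ k t) (hu : ContinuousOn u (Icc 0 T)) (hu0 : ∀ t ∈ Icc 0 T, 0 ≤ u t)
    (h : ∀ t ∈ Icc 0 T, u t ≤ a + ∫ s in (0:ℝ)..t, k s * u s) :
    ∀ t ∈ Icc 0 T, u t ≤ a * Real.exp (2 * ∫ s in (0:ℝ)..t, k s) := by
  have hTT : uIcc 0 T = Icc 0 T := uIcc_of_le hT
  have hku : IntervalIntegrable (fun s => k s * u s) volume 0 T := by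
    apply hk.mul_continuousOn; rwa [hTT]
  have sub : ∀ {f : ℝ → ℝ}, IntervalIntegrable f volume 0 T → ∀ s ∈ Icc 0 T, ∀ t ∈ Icc 0 T,
      IntervalIntegrable f volume s t := by
    intro f hf s hs t ht
    apply hf.mono_set
    rw [hTT]
    exact (convex_Icc 0 T).ordConnected.uIcc_subset hs ht
  have h0 : (0:ℝ) ∈ Icc 0 T := ⟨le_rfl, hT⟩
  set g : ℝ → ℝ := fun t => a + ∫ s in (0:ℝ)..t, k s * u s with hg
  set K : ℝ → ℝ := fun t => ∫ s in (0:ℝ)..t, k s with hK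
  have hKc : ContinuousOn K (Icc 0 T) := by
    rw [← hTT]
    apply intervalIntegral.continuousOn_primitive_interval
    rw [hTT]
    exact (intervalIntegrable_iff_integrableOn_Icc_of_le hT).1 hk
  have hKd : ∀ s ∈ Icc 0 T, ∀ t ∈ Icc 0 T, K t - K s = ∫ r in s..t, k r := by
    intro s hs t ht
    exact intervalIntegral.integral_interval_sub_left (sub hk _ h0 _ ht) (sub hk _ h0 _ hs)
  have hgd : ∀ s ∈ Icc 0 T, ∀ t ∈ Icc 0 T, g t - g s = ∫ r in s..t, k r * u r := by
    intro s hs t ht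
    rw [← intervalIntegral.integral_interval_sub_left (sub hku _ h0 _ ht) (sub hku _ h0 _ hs)]
    simp [hg]
  have hgm : ∀ s ∈ Icc 0 T, ∀ t ∈ Icc 0 T, s ≤ t → g s ≤ g t := by
    intro s hs t ht hst
    have : 0 ≤ g t - g s := by
      rw [hgd s hs t ht]
      apply intervalIntegral.integral_nonneg hst
      intro r hr
      exact mul_nonneg (hk0 r) (hu0 r ⟨hs.1.trans hr.1, hr.2.trans ht.2⟩)
    linarith
  have hKm : ∀ s ∈ Icc 0 T, ∀ t ∈ Icc 0 T, s ≤ t → 0 ≤ K t - K s := by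
    intro s hs t ht hst
    rw [hKd s hs t ht]
    exact intervalIntegral.integral_nonneg hst fun r _ => hk0 r
  have hg0 : ∀ s ∈ Icc 0 T, 0 ≤ g s := fun s hs => (hu0 s hs).trans (h s hs)
  obtain ⟨δ, hδ, hδK⟩ := Metric.uniformContinuousOn_iff.1
    (isCompact_Icc.uniformContinuousOn_of_continuous hKc) (1/2) (by norm_num)
  have step : ∀ s ∈ Icc 0 T, ∀ t ∈ Icc 0 T, s ≤ t → t - s < δ →
      g t ≤ g s * Real.exp (2 * (K t - K s)) := by
    intro s hs t ht hst hd
    have hx0 := hKm s hs t ht hst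
    have hx1 : K t - K s < 1/2 := by
      have := hδK t ht s hs (by rw [Real.dist_eq, abs_of_nonneg (by linarith)]; exact hd)
      rw [Real.dist_eq] at this
      exact (le_abs_self _).trans_lt this
    have h1 : g t - g s ≤ (K t - K s) * g t := by
      rw [hgd s hs t ht, hKd s hs t ht, ← intervalIntegral.integral_mul_const]
      apply intervalIntegral.integral_mono_on hst (sub hku s hs t ht)
        ((sub hk s hs t ht).mul_const _)
      intro r hr
      have hr' : r ∈ Icc 0 T := ⟨hs.1.trans hr.1, hr.2.trans ht.2⟩
      exact mul_le_mul_of_nonneg_left ((h r hr').trans (hgm r hr' t ht hr.2)) (hk0 r)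
    have h2 := Real.add_one_le_exp (2 * (K t - K s))
    set x := K t - K s
    have h3 := hg0 t ht
    have h4 := hg0 s hs
    calc g t ≤ g t * (1 - x) * (2 * x + 1) := by nlinarith [mul_nonneg h3 hx0]
      _ ≤ g s * (2 * x + 1) := by
        apply mul_le_mul_of_nonneg_right _ (by linarith)
        linarith
      _ ≤ _ := mul_le_mul_of_nonneg_left h2 h4
  have key : ∀ n : ℕ, ∀ t ∈ Icc 0 T, t ≤ n * (δ / 2) → g t ≤ a * Real.exp (2 * K t) := by
    intro n
    induction n with
    | zero =>
      intro t ht htn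
      have : t = 0 := by
        have := ht.1
        simp at htn
        linarith
      subst this
      simp [hg, hK]
    | succ n ih =>
      intro t ht htn
      push_cast at htn
      by_cases hc : t ≤ n * (δ / 2)
      · exact ih t ht hc
      push Not at hc
      have hs : (n * (δ / 2) : ℝ) ∈ Icc 0 T := ⟨by positivity, hc.le.trans ht.2⟩
      have h1 := step _ hs t ht hc.le (by linarith)
      have h2 := ih _ hs le_rfl
      calc g t ≤ _ := h1
        _ ≤ _ := mul_le_mul_of_nonneg_right h2 (Real.exp_nonneg _)
        _ = _ := by rw [mul_assoc, ← Real.exp_add]; congr 2; ring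
  intro t ht
  obtain ⟨n, hn⟩ := exists_nat_ge (T / (δ / 2))
  refine (h t ht).trans (key n t ht (ht.2.trans ?_))
  rwa [div_le_iff₀ (by positivity)] at hn

lemma gronF14 {E : Type*} [NormedAddCommGroup E] [NormedSpace ℝ E]
    (k : ℝ → ℝ) (e g : ℝ → E) (S T : ℝ) (hT : 0 ≤ T)
    (hk : IntervalIntegrable k volume 0 T) (hS : 0 ≤ S)
    (hk0 : ∀ t, 0 ≤ k t) (he : ContinuousOn e (Icc 0 T))
    (hg : ∀ t ∈ Icc 0 T, ‖g t‖ ≤ k t * ‖e t‖ + k t * S)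
    (h : ∀ t ∈ Icc 0 T, e t = e 0 + ∫ s in (0:ℝ)..t, g s) :
    ∀ t ∈ Icc 0 T, ‖e t‖ ≤ (‖e 0‖ + S * ∫ s in (0:ℝ)..T, k s) *
      Real.exp (2 * ∫ s in (0:ℝ)..T, k s) := by
  have hTT : uIcc 0 T = Icc 0 T := uIcc_of_le hT
  have sub : ∀ {f : ℝ → ℝ}, IntervalIntegrable f volume 0 T → ∀ t ∈ Icc 0 T,
      IntervalIntegrable f volume 0 t := by
    intro f hf t ht
    apply hf.mono_set
    rw [hTT, uIcc_of_le ht.1]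
    exact Icc_subset_Icc_right ht.2
  have hku : IntervalIntegrable (fun s => k s * ‖e s‖) volume 0 T := by
    apply hk.mul_continuousOn; rw [hTT]; exact he.norm
  have hmono : ∀ t ∈ Icc 0 T, ∫ s in (0:ℝ)..t, k s ≤ ∫ s in (0:ℝ)..T, k s := by
    intro t ht
    apply intervalIntegral.integral_mono_interval le_rfl ht.1 ht.2 _ hk
    exact Eventually.of_forall hk0
  intro t ht
  have := gron14 k (fun t => ‖e t‖) (‖e 0‖ + S * ∫ s in (0:ℝ)..T, k s) T hT hk hk0 he.norm
    (fun _ _ => norm_nonneg _) ?_ t ht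
  · refine this.trans ?_
    have h1 : 0 ≤ ∫ s in (0:ℝ)..T, k s := intervalIntegral.integral_nonneg hT fun r _ => hk0 r
    have := hmono t ht
    gcongr
  · intro t ht
    have h1 : ‖∫ s in (0:ℝ)..t, g s‖ ≤ ∫ s in (0:ℝ)..t, (k s * ‖e s‖ + k s * S) := by
      apply intervalIntegral.norm_integral_le_of_norm_le ht.1
      · exact Eventually.of_forall fun s hs => hg s ⟨hs.1.le, hs.2.trans ht.2⟩
      · exact (sub hku t ht).add ((sub hk t ht).mul_const S)
    rw [intervalIntegral.integral_add (sub hku t ht) ((sub hk t ht).mul_const S),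
      intervalIntegral.integral_mul_const] at h1
    have h2 := mul_le_mul_of_nonneg_left (hmono t ht) hS
    have h3 : ‖e t‖ ≤ ‖e 0‖ + ‖∫ s in (0:ℝ)..t, g s‖ := by
      conv_lhs => rw [h t ht]
      exact norm_add_le _ _
    linarith

lemma gronB14 {E : Type*} [NormedAddCommGroup E] [NormedSpace ℝ E]
    (k : ℝ → ℝ) (e g : ℝ → E) (T : ℝ) (hT : 0 ≤ T)
    (hk : IntervalIntegrable k volume 0 T)
    (hk0 : ∀ t, 0 ≤ k t) (he : ContinuousOn e (Icc 0 T))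
    (hgi : IntervalIntegrable g volume 0 T)
    (hg : ∀ t ∈ Icc 0 T, ‖g t‖ ≤ k t * ‖e t‖)
    (h : ∀ t ∈ Icc 0 T, e t = e 0 + ∫ s in (0:ℝ)..t, g s) :
    ‖e 0‖ ≤ ‖e T‖ * Real.exp (2 * ∫ s in (0:ℝ)..T, k s) := by
  have hTT : uIcc 0 T = Icc 0 T := uIcc_of_le hT
  have hm : ∀ t ∈ Icc 0 T, T - t ∈ Icc 0 T := fun t ht => ⟨by linarith [ht.2], by linarith [ht.1]⟩
  have hk' : IntervalIntegrable (fun t => k (T - t)) volume 0 T := by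
    have := hk.comp_sub_left T
    rw [sub_zero, sub_self] at this
    exact this.symm
  have := gronF14 (fun t => k (T - t)) (fun t => e (T - t)) (fun t => - g (T - t)) 0 T hT
    hk' le_rfl (fun t => hk0 _) (he.comp (by fun_prop) hm)
    (fun t ht => by simpa using hg _ (hm t ht)) ?_ T ⟨hT, le_rfl⟩
  · rw [intervalIntegral.integral_comp_sub_left (fun t => k t)] at this
    simpa using this
  · intro t ht
    simp only [sub_zero, intervalIntegral.integral_neg]
    rw [intervalIntegral.integral_comp_sub_left g, h _ (hm t ht), h T ⟨hT, le_rfl⟩]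
    have h0t : IntervalIntegrable g volume 0 (T - t) := by
      apply hgi.mono_set
      rw [hTT, uIcc_of_le (hm t ht).1]
      exact Icc_subset_Icc_right (hm t ht).2
    have h1 := intervalIntegral.integral_interval_sub_left hgi h0t
    rw [sub_zero, ← h1]
    abel

lemma bdd14 {d k : ℕ} (Ω : Set (Euc d)) (hΩo : IsOpen Ω) (hΩb : Bornology.IsBounded Ω)
    (f : Euc d → Euc d) (hf : MemC0k k Ω f) (j : ℕ) (hj : j ≤ k) :
    ∃ C : ℝ, 0 ≤ C ∧ ∀ x ∈ Ω, ‖iteratedFDeriv ℝ j f x‖ ≤ C := by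
  have hc : IsCompact (closure Ω) := hΩb.isCompact_closure
  have main : ∃ C : ℝ, 0 ≤ C ∧ ∀ x ∈ closure Ω ∩ Ω, ‖iteratedFDeriv ℝ j f x‖ ≤ C := by
    refine hc.induction_on (p := fun s => ∃ C : ℝ, 0 ≤ C ∧ ∀ x ∈ s ∩ Ω,
      ‖iteratedFDeriv ℝ j f x‖ ≤ C) ⟨0, le_rfl, by simp⟩ ?_ ?_ ?_
    · rintro s t hst ⟨C, hC, h⟩
      exact ⟨C, hC, fun x hx => h x ⟨hst hx.1, hx.2⟩⟩
    · rintro s t ⟨C, hC, h⟩ ⟨C', hC', h'⟩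
      refine ⟨max C C', le_max_of_le_left hC, ?_⟩
      rintro x ⟨hx | hx, hxΩ⟩
      · exact (h x ⟨hx, hxΩ⟩).trans (le_max_left _ _)
      · exact (h' x ⟨hx, hxΩ⟩).trans (le_max_right _ _)
    · intro x hx
      have : ∃ l, Tendsto (iteratedFDeriv ℝ j f) (𝓝[Ω] x) (𝓝 l) := by
        by_cases hxΩ : x ∈ Ω
        · exact ⟨_, ((hf.1.contDiffAt (hΩo.mem_nhds hxΩ)).continuousAt_iteratedFDeriv
            (by exact_mod_cast hj)).tendsto.mono_left nhdsWithin_le_nhds⟩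
        · refine ⟨0, hf.2 j hj x ?_⟩
          rw [frontier, hΩo.interior_eq]
          exact ⟨hx, hxΩ⟩
      obtain ⟨l, hl⟩ := this
      have h1 := hl.norm.eventually_le_const (u := ‖l‖ + 1) (by linarith)
      rw [eventually_nhdsWithin_iff] at h1
      refine ⟨_, mem_nhdsWithin_of_mem_nhds h1, ‖l‖ + 1, by positivity, ?_⟩
      intro y hy
      exact hy.1 hy.2
  obtain ⟨C, hC, h⟩ := main
  exact ⟨C, hC, fun x hx => h x ⟨subset_closure hx, hx⟩⟩

lemma bound14 {d k : ℕ} (Ω : Set (Euc d)) (hΩo : IsOpen Ω) (hΩb : Bornology.IsBounded Ω)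
    (f : Euc d → Euc d) (hf : MemC0k k Ω f) (j : ℕ) (hj : j ≤ k) (x : Euc d) (hx : x ∈ Ω) :
    ‖iteratedFDeriv ℝ j f x‖ ≤ CknormOn k Ω f := by
  have h1 : ‖iteratedFDeriv ℝ j f x‖ ≤ ⨆ x ∈ Ω, ‖iteratedFDeriv ℝ j f x‖ := by
    obtain ⟨C, hC, h⟩ := bdd14 Ω hΩo hΩb f hf j hj
    have hb : BddAbove (range fun x => ⨆ (_ : x ∈ Ω), ‖iteratedFDeriv ℝ j f x‖) := by
      refine ⟨C, ?_⟩
      rintro _ ⟨y, rfl⟩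
      exact Real.iSup_le (fun hy => h y hy) hC
    have := le_ciSup hb x
    simpa only [ciSup_pos hx] using this
  refine h1.trans ?_
  unfold CknormOn
  apply Finset.single_le_sum (f := fun j => ⨆ x ∈ Ω, ‖iteratedFDeriv ℝ j f x‖)
  · intro i _
    exact Real.iSup_nonneg fun y => Real.iSup_nonneg fun _ => norm_nonneg _
  · simp; omega

lemma half14 {E : Type*} [NormedAddCommGroup E] [NormedSpace ℝ E] (Ω : Set E) (hΩo : IsOpen Ω)
    (f : E → E) (L : ℝ) (hL : 0 ≤ L) (hd : ∀ x ∈ Ω, DifferentiableAt ℝ f x)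
    (hb : ∀ x ∈ Ω, ‖fderiv ℝ f x‖ ≤ L)
    (hz : ∀ z ∈ frontier Ω, Tendsto f (𝓝[Ω] z) (𝓝 0)) (p q : E) (hp : p ∈ Ω) (hq : q ∉ Ω) :
    ‖f p‖ ≤ L * ‖q - p‖ := by
  set γ : ℝ → E := fun s => p + s • (q - p) with hγ
  have hγc : Continuous γ := by fun_prop
  set S : Set ℝ := Icc 0 1 ∩ γ ⁻¹' Ωᶜ with hS
  have hSc : IsCompact S := isCompact_Icc.inter_right (hΩo.isClosed_compl.preimage hγc)
  have hSn : S.Nonempty := ⟨1, by simp [hS, hγ, hq]⟩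
  have hs0 := hSc.sInf_mem hSn
  set s0 := sInf S
  have hlt : ∀ r ∈ Ico 0 s0, γ r ∈ Ω := by
    intro r hr
    by_contra hc
    have : s0 ≤ r := csInf_le hSc.bddBelow ⟨⟨hr.1, hr.2.le.trans hs0.1.2⟩, hc⟩
    linarith [hr.2]
  have hpos : 0 < s0 := by
    rcases hs0.1.1.eq_or_lt with h | h
    · exfalso
      apply hs0.2
      rw [← h]; simpa [hγ] using hp
    · exact h
  have hev : ∀ᶠ r in 𝓝[<] s0, r ∈ Ico 0 s0 := Ico_mem_nhdsLT hpos
  have ht : Tendsto γ (𝓝[<] s0) (𝓝[Ω] (γ s0)) := by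
    rw [tendsto_nhdsWithin_iff]
    exact ⟨hγc.continuousAt.tendsto.mono_left nhdsWithin_le_nhds, hev.mono hlt⟩
  have hfr : γ s0 ∈ frontier Ω := by
    rw [frontier, hΩo.interior_eq]
    refine ⟨?_, hs0.2⟩
    exact mem_closure_of_tendsto (ht.mono_right nhdsWithin_le_nhds) (hev.mono hlt)
  have hl := ((hz _ hfr).comp ht).sub_const (f p)
  have := le_of_tendsto hl.norm (b := L * ‖q - p‖) ?_
  · simpa using this
  filter_upwards [hev] with r hr
  have hsub : segment ℝ p (γ r) ⊆ Ω := by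
    rw [segment_eq_image']
    rintro _ ⟨θ, hθ, rfl⟩
    have : p + θ • (γ r - p) = γ (θ * r) := by simp [hγ, mul_smul]
    simp only [this]
    apply hlt
    exact ⟨mul_nonneg hθ.1 hr.1, lt_of_le_of_lt (mul_le_of_le_one_left hr.1 hθ.2) hr.2⟩
  have h1 := (convex_segment p (γ r)).norm_image_sub_le_of_norm_hasFDerivWithin_le
    (f := f) (f' := fderiv ℝ f) (C := L)
    (fun x hx => (hd x (hsub hx)).hasFDerivAt.hasFDerivWithinAt) (fun x hx => hb x (hsub hx))
    (left_mem_segment _ _ _) (right_mem_segment _ _ _)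
  refine h1.trans (mul_le_mul_of_nonneg_left ?_ hL)
  have : γ r - p = r • (q - p) := by simp [hγ]
  rw [this, norm_smul, Real.norm_of_nonneg hr.1]
  exact mul_le_of_le_one_left (norm_nonneg _) (hr.2.le.trans hs0.1.2)

lemma lip14 {E : Type*} [NormedAddCommGroup E] [NormedSpace ℝ E] (Ω : Set E) (hΩo : IsOpen Ω)
    (f : E → E) (L : ℝ) (hL : 0 ≤ L) (hd : ∀ x ∈ Ω, DifferentiableAt ℝ f x)
    (hb : ∀ x ∈ Ω, ‖fderiv ℝ f x‖ ≤ L)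
    (hz : ∀ z ∈ frontier Ω, Tendsto f (𝓝[Ω] z) (𝓝 0)) (p q : E) :
    ‖Ω.indicator f p - Ω.indicator f q‖ ≤ L * ‖p - q‖ := by
  have H := half14 Ω hΩo f L hL hd hb hz
  by_cases hp : p ∈ Ω <;> by_cases hq : q ∈ Ω
  · simp only [indicator_of_mem hp, indicator_of_mem hq]
    by_cases hseg : segment ℝ q p ⊆ Ω
    · exact (convex_segment q p).norm_image_sub_le_of_norm_hasFDerivWithin_le
        (f := f) (f' := fderiv ℝ f) (C := L)
        (fun x hx => (hd x (hseg hx)).hasFDerivAt.hasFDerivWithinAt) (fun x hx => hb x (hseg hx))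
        (left_mem_segment _ _ _) (right_mem_segment _ _ _)
    · obtain ⟨w, hw, hwΩ⟩ := not_subset.1 hseg
      have h1 := H p w hp hwΩ
      have h2 := H q w hq hwΩ
      have h3 := dist_add_dist_of_mem_segment hw
      rw [dist_eq_norm, dist_eq_norm, dist_eq_norm, norm_sub_rev q w, norm_sub_rev q p] at h3
      calc ‖f p - f q‖ ≤ ‖f p‖ + ‖f q‖ := norm_sub_le _ _
        _ ≤ L * ‖w - p‖ + L * ‖w - q‖ := add_le_add h1 h2
        _ = _ := by rw [← h3]; ring
  · simpa [hp, hq, norm_sub_rev] using H p q hp hq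
  · simpa [hp, hq] using H q p hq hp
  · simp [hp, hq]; positivity

lemma taylor14 {E : Type*} [NormedAddCommGroup E] [NormedSpace ℝ E]
    (f : E → E) (L : ℝ) (hL : 0 ≤ L) (p q : E)
    (hd : ∀ x ∈ Metric.closedBall p ‖q - p‖, DifferentiableAt ℝ f x)
    (hd2 : ∀ x ∈ Metric.closedBall p ‖q - p‖, DifferentiableAt ℝ (fderiv ℝ f) x)
    (hb : ∀ x ∈ Metric.closedBall p ‖q - p‖, ‖fderiv ℝ (fderiv ℝ f) x‖ ≤ L) :
    ‖f q - f p - fderiv ℝ f p (q - p)‖ ≤ L * ‖q - p‖ ^ 2 := by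
  have hp : p ∈ Metric.closedBall p ‖q - p‖ := Metric.mem_closedBall_self (norm_nonneg _)
  have hq : q ∈ Metric.closedBall p ‖q - p‖ := by rw [mem_closedBall_iff_norm]
  rw [pow_two, ← mul_assoc]
  refine (convex_closedBall p _).norm_image_sub_le_of_norm_hasFDerivWithin_le'
    (f' := fderiv ℝ f) (fun x hx => (hd x hx).hasFDerivAt.hasFDerivWithinAt) ?_ hp hq
  intro x hx
  refine ((convex_closedBall p _).norm_image_sub_le_of_norm_hasFDerivWithin_le
    (f := fderiv ℝ f) (f' := fderiv ℝ (fderiv ℝ f)) (C := L)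
    (fun x hx => (hd2 x hx).hasFDerivAt.hasFDerivWithinAt) hb hp hx).trans ?_
  rw [mem_closedBall_iff_norm] at hx
  gcongr

lemma meas14 {d : ℕ} {V : Type*} [NormedAddCommGroup V] [MeasurableSpace V] [BorelSpace V]
    (F : V → Euc d → Euc d) (c : ℝ)
    (hFl : ∀ f p q, ‖F f p - F f q‖ ≤ c * ‖f‖ * ‖p - q‖)
    (hFb : ∀ f p, ‖F f p‖ ≤ c * ‖f‖)
    (hFm : ∀ p, Measurable fun f => F f p)
    (v : ℝ → V) (hv : Measurable v)
    (hvi : IntegrableOn (fun t => ‖v t‖) (Icc (0:ℝ) 1)) (y : ℝ → Euc d)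
    (hy : AEMeasurable y (volume.restrict (Icc (0:ℝ) 1))) :
    IntegrableOn (fun u => F (v u) (y u)) (Icc (0:ℝ) 1) := by
  have hm : Measurable (Function.uncurry fun p f => F f p) := by
    apply measurable_uncurry_of_continuous_of_measurable _ hFm
    intro f
    exact (LipschitzWith.of_dist_le_mul (K := (c * ‖f‖).toNNReal) fun p q => by
      rw [dist_eq_norm, dist_eq_norm]
      exact (hFl f p q).trans (mul_le_mul_of_nonneg_right (Real.le_coe_toNNReal _)
        (norm_nonneg _))).continuous
  have h1 : AEMeasurable (fun u => F (v u) (y u)) (volume.restrict (Icc (0:ℝ) 1)) :=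
    hm.comp_aemeasurable (hy.prodMk hv.aemeasurable)
  exact (hvi.const_mul c).mono' h1.aestronglyMeasurable (Eventually.of_forall fun u => hFb _ _)

lemma stay14 {d : ℕ} {V : Type*} [NormedAddCommGroup V] [MeasurableSpace V] [BorelSpace V]
    (Ω : Set (Euc d)) (hΩo : IsOpen Ω)
    (F : V → Euc d → Euc d) (c : ℝ) (hc : 0 < c)
    (hFl : ∀ f p q, ‖F f p - F f q‖ ≤ c * ‖f‖ * ‖p - q‖)
    (hFb : ∀ f p, ‖F f p‖ ≤ c * ‖f‖)
    (hFo : ∀ f, ∀ p ∉ Ω, F f p = 0)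
    (hFm : ∀ p, Measurable fun f => F f p)
    (v : ℝ → V) (hv : Measurable v)
    (hvi : IntegrableOn (fun t => ‖v t‖) (Icc (0:ℝ) 1)) (x : Euc d) (hx : x ∈ Ω)
    (y g : ℝ → Euc d) (hg : ∀ u, y u ∈ Ω → g u = F (v u) (y u))
    (hy : ∀ t ∈ Icc (0:ℝ) 1, y t = x + ∫ u in (0:ℝ)..t, g u) :
    ContinuousOn y (Icc 0 1) ∧ IntervalIntegrable (fun u => F (v u) (y u)) volume 0 1 ∧
      (∀ t ∈ Icc (0:ℝ) 1, y t = x + ∫ u in (0:ℝ)..t, F (v u) (y u)) ∧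
      (∀ t ∈ Icc (0:ℝ) 1, y t ∈ Ω) := by
  set B : Set ℝ := {t | t ∈ Icc (0:ℝ) 1 ∧ IntervalIntegrable g volume 0 t} with hB
  have hBd : ∀ t ∈ B, ∀ s, 0 ≤ s → s ≤ t → s ∈ B := by
    intro t ht s hs hst
    refine ⟨⟨hs, hst.trans ht.1.2⟩, ht.2.mono_set ?_⟩
    rw [uIcc_of_le hs, uIcc_of_le (hs.trans hst)]
    exact Icc_subset_Icc_right hst
  have hyB : ∀ t ∈ Icc (0:ℝ) 1, t ∉ B → y t = x := by
    intro t ht htB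
    rw [hy t ht, intervalIntegral.integral_undef, add_zero]
    exact fun h => htB ⟨ht, h⟩
  have hcB' : ∀ t ∈ B, ContinuousOn y (Icc 0 t) := by
    intro t ht
    have h1 := intervalIntegral.continuousOn_primitive_interval (a := 0) (b := t) (f := g)
      (μ := volume) (by
        rw [uIcc_of_le ht.1.1]
        exact (intervalIntegrable_iff_integrableOn_Icc_of_le ht.1.1).1 ht.2)
    rw [uIcc_of_le ht.1.1] at h1
    exact (continuousOn_const.add h1).congr fun s hs => hy s ⟨hs.1, hs.2.trans ht.1.2⟩
  have hcB : ContinuousOn y B := by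
    intro t ht
    by_cases h : ∃ t' ∈ B, t < t'
    · obtain ⟨t', ht', htt⟩ := h
      refine (hcB' t' ht' t ⟨ht.1.1, htt.le⟩).mono_of_mem_nhdsWithin ?_
      filter_upwards [self_mem_nhdsWithin, mem_nhdsWithin_of_mem_nhds (Iio_mem_nhds htt)]
        with s hs hs'
      exact ⟨hs.1.1, le_of_lt hs'⟩
    · push Not at h
      exact (hcB' t ht t ⟨ht.1.1, le_rfl⟩).mono fun s hs => ⟨hs.1.1, h s hs⟩
  have hBm : MeasurableSet B := by
    apply OrdConnected.measurableSet
    refine ⟨fun a ha b hb s hs => hBd b hb s (ha.1.1.trans hs.1) hs.2⟩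
  have hym : AEMeasurable y (volume.restrict (Icc (0:ℝ) 1)) := by
    classical
    have h1 : Measurable (B.piecewise y fun _ => x) :=
      hcB.measurable_piecewise continuousOn_const hBm
    refine ⟨_, h1, ?_⟩
    apply ae_restrict_of_forall_mem measurableSet_Icc
    intro t ht
    by_cases htB : t ∈ B
    · simp [htB]
    · simp [htB, hyB t ht htB]
  have hFi := meas14 F c hFl hFb hFm v hv hvi y hym
  have hFi' : IntervalIntegrable (fun u => F (v u) (y u)) volume 0 1 :=
    (intervalIntegrable_iff_integrableOn_Icc_of_le zero_le_one).2 hFi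
  have hsub : ∀ {G : Type} [NormedAddCommGroup G] {f : ℝ → G}, IntervalIntegrable f volume 0 1 →
      ∀ t ∈ Icc (0:ℝ) 1, IntervalIntegrable f volume 0 t := by
    intro G _ f hf t ht
    apply hf.mono_set
    rw [uIcc_of_le ht.1, uIcc_of_le zero_le_one]
    exact Icc_subset_Icc_right ht.2
  have hy0 : y 0 = x := by simpa using hy 0 ⟨le_rfl, zero_le_one⟩
  have hin : ∀ t ∈ Icc (0:ℝ) 1, y t ∈ Ω := by
    by_contra hcon
    push Not at hcon
    obtain ⟨t0, ht0, ht0Ω⟩ := hcon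
    set S : Set ℝ := {t | t ∈ Icc (0:ℝ) 1 ∧ y t ∉ Ω} with hS
    have hSn : S.Nonempty := ⟨t0, ht0, ht0Ω⟩
    have hSb : BddBelow S := ⟨0, fun t ht => ht.1.1⟩
    set σ := sInf S with hσ
    have hσ0 : 0 ≤ σ := le_csInf hSn fun t ht => ht.1.1
    have hσ1 : σ ≤ 1 := (csInf_le hSb ⟨ht0, ht0Ω⟩).trans ht0.2
    have hlt : ∀ t, 0 ≤ t → t < σ → y t ∈ Ω := by
      intro t h0 hts
      by_contra h
      have : σ ≤ t := csInf_le hSb ⟨⟨h0, hts.le.trans hσ1⟩, h⟩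
      linarith
    have hae : ∀ t ∈ Icc 0 σ, ∀ᵐ u ∂(volume : Measure ℝ), u ∈ uIoc 0 t → F (v u) (y u) = g u := by
      intro t ht
      have : ∀ᵐ u ∂(volume : Measure ℝ), u ≠ σ := by
        simp [ae_iff]
      filter_upwards [this] with u hu hut
      rw [uIoc_of_le ht.1] at hut
      exact (hg u (hlt u hut.1.le (lt_of_le_of_ne (hut.2.trans ht.2) hu))).symm
    have hσB : σ ∈ B := by
      refine ⟨⟨hσ0, hσ1⟩, ?_⟩
      refine (hsub hFi' σ ⟨hσ0, hσ1⟩).congr_ae ?_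
      rw [EventuallyEq, ae_restrict_iff' measurableSet_uIoc]
      exact hae σ ⟨hσ0, le_rfl⟩
    have hyσ : y σ ∉ Ω := by
      intro h
      have h1 : ∀ᶠ t in 𝓝[B] σ, y t ∈ Ω := (hcB σ hσB).eventually (hΩo.mem_nhds h)
      obtain ⟨ε, hε, hεB⟩ := Metric.mem_nhdsWithin_iff.1 h1
      obtain ⟨t, htS, htlt⟩ := exists_lt_of_csInf_lt hSn (show sInf S < σ + ε by linarith)
      have hσt : σ ≤ t := csInf_le hSb htS
      have htB : t ∈ B := by
        by_contra htB
        exact htS.2 (by rw [hyB t htS.1 htB]; exact hx)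
      apply htS.2
      apply hεB ⟨?_, htB⟩
      rw [Metric.mem_ball, Real.dist_eq, abs_of_nonneg (by linarith)]
      linarith
    have hk : IntervalIntegrable (fun t => c * ‖v t‖) volume 0 1 :=
      (intervalIntegrable_iff_integrableOn_Icc_of_le zero_le_one).2 (hvi.const_mul c)
    have := gronB14 (fun t => c * ‖v t‖) (fun t => y t - y σ) (fun u => F (v u) (y u)) σ hσ0
      (hsub hk σ ⟨hσ0, hσ1⟩) (fun t => by positivity) ((hcB' σ hσB).sub continuousOn_const)
      (hsub hFi' σ ⟨hσ0, hσ1⟩)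
      (fun t ht => by simpa [hFo _ _ hyσ] using hFl (v t) (y t) (y σ)) ?_
    · simp only [sub_self, norm_zero, zero_mul, norm_le_zero_iff, sub_eq_zero, hy0] at this
      exact hyσ (this ▸ hx)
    · intro t ht
      rw [hy0, hy t ⟨ht.1, ht.2.trans hσ1⟩, intervalIntegral.integral_congr_ae (hae t ht)]
      abel
  have hint : ∀ t ∈ Icc (0:ℝ) 1, y t = x + ∫ u in (0:ℝ)..t, F (v u) (y u) := by
    intro t ht
    rw [hy t ht]
    congr 1
    apply intervalIntegral.integral_congr
    intro u hu
    rw [uIcc_of_le ht.1] at hu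
    exact hg u (hin u ⟨hu.1, hu.2.trans ht.2⟩)
  refine ⟨?_, hFi', hint, hin⟩
  have h1 := intervalIntegral.continuousOn_primitive_interval (a := 0) (b := 1)
    (f := (fun u => F (v u) (y u)))
      (μ := volume) (by rwa [uIcc_of_le zero_le_one])
  rw [uIcc_of_le zero_le_one] at h1
  exact (continuousOn_const.add h1).congr hint

def Traj14 {d : ℕ} {V : Type*} (F : V → Euc d → Euc d) (v : ℝ → V) (x : Euc d) (y : ℝ → Euc d) :
    Prop :=
  ContinuousOn y (Icc 0 1) ∧ IntervalIntegrable (fun u => F (v u) (y u)) volume 0 1 ∧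
      (∀ t ∈ Icc (0:ℝ) 1, y t = x + ∫ u in (0:ℝ)..t, F (v u) (y u))

lemma ii14 {G : Type*} [NormedAddCommGroup G] {f : ℝ → G} (hf : IntervalIntegrable f volume 0 1)
    (t : ℝ) (ht : t ∈ Icc (0:ℝ) 1) : IntervalIntegrable f volume 0 t := by
  apply hf.mono_set
  rw [uIcc_of_le ht.1, uIcc_of_le zero_le_one]
  exact Icc_subset_Icc_right ht.2

lemma Traj14.zero {d : ℕ} {V : Type*} {F : V → Euc d → Euc d} {v : ℝ → V} {x : Euc d}
    {y : ℝ → Euc d} (h : Traj14 F v x y) : y 0 = x := by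
  simpa using h.2.2 0 ⟨le_rfl, zero_le_one⟩

lemma comp14 {d : ℕ} {V : Type*} (F : V → Euc d → Euc d) (v : ℝ → V) (k : ℝ → ℝ) (K : ℝ)
    (hk : IntervalIntegrable k volume 0 1) (hk0 : ∀ t, 0 ≤ k t)
    (hK : ∫ t in (0:ℝ)..1, k t ≤ K)
    (hFl : ∀ u p q, ‖F (v u) p - F (v u) q‖ ≤ k u * ‖p - q‖)
    (x x' : Euc d) (y y' : ℝ → Euc d) (hy : Traj14 F v x y) (hy' : Traj14 F v x' y')
    (t : ℝ) (ht : t ∈ Icc (0:ℝ) 1) :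
    ‖y t - y' t‖ ≤ ‖x - x'‖ * Real.exp (2 * K) ∧ ‖x - x'‖ ≤ ‖y t - y' t‖ * Real.exp (2 * K) := by
  have hmem : ∀ s ∈ Icc 0 t, s ∈ Icc (0:ℝ) 1 := fun s hs => ⟨hs.1, hs.2.trans ht.2⟩
  have hKt : ∫ s in (0:ℝ)..t, k s ≤ K :=
    (intervalIntegral.integral_mono_interval le_rfl ht.1 ht.2 (Eventually.of_forall hk0) hk).trans hK
  have hi : ∀ s ∈ Icc 0 t, y s - y' s = y 0 - y' 0 +
      ∫ u in (0:ℝ)..s, (F (v u) (y u) - F (v u) (y' u)) := by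
    intro s hs
    rw [intervalIntegral.integral_sub (ii14 hy.2.1 s (hmem s hs)) (ii14 hy'.2.1 s (hmem s hs)),
      hy.2.2 s (hmem s hs), hy'.2.2 s (hmem s hs), hy.zero, hy'.zero]
    abel
  have hcont : ContinuousOn (fun s => y s - y' s) (Icc 0 t) := (hy.1.sub hy'.1).mono hmem
  have h1 := gronF14 k (fun s => y s - y' s) (fun u => F (v u) (y u) - F (v u) (y' u)) 0 t ht.1
    (ii14 hk t ht) le_rfl hk0 hcont (fun s hs => by simpa using hFl s (y s) (y' s)) hi t
    ⟨ht.1, le_rfl⟩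
  have h2 := gronB14 k (fun s => y s - y' s) (fun u => F (v u) (y u) - F (v u) (y' u)) t ht.1
    (ii14 hk t ht) hk0 hcont (ii14 (hy.2.1.sub hy'.2.1) t ht)
    (fun s hs => hFl s (y s) (y' s)) hi
  simp only [hy.zero, hy'.zero, zero_mul, add_zero] at h1 h2
  refine ⟨h1.trans ?_, h2.trans ?_⟩ <;> gcongr

lemma approx14 {d : ℕ} {V : Type*} (F : V → Euc d → Euc d) (v : ℝ → V) (k : ℝ → ℝ) (K : ℝ)
    (hk : IntervalIntegrable k volume 0 1) (hk0 : ∀ t, 0 ≤ k t)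
    (hK : ∫ t in (0:ℝ)..1, k t ≤ K)
    (A : ℝ → Euc d →L[ℝ] Euc d) (hA : ∀ u ∈ Icc (0:ℝ) 1, ‖A u‖ ≤ k u)
    (x h l : Euc d) (a b : ℝ) (y0 y1 y2 y3 : ℝ → Euc d) (hy0 : Traj14 F v x y0)
    (hy1 : Traj14 F v (x + (a • h + b • l)) y1) (hy2 : Traj14 F v (x + h) y2)
    (hy3 : Traj14 F v (x + l) y3)
    (hFl : ∀ u p q, ‖F (v u) p - F (v u) q‖ ≤ k u * ‖p - q‖)
    (hT1 : ∀ u ∈ Icc (0:ℝ) 1, ‖F (v u) (y1 u) - F (v u) (y0 u) - A u (y1 u - y0 u)‖ ≤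
      k u * ‖y1 u - y0 u‖ ^ 2)
    (hT2 : ∀ u ∈ Icc (0:ℝ) 1, ‖F (v u) (y2 u) - F (v u) (y0 u) - A u (y2 u - y0 u)‖ ≤
      k u * ‖y2 u - y0 u‖ ^ 2)
    (hT3 : ∀ u ∈ Icc (0:ℝ) 1, ‖F (v u) (y3 u) - F (v u) (y0 u) - A u (y3 u - y0 u)‖ ≤
      k u * ‖y3 u - y0 u‖ ^ 2) :
    ‖(y1 1 - y0 1) - a • (y2 1 - y0 1) - b • (y3 1 - y0 1)‖ ≤
      (Real.exp (2 * K)) ^ 2 * K * Real.exp (2 * K) *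
        (‖a • h + b • l‖ ^ 2 + |a| * ‖h‖ ^ 2 + |b| * ‖l‖ ^ 2) := by
  set Q := ‖a • h + b • l‖ ^ 2 + |a| * ‖h‖ ^ 2 + |b| * ‖l‖ ^ 2 with hQ
  have hQ0 : 0 ≤ Q := by positivity
  set X := Real.exp (2 * K) with hX
  have hX0 : 0 ≤ X := Real.exp_nonneg _
  have hKn : 0 ≤ ∫ s in (0:ℝ)..1, k s :=
    intervalIntegral.integral_nonneg zero_le_one fun r _ => hk0 r
  have hc1 : ∀ u ∈ Icc (0:ℝ) 1, ‖y1 u - y0 u‖ ≤ ‖a • h + b • l‖ * X := fun u hu => by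
    simpa using (comp14 F v k K hk hk0 hK hFl _ _ _ _ hy1 hy0 u hu).1
  have hc2 : ∀ u ∈ Icc (0:ℝ) 1, ‖y2 u - y0 u‖ ≤ ‖h‖ * X := fun u hu => by
    simpa using (comp14 F v k K hk hk0 hK hFl _ _ _ _ hy2 hy0 u hu).1
  have hc3 : ∀ u ∈ Icc (0:ℝ) 1, ‖y3 u - y0 u‖ ≤ ‖l‖ * X := fun u hu => by
    simpa using (comp14 F v k K hk hk0 hK hFl _ _ _ _ hy3 hy0 u hu).1
  set f : ℝ → (ℝ → Euc d) → Euc d := fun u y => F (v u) (y u) with hf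
  have h1 := gronF14 k (fun t => (y1 t - y0 t) - a • (y2 t - y0 t) - b • (y3 t - y0 t))
    (fun u => (f u y1 - f u y0) - a • (f u y2 - f u y0) - b • (f u y3 - f u y0)) (X ^ 2 * Q) 1
    zero_le_one hk (by positivity) hk0 ?_ ?_ ?_ 1 ⟨zero_le_one, le_rfl⟩
  · have h0 : (y1 0 - y0 0) - a • (y2 0 - y0 0) - b • (y3 0 - y0 0) = 0 := by
      rw [hy0.zero, hy1.zero, hy2.zero, hy3.zero]; simp
    simp only [h0, norm_zero, zero_add] at h1
    refine h1.trans ?_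
    calc X ^ 2 * Q * (∫ s in (0:ℝ)..1, k s) * Real.exp (2 * ∫ s in (0:ℝ)..1, k s)
        ≤ X ^ 2 * Q * K * Real.exp (2 * K) := by gcongr; exact mul_nonneg (by positivity) (hKn.trans hK)
      _ = _ := by rw [← hX]; ring
  · exact ((hy1.1.sub hy0.1).sub ((hy2.1.sub hy0.1).const_smul a)).sub
      ((hy3.1.sub hy0.1).const_smul b)
  · intro u hu
    have e1 : (f u y1 - f u y0) - a • (f u y2 - f u y0) - b • (f u y3 - f u y0) =
      A u ((y1 u - y0 u) - a • (y2 u - y0 u) - b • (y3 u - y0 u)) +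
      ((f u y1 - f u y0 - A u (y1 u - y0 u)) - a • (f u y2 - f u y0 - A u (y2 u - y0 u))
        - b • (f u y3 - f u y0 - A u (y3 u - y0 u))) := by
      simp only [map_sub, map_smul, smul_sub]
      abel
    rw [e1]
    refine (norm_add_le _ _).trans (add_le_add ?_ ?_)
    · exact ((A u).le_opNorm _).trans (mul_le_mul_of_nonneg_right (hA u hu) (norm_nonneg _))
    · refine (norm_sub_le _ _).trans ((add_le_add_left (norm_sub_le _ _) _).trans ?_)
      rw [norm_smul, norm_smul, Real.norm_eq_abs, Real.norm_eq_abs]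
      have k0 := hk0 u
      have i1 : ‖f u y1 - f u y0 - A u (y1 u - y0 u)‖ ≤ k u * (‖a • h + b • l‖ * X) ^ 2 :=
        (hT1 u hu).trans (by have := hc1 u hu; gcongr)
      have i2 : ‖f u y2 - f u y0 - A u (y2 u - y0 u)‖ ≤ k u * (‖h‖ * X) ^ 2 :=
        (hT2 u hu).trans (by have := hc2 u hu; gcongr)
      have i3 : ‖f u y3 - f u y0 - A u (y3 u - y0 u)‖ ≤ k u * (‖l‖ * X) ^ 2 :=
        (hT3 u hu).trans (by have := hc3 u hu; gcongr)
      calc _ ≤ k u * (‖a • h + b • l‖ * X) ^ 2 + |a| * (k u * (‖h‖ * X) ^ 2) +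
            |b| * (k u * (‖l‖ * X) ^ 2) := by gcongr
        _ = _ := by rw [hQ]; ring
  · intro t ht
    have g0 : IntervalIntegrable (fun u => f u y0) volume 0 t := ii14 hy0.2.1 t ht
    have g1 : IntervalIntegrable (fun u => f u y1) volume 0 t := ii14 hy1.2.1 t ht
    have g2 : IntervalIntegrable (fun u => f u y2) volume 0 t := ii14 hy2.2.1 t ht
    have g3 : IntervalIntegrable (fun u => f u y3) volume 0 t := ii14 hy3.2.1 t ht
    have g10 : IntervalIntegrable (fun u => f u y1 - f u y0) volume 0 t := g1.sub g0
    have g20 : IntervalIntegrable (fun u => a • (f u y2 - f u y0)) volume 0 t :=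
      (g2.sub g0).smul a
    have g30 : IntervalIntegrable (fun u => b • (f u y3 - f u y0)) volume 0 t :=
      (g3.sub g0).smul b
    rw [intervalIntegral.integral_sub (g10.sub g20) g30, intervalIntegral.integral_sub g10 g20,
      intervalIntegral.integral_smul, intervalIntegral.integral_smul,
      intervalIntegral.integral_sub g1 g0, intervalIntegral.integral_sub g2 g0,
      intervalIntegral.integral_sub g3 g0]
    rw [hy0.zero, hy1.zero, hy2.zero, hy3.zero, hy0.2.2 t ht, hy1.2.2 t ht, hy2.2.2 t ht,
      hy3.2.2 t ht]
    simp only [smul_sub, smul_add]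
    abel

lemma linear14 {E : Type*} [NormedAddCommGroup E] [NormedSpace ℝ E] [FiniteDimensional ℝ E]
    (N : E → E) (δ C : ℝ) (hδ : 0 < δ)
    (hN : ∀ (a b : ℝ) (h l : E), ‖h‖ ≤ δ → ‖l‖ ≤ δ → ‖a • h + b • l‖ ≤ δ →
      ‖N (a • h + b • l) - a • N h - b • N l‖ ≤
        C * (‖a • h + b • l‖ ^ 2 + |a| * ‖h‖ ^ 2 + |b| * ‖l‖ ^ 2)) :
    ∃ Z : E →L[ℝ] E, ∀ h, ‖h‖ ≤ δ → ‖N h - Z h‖ ≤ C * ‖h‖ ^ 2 := by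
  have : CompleteSpace E := FiniteDimensional.complete ℝ E
  set r : ℕ → ℝ := fun n => 1 / ((n:ℝ) + 1) with hr
  have hr0 : ∀ n, 0 < r n := fun n => by positivity
  have hrt : Tendsto r atTop (𝓝 0) := tendsto_one_div_add_atTop_nhds_zero_nat
  set s : ℕ → E → E := fun n h => (r n)⁻¹ • N (r n • h) with hs
  have hsm : ∀ h : E, ∀ᶠ n in atTop, ‖r n • h‖ ≤ δ := by
    intro h
    have : Tendsto (fun n => ‖r n • h‖) atTop (𝓝 0) := by
      simpa using (hrt.smul_const h).norm
    exact this.eventually_le_const hδ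
  have N1 : ∀ (a : ℝ) (h : E), ‖h‖ ≤ δ → ‖a • h‖ ≤ δ →
      ‖N (a • h) - a • N h‖ ≤ C * (‖a • h‖ ^ 2 + |a| * ‖h‖ ^ 2) := by
    intro a h h1 h2
    have := hN a 0 h 0 h1 (by simpa using hδ.le) (by simpa using h2)
    simpa using this
  have hcs : ∀ h n m, ‖r n • h‖ ≤ δ → ‖r m • h‖ ≤ δ →
      ‖s m h - s n h‖ ≤ C * ‖h‖ ^ 2 * (r m + r n) := by
    intro h n m hn hm
    have e1 : (r m / r n) • (r n • h) = r m • h := by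
      rw [smul_smul, div_mul_cancel₀ _ (hr0 n).ne']
    have h1 := N1 (r m / r n) (r n • h) hn (by rwa [e1])
    rw [e1, abs_of_pos (div_pos (hr0 m) (hr0 n)), norm_smul, norm_smul,
      Real.norm_of_nonneg (hr0 m).le, Real.norm_of_nonneg (hr0 n).le] at h1
    have e2 : s m h - s n h = (r m)⁻¹ • (N (r m • h) - (r m / r n) • N (r n • h)) := by
      simp only [hs, smul_sub, smul_smul]
      congr 2
      have := (hr0 m).ne'
      field_simp
    rw [e2, norm_smul, Real.norm_of_nonneg (inv_nonneg.2 (hr0 m).le)]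
    refine (mul_le_mul_of_nonneg_left h1 (inv_nonneg.2 (hr0 m).le)).trans (le_of_eq ?_)
    have := (hr0 m).ne'
    have := (hr0 n).ne'
    field_simp
  have hlim : ∀ h, ∃ l, Tendsto (fun n => s n h) atTop (𝓝 l) := by
    intro h
    apply cauchySeq_tendsto_of_complete
    obtain ⟨n0, hn0⟩ := eventually_atTop.1 (hsm h)
    rw [Metric.cauchySeq_iff]
    intro ε hε
    have : Tendsto (fun n => C * ‖h‖ ^ 2 * r n) atTop (𝓝 0) := by
      simpa using hrt.const_mul (C * ‖h‖ ^ 2)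
    obtain ⟨n1, hn1⟩ := eventually_atTop.1 (this.eventually_lt_const (half_pos hε))
    refine ⟨max n0 n1, fun m hm n hn => ?_⟩
    rw [dist_eq_norm]
    have h1 := hcs h n m (hn0 n (le_of_max_le_left hn)) (hn0 m (le_of_max_le_left hm))
    have h2 := hn1 n (le_of_max_le_right hn)
    have h3 := hn1 m (le_of_max_le_right hm)
    linarith
  choose Z hZ using hlim
  have hlin : ∀ (a b : ℝ) (h l : E), Z (a • h + b • l) = a • Z h + b • Z l := by
    intro a b h l
    have h1 : Tendsto (fun n => s n (a • h + b • l) - a • s n h - b • s n l) atTop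
        (𝓝 (Z (a • h + b • l) - a • Z h - b • Z l)) :=
      ((hZ _).sub ((hZ h).const_smul a)).sub ((hZ l).const_smul b)
    have h2 : Tendsto (fun n => s n (a • h + b • l) - a • s n h - b • s n l) atTop (𝓝 0) := by
      apply squeeze_zero_norm' (a := fun n =>
        C * (‖a • h + b • l‖ ^ 2 + |a| * ‖h‖ ^ 2 + |b| * ‖l‖ ^ 2) * r n)
      · filter_upwards [hsm h, hsm l, hsm (a • h + b • l)] with n n1 n2 n3
        have e : r n • (a • h + b • l) = a • (r n • h) + b • (r n • l) := by
          rw [smul_add, smul_comm (r n) a, smul_comm (r n) b]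
        have h3 := hN a b (r n • h) (r n • l) n1 n2 (by rwa [← e])
        rw [← e, norm_smul, norm_smul, norm_smul, Real.norm_of_nonneg (hr0 n).le] at h3
        have e2 : s n (a • h + b • l) - a • s n h - b • s n l = (r n)⁻¹ •
            (N (r n • (a • h + b • l)) - a • N (r n • h) - b • N (r n • l)) := by
          simp only [hs, smul_sub]
          rw [smul_comm a, smul_comm b]
        rw [e2, norm_smul, Real.norm_of_nonneg (inv_nonneg.2 (hr0 n).le)]
        refine (mul_le_mul_of_nonneg_left h3 (inv_nonneg.2 (hr0 n).le)).trans (le_of_eq ?_)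
        have := (hr0 n).ne'
        field_simp
      · simpa using hrt.const_mul (C * (‖a • h + b • l‖ ^ 2 + |a| * ‖h‖ ^ 2 + |b| * ‖l‖ ^ 2))
    have h3 := tendsto_nhds_unique h1 h2
    rw [sub_sub, sub_eq_zero] at h3
    exact h3
  let Zl : E →ₗ[ℝ] E :=
    { toFun := Z
      map_add' := fun h l => by simpa using hlin 1 1 h l
      map_smul' := fun a h => by simpa using hlin a 0 h 0 }
  refine ⟨LinearMap.toContinuousLinearMap Zl, fun h hh => ?_⟩
  have hval : (LinearMap.toContinuousLinearMap Zl) h = Z h := rfl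
  rw [hval]
  have h1 : Tendsto (fun n => ‖N h - s n h‖) atTop (𝓝 ‖N h - Z h‖) :=
    ((hZ h).const_sub (N h)).norm
  have h2 : Tendsto (fun n => C * ‖h‖ ^ 2 * (1 + r n)) atTop (𝓝 (C * ‖h‖ ^ 2 * (1 + 0))) :=
    (hrt.const_add 1).const_mul _
  rw [add_zero, mul_one] at h2
  refine le_of_tendsto_of_tendsto h1 h2 ?_
  filter_upwards [hsm h] with n hn
  have h0 : s 0 h = N h := by simp [hs, hr]
  have h3 := hcs h n 0 hn (by simpa [hr] using hh)
  rw [h0] at h3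
  simpa [hr] using h3

lemma diff14 {d : ℕ} (Ω : Set (Euc d)) (hΩo : IsOpen Ω) (hΩb : Bornology.IsBounded Ω)
    {V : Type*} [NormedAddCommGroup V] [InnerProductSpace ℝ V]
    [MeasurableSpace V] [BorelSpace V]
    (ι : V →ₗ[ℝ] (Euc d → Euc d))
    (c : ℝ) (hc : 0 < c)
    (hemb : ∀ f : V, MemC0k 2 Ω (ι f) ∧ CknormOn 2 Ω (ι f) ≤ c * ‖f‖)
    (Φ : (ℝ → V) → ℝ → ℝ → Euc d → Euc d)
    (hflow : ∀ v : ℝ → V, InV01 v → ∀ s ∈ Icc (0:ℝ) 1, ∀ t ∈ Icc (0:ℝ) 1, ∀ x ∈ Ω,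
      Φ v s t x = x + ∫ u in s..t, ι (v u) (Φ v s u x))
    (M : ℝ) (x : Euc d) (hx : x ∈ Ω) :
    ∃ δ > 0, ∃ C : ℝ, ∃ X : ℝ, 0 ≤ C ∧ (∀ h, ‖h‖ ≤ δ → x + h ∈ Ω) ∧
      ∀ v : ℝ → V, InV01 v → normV01 v ≤ M →
      ∃ Z : Euc d →L[ℝ] Euc d, ∀ h, ‖h‖ ≤ δ →
        ‖Φ v 0 1 (x + h) - Φ v 0 1 x - Z h‖ ≤ C * ‖h‖ ^ 2 ∧
        ‖h‖ ≤ ‖Φ v 0 1 (x + h) - Φ v 0 1 x‖ * X := by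
  obtain ⟨r, hr, hrΩ⟩ := Metric.isOpen_iff.1 hΩo x hx
  set K : ℝ := c * ((1 + M ^ 2) / 2) with hKdef
  have hK0 : 0 ≤ K := by positivity
  set X := Real.exp (2 * K) with hX
  have hX1 : 1 ≤ X := Real.one_le_exp (by positivity)
  have hX0 : 0 < X := by linarith
  set δ := r / (2 * X ^ 2) with hδdef
  have hδ : 0 < δ := by positivity
  have hδr : δ < r := by
    rw [hδdef, div_lt_iff₀ (by positivity)]
    have : 1 ≤ X ^ 2 := one_le_pow₀ hX1
    nlinarith
  have hδX : δ * X * X < r := by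
    have : δ * X * X = r / 2 := by rw [hδdef]; field_simp
    linarith
  have hball : ∀ h, ‖h‖ ≤ δ → x + h ∈ Ω := by
    intro h hh
    apply hrΩ
    simp only [Metric.mem_ball, dist_self_add_left]
    linarith
  refine ⟨δ, hδ, X ^ 2 * K * X, X, by positivity, hball, ?_⟩
  intro v hv hvM
  -- facts on the fields
  have hbd : ∀ (f : V) (j : ℕ), j ≤ 2 → ∀ p ∈ Ω, ‖iteratedFDeriv ℝ j (ι f) p‖ ≤ c * ‖f‖ :=
    fun f j hj p hp => (bound14 Ω hΩo hΩb (ι f) (hemb f).1 j hj p hp).trans (hemb f).2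
  have hb0 : ∀ (f : V), ∀ p ∈ Ω, ‖ι f p‖ ≤ c * ‖f‖ := by
    intro f p hp
    simpa using hbd f 0 (by norm_num) p hp
  have hb1 : ∀ (f : V), ∀ p ∈ Ω, ‖fderiv ℝ (ι f) p‖ ≤ c * ‖f‖ := by
    intro f p hp
    simpa only [norm_iteratedFDeriv_one] using hbd f 1 (by norm_num) p hp
  have hb2 : ∀ (f : V), ∀ p ∈ Ω, ‖fderiv ℝ (fderiv ℝ (ι f)) p‖ ≤ c * ‖f‖ := by
    intro f p hp
    have := hbd f 2 le_rfl p hp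
    rwa [← norm_iteratedFDeriv_fderiv, norm_iteratedFDeriv_one] at this
  have hcd : ∀ (f : V), ∀ p ∈ Ω, ContDiffAt ℝ 2 (ι f) p := fun f p hp =>
    (hemb f).1.1.contDiffAt (hΩo.mem_nhds hp)
  have hd1 : ∀ (f : V), ∀ p ∈ Ω, DifferentiableAt ℝ (ι f) p := fun f p hp =>
    (hcd f p hp).differentiableAt (by norm_num)
  have hd2 : ∀ (f : V), ∀ p ∈ Ω, DifferentiableAt ℝ (fderiv ℝ (ι f)) p := fun f p hp =>
    ((hcd f p hp).fderiv_right (m := 1) (by norm_num)).differentiableAt (by norm_num)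
  set F : V → Euc d → Euc d := fun f => Ω.indicator (ι f) with hF
  have hFl : ∀ f p q, ‖F f p - F f q‖ ≤ c * ‖f‖ * ‖p - q‖ := by
    intro f p q
    refine lip14 Ω hΩo (ι f) _ (by positivity) (hd1 f) (hb1 f) ?_ p q
    intro z hz
    have := (hemb f).1.2 0 (by norm_num) z hz
    rw [tendsto_zero_iff_norm_tendsto_zero] at this ⊢
    simpa using this
  have hFb : ∀ f p, ‖F f p‖ ≤ c * ‖f‖ := by
    intro f p
    by_cases hp : p ∈ Ω
    · simpa [hF, hp] using hb0 f p hp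
    · simp [hF, hp]; positivity
  have hFo : ∀ f, ∀ p ∉ Ω, F f p = 0 := fun f p hp => by simp [hF, hp]
  have hFi : ∀ f, ∀ p ∈ Ω, F f p = ι f p := fun f p hp => by simp [hF, hp]
  have hFm : ∀ p, Measurable fun f => F f p := by
    intro p
    by_cases hp : p ∈ Ω
    · let l : V →ₗ[ℝ] Euc d := (LinearMap.proj p).comp ι
      have h1 : (fun f => F f p) = l.mkContinuous c (fun f => hb0 f p hp) := by
        funext f
        exact hFi f p hp
      rw [h1]
      exact (ContinuousLinearMap.continuous _).measurable
    · simp only [hFo _ p hp]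
      exact measurable_const
  -- integrability of the speed
  have hfin : IsFiniteMeasure ((volume : Measure ℝ).restrict (Icc (0:ℝ) 1)) := inferInstance
  have hmaj : IntegrableOn (fun t => (1 + ‖v t‖ ^ 2) / 2) (Icc (0:ℝ) 1) :=
    ((integrable_const (1:ℝ)).add hv.2).div_const 2
  have hle : ∀ t, ‖v t‖ ≤ (1 + ‖v t‖ ^ 2) / 2 := fun t => by nlinarith [sq_nonneg (‖v t‖ - 1)]
  have hvi : IntegrableOn (fun t => ‖v t‖) (Icc (0:ℝ) 1) :=
    hmaj.mono' hv.1.norm.aestronglyMeasurable (Eventually.of_forall fun t => by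
      rw [norm_norm]; exact hle t)
  set k : ℝ → ℝ := fun t => c * ‖v t‖ with hk
  have hk0 : ∀ t, 0 ≤ k t := fun t => by positivity
  have hki : IntervalIntegrable k volume 0 1 :=
    (intervalIntegrable_iff_integrableOn_Icc_of_le zero_le_one).2 (hvi.const_mul c)
  have hv2 : IntervalIntegrable (fun t => ‖v t‖ ^ 2) volume 0 1 :=
    (intervalIntegrable_iff_integrableOn_Icc_of_le zero_le_one).2 hv.2
  have hK : ∫ t in (0:ℝ)..1, k t ≤ K := by
    have h1 : ∫ t in (0:ℝ)..1, k t ≤ ∫ t in (0:ℝ)..1, c * ((1 + ‖v t‖ ^ 2) / 2) := by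
      apply intervalIntegral.integral_mono_on zero_le_one hki
      · exact (intervalIntegrable_iff_integrableOn_Icc_of_le zero_le_one).2 (hmaj.const_mul c)
      · intro t _
        exact mul_le_mul_of_nonneg_left (hle t) hc.le
    rw [intervalIntegral.integral_const_mul c (fun t => (1 + ‖v t‖ ^ 2) / 2),
      intervalIntegral.integral_div,
      intervalIntegral.integral_add (by simp) hv2] at h1
    have h2 := (Real.sqrt_le_iff.1 hvM).2
    refine h1.trans ?_
    rw [hKdef]
    simp only [intervalIntegral.integral_const, sub_zero, smul_eq_mul, mul_one]
    gcongr
  have hFl' : ∀ u p q, ‖F (v u) p - F (v u) q‖ ≤ k u * ‖p - q‖ := fun u p q => hFl (v u) p q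
  -- trajectories
  have htr : ∀ p ∈ Ω, Traj14 F v p (fun t => Φ v 0 t p) ∧
      ∀ t ∈ Icc (0:ℝ) 1, Φ v 0 t p ∈ Ω := by
    intro p hp
    obtain ⟨h1, h2, h3, h4⟩ := stay14 Ω hΩo F c hc hFl hFb hFo hFm v hv.1 hvi p hp
      (fun t => Φ v 0 t p) (fun u => ι (v u) (Φ v 0 u p)) (fun u hu => (hFi _ _ hu).symm)
      (fun t ht => hflow v hv 0 ⟨le_rfl, zero_le_one⟩ t ht p hp)
    exact ⟨⟨h1, h2, h3⟩, h4⟩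
  have hconst : ∀ w ∉ Ω, Traj14 F v w (fun _ => w) := by
    intro w hw
    refine ⟨continuousOn_const, ?_, ?_⟩ <;> simp [hFo _ w hw]
  have hcomp := fun p p' y y' => comp14 F v k K hki hk0 hK hFl' p p' y y'
  have hT : ∀ h, ‖h‖ ≤ δ → ∀ u ∈ Icc (0:ℝ) 1,
      ‖F (v u) (Φ v 0 u (x + h)) - F (v u) (Φ v 0 u x) -
        fderiv ℝ (ι (v u)) (Φ v 0 u x) (Φ v 0 u (x + h) - Φ v 0 u x)‖ ≤
      k u * ‖Φ v 0 u (x + h) - Φ v 0 u x‖ ^ 2 := by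
    intro h hh u hu
    have hq := (htr (x + h) (hball h hh)).2 u hu
    have hp := (htr x hx).2 u hu
    rw [hFi _ _ hq, hFi _ _ hp]
    have h1 := (hcomp _ _ _ _ (htr (x + h) (hball h hh)).1 (htr x hx).1 u hu).1
    simp only [add_sub_cancel_left] at h1
    have hsub : Metric.closedBall (Φ v 0 u x) ‖Φ v 0 u (x + h) - Φ v 0 u x‖ ⊆ Ω := by
      intro w hw
      by_contra hwΩ
      have h2 := (hcomp _ _ _ _ (htr x hx).1 (hconst w hwΩ) u hu).2
      have h3 : r ≤ ‖x - w‖ := by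
        by_contra hlt
        push Not at hlt
        exact hwΩ (hrΩ (by rw [mem_ball_iff_norm']; exact hlt))
      rw [mem_closedBall_iff_norm'] at hw
      have h4 : ‖Φ v 0 u x - w‖ ≤ δ * X :=
        hw.trans (h1.trans (mul_le_mul_of_nonneg_right hh hX0.le))
      have h5 := mul_le_mul_of_nonneg_right h4 hX0.le
      linarith
    exact taylor14 (ι (v u)) (k u) (hk0 u) _ _ (fun z hz => hd1 _ z (hsub hz))
      (fun z hz => hd2 _ z (hsub hz)) (fun z hz => hb2 _ z (hsub hz))
  obtain ⟨Z, hZ⟩ := linear14 (fun h => Φ v 0 1 (x + h) - Φ v 0 1 x) δ (X ^ 2 * K * X) hδ (by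
    intro a b h l hh hl hhl
    exact approx14 F v k K hki hk0 hK (fun u => fderiv ℝ (ι (v u)) (Φ v 0 u x))
      (fun u hu => hb1 _ _ ((htr x hx).2 u hu)) x h l a b (fun t => Φ v 0 t x)
      (fun t => Φ v 0 t (x + (a • h + b • l))) (fun t => Φ v 0 t (x + h))
      (fun t => Φ v 0 t (x + l)) (htr x hx).1 (htr _ (hball _ hhl)).1 (htr _ (hball _ hh)).1
      (htr _ (hball _ hl)).1 hFl' (hT _ hhl) (hT _ hh) (hT _ hl))
  refine ⟨Z, fun h hh => ⟨hZ h hh, ?_⟩⟩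
  have := (hcomp _ _ _ _ (htr (x + h) (hball h hh)).1 (htr x hx).1 1 ⟨zero_le_one, le_rfl⟩).2
  simpa using this

lemma deriv14 {E : Type*} [NormedAddCommGroup E] [NormedSpace ℝ E] (f : E → E) (x : E)
    (δ C : ℝ) (hδ : 0 < δ) (Z : E →L[ℝ] E)
    (h : ∀ h, ‖h‖ ≤ δ → ‖f (x + h) - f x - Z h‖ ≤ C * ‖h‖ ^ 2) : fderiv ℝ f x = Z := by
  apply HasFDerivAt.fderiv
  rw [hasFDerivAt_iff_isLittleO_nhds_zero]
  have h1 : (fun h => f (x + h) - f x - Z h) =O[𝓝 0] fun h : E => ‖h‖ ^ 2 := by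
    apply Asymptotics.IsBigO.of_bound C
    have : ∀ᶠ h : E in 𝓝 0, ‖h‖ < δ := by
      have := Metric.ball_mem_nhds (0:E) hδ
      filter_upwards [this] with y hy
      simpa using hy
    filter_upwards [this] with y hy
    simpa using h y hy.le
  exact h1.trans_isLittleO (Asymptotics.isLittleO_norm_pow_id one_lt_two)

lemma inj14 {E : Type*} [NormedAddCommGroup E] [NormedSpace ℝ E] (N : E → E)
    (δ C X : ℝ) (hδ : 0 < δ) (Z : E →L[ℝ] E)
    (h : ∀ h, ‖h‖ ≤ δ → ‖N h - Z h‖ ≤ C * ‖h‖ ^ 2 ∧ ‖h‖ ≤ ‖N h‖ * X) (h0 : E) (hZ : Z h0 = 0) :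
    h0 = 0 := by
  by_contra hne
  have hpos : 0 < ‖h0‖ := norm_pos_iff.2 hne
  -- the inequality s * n ≤ C * s ^ 2 * n ^ 2 * |X| for small s
  have ht : Tendsto (fun s : ℝ => C * s * ‖h0‖ ^ 2 * |X|) (𝓝[>] 0) (𝓝 (C * 0 * ‖h0‖ ^ 2 * |X|)) := by
    apply Tendsto.mono_left _ nhdsWithin_le_nhds
    exact (Continuous.tendsto (by fun_prop) 0)
  have hs : Tendsto (fun s : ℝ => s * ‖h0‖) (𝓝[>] 0) (𝓝 (0 * ‖h0‖)) := by
    apply Tendsto.mono_left _ nhdsWithin_le_nhds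
    exact (Continuous.tendsto (by fun_prop) 0)
  rw [zero_mul] at hs
  have : ‖h0‖ ≤ C * 0 * ‖h0‖ ^ 2 * |X| := by
    refine ge_of_tendsto ht ?_
    filter_upwards [hs.eventually_le_const hδ, self_mem_nhdsWithin] with s h1 h2
    have h2 : 0 < s := h2
    have hn : ‖s • h0‖ = s * ‖h0‖ := by rw [norm_smul, Real.norm_of_nonneg h2.le]
    obtain ⟨h3, h4⟩ := h (s • h0) (by rwa [hn])
    rw [map_smul, hZ, smul_zero, sub_zero, hn] at h3
    rw [hn] at h4
    have h5 : ‖N (s • h0)‖ * X ≤ C * (s * ‖h0‖) ^ 2 * |X| :=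
      (mul_le_mul_of_nonneg_left (le_abs_self X) (norm_nonneg _)).trans
        (mul_le_mul_of_nonneg_right h3 (abs_nonneg _))
    have h6 : s * ‖h0‖ ≤ s * (C * s * ‖h0‖ ^ 2 * |X|) := by
      refine (h4.trans h5).trans (le_of_eq (by ring))
    exact le_of_mul_le_mul_left h6 h2
  simp at this
  exact hne this

lemma det14 {d : ℕ} (Z : ℕ → Euc d →L[ℝ] Euc d) (Z0 : Euc d →L[ℝ] Euc d)
    (h : ∀ x, Tendsto (fun m => Z m x) atTop (𝓝 (Z0 x))) :
    Tendsto (fun m => (Z m).det) atTop (𝓝 Z0.det) := by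
  have b := (EuclideanSpace.basisFun (Fin d) ℝ).toBasis
  have e : ∀ A : Euc d →L[ℝ] Euc d, A.det = (LinearMap.toMatrix b b (A : Euc d →ₗ[ℝ] Euc d)).det :=
    fun A => by rw [LinearMap.det_toMatrix]
  simp only [e]
  apply ((continuous_id.matrix_det).tendsto _).comp
  refine tendsto_pi_nhds.2 fun i => tendsto_pi_nhds.2 fun j => ?_
  simp only [LinearMap.toMatrix_apply]
  have hc : Continuous fun y : Euc d => b.repr y i :=
    ((b.coord i).continuous_of_finiteDimensional)
  exact (hc.tendsto _).comp (h (b j))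

/-- if `v^m` is a bounded sequence in `V^{[0,1]}` converging weakly to
`v̂`, and the flows converge uniformly in `t ∈ [0,1]` at each `x ∈ Ω`, then the
log-Jacobian-determinants of the time-one maps converge pointwise:
`log det Dφ^{v^m}_1(x) → log det Dφ^{v̂}_1(x)`. -/
theorem stmt_14 {d : ℕ} (Ω : Set (Euc d)) (hΩo : IsOpen Ω) (hΩb : Bornology.IsBounded Ω)
    (V : Type*) [NormedAddCommGroup V] [InnerProductSpace ℝ V] [CompleteSpace V]
    [MeasurableSpace V] [BorelSpace V]
    (ι : V →ₗ[ℝ] (Euc d → Euc d)) (hinj : Function.Injective ι)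
    (c : ℝ) (hc : 0 < c)
    (hemb : ∀ f : V, MemC0k 2 Ω (ι f) ∧ CknormOn 2 Ω (ι f) ≤ c * ‖f‖)
    (Φ : (ℝ → V) → ℝ → ℝ → Euc d → Euc d)
    (hflow : ∀ v : ℝ → V, InV01 v → ∀ s ∈ Icc (0:ℝ) 1, ∀ t ∈ Icc (0:ℝ) 1, ∀ x ∈ Ω,
      Φ v s t x = x + ∫ u in s..t, ι (v u) (Φ v s u x))
    (vm : ℕ → ℝ → V) (hvm : ∀ m, InV01 (vm m))
    (M : ℝ) (hM : ∀ m, normV01 (vm m) ≤ M)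
    (vhat : ℝ → V) (hvhat : InV01 vhat)
    (hweak : ∀ w : ℝ → V, InV01 w →
      Tendsto (fun m => ∫ t in (0:ℝ)..1, ⟪vm m t, w t⟫) atTop
        (𝓝 (∫ t in (0:ℝ)..1, ⟪vhat t, w t⟫)))
    (huc : ∀ x ∈ Ω,
      TendstoUniformlyOn (fun m t => Φ (vm m) 0 t x) (fun t => Φ vhat 0 t x) atTop
        (Icc (0:ℝ) 1)) :
    ∀ x ∈ Ω,
      Tendsto (fun m => Real.log ((fderiv ℝ (Φ (vm m) 0 1) x).det)) atTop
        (𝓝 (Real.log ((fderiv ℝ (Φ vhat 0 1) x).det))) := by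
  intro x hx
  obtain ⟨δ, hδ, C, X, hC, hball, hmain⟩ := diff14 Ω hΩo hΩb ι c hc hemb Φ hflow
    (max M (normV01 vhat)) x hx
  have hZm := fun m => hmain (vm m) (hvm m) ((hM m).trans (le_max_left _ _))
  choose Z hZ using hZm
  obtain ⟨Z0, hZ0⟩ := hmain vhat hvhat (le_max_right _ _)
  have e1 : ∀ m, fderiv ℝ (Φ (vm m) 0 1) x = Z m := fun m =>
    deriv14 _ x δ C hδ (Z m) fun h hh => (hZ m h hh).1
  have e0 : fderiv ℝ (Φ vhat 0 1) x = Z0 := deriv14 _ x δ C hδ Z0 fun h hh => (hZ0 h hh).1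
  simp only [e1, e0]
  have hdet0 : Z0.det ≠ 0 := by
    intro h0
    have h1 := LinearMap.bot_lt_ker_of_det_eq_zero (f := (Z0 : Euc d →ₗ[ℝ] Euc d)) h0
    obtain ⟨w, hw, hw0⟩ := (Submodule.ne_bot_iff _).1 h1.ne'
    exact hw0 (inj14 (fun h => Φ vhat 0 1 (x + h) - Φ vhat 0 1 x) δ C X hδ Z0 hZ0 w
      (by simpa using hw))
  refine ((Real.continuousAt_log hdet0).tendsto).comp (det14 Z Z0 ?_)
  intro h
  have hpt : ∀ p ∈ Ω, Tendsto (fun m => Φ (vm m) 0 1 p) atTop (𝓝 (Φ vhat 0 1 p)) := fun p hp =>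
    (huc p hp).tendsto_at ⟨zero_le_one, le_rfl⟩
  rw [Metric.tendsto_atTop']
  intro ε hε
  have hs1 : Tendsto (fun s : ℝ => s * ‖h‖) (𝓝[>] 0) (𝓝 (0 * ‖h‖)) :=
    Tendsto.mono_left (Continuous.tendsto (by fun_prop) 0) nhdsWithin_le_nhds
  have hs2 : Tendsto (fun s : ℝ => (2 * C * ‖h‖ ^ 2 + 1) * s) (𝓝[>] 0)
      (𝓝 ((2 * C * ‖h‖ ^ 2 + 1) * 0)) :=
    Tendsto.mono_left (Continuous.tendsto (by fun_prop) 0) nhdsWithin_le_nhds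
  rw [zero_mul] at hs1
  rw [mul_zero] at hs2
  obtain ⟨s, h1, h2, h3⟩ := ((hs1.eventually_le_const hδ).and
    ((hs2.eventually_lt_const hε).and self_mem_nhdsWithin)).exists
  have h3 : 0 < s := h3
  have hn : ‖s • h‖ = s * ‖h‖ := by rw [norm_smul, Real.norm_of_nonneg h3.le]
  have hsδ : ‖s • h‖ ≤ δ := by rwa [hn]
  have hlim := ((hpt _ (hball _ hsδ)).sub (hpt x hx))
  have hev := Metric.tendsto_atTop'.1 hlim (s ^ 2) (by positivity)
  obtain ⟨n0, hn0⟩ := hev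
  refine ⟨n0, fun m hm => ?_⟩
  have h4 := hn0 m hm
  have h5 := (hZ m _ hsδ).1
  have h6 := (hZ0 _ hsδ).1
  rw [dist_eq_norm] at h4 ⊢
  rw [hn, map_smul] at h5 h6
  set a := Φ (vm m) 0 1 (x + s • h) - Φ (vm m) 0 1 x
  set b := Φ vhat 0 1 (x + s • h) - Φ vhat 0 1 x
  have h7 : s * ‖Z m h - Z0 h‖ ≤ s * ((2 * C * ‖h‖ ^ 2 + 1) * s) := by
    have : s • (Z m h - Z0 h) = (a - b) - (a - s • Z m h) + (b - s • Z0 h) := by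
      rw [smul_sub]; abel
    rw [← Real.norm_of_nonneg h3.le, ← norm_smul, Real.norm_of_nonneg h3.le, this]
    refine ((norm_add_le _ _).trans (add_le_add_left (norm_sub_le _ _) _)).trans ?_
    nlinarith
  exact (le_of_mul_le_mul_left h7 h3).trans_lt h2
end
end
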